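/- arXiv:1507.03241 — 2 statements merged into one kernel-verified Lean document; each statement's English description precedes it below -/
import Mathlib

section
/- Let 1 < p < 2 with conjugate exponent p', and let p' ≤ q < ∞. Suppose X is a (real or complex) Banach space containing a complemented copy of ℓ_p, witnessed by operators P ∈ L(X, ℓ_p) and Q ∈ L(ℓ_p, X) with P∘Q = id. Suppose Ŷ is a Banach space containing a copy of ℓ_q, and let Ĵ : ℓ_q → Ŷ be any isomorphic embedding. Then there exists an operator Û ∈ L(ℓ_p, ℓ_q) which is both finitely strictly singular and superstrictly cosingular, such that Ĵ∘Û∘P does not belong to the closed linear span in L(X, Ŷ) of the set of operators from X to Ŷ that factor through the Hilbert space ℓ₂. -/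
open scoped ENNReal

noncomputable section

def FinStrictSing {𝕜 X Y : Type*} [NontriviallyNormedField 𝕜]
    [NormedAddCommGroup X] [NormedSpace 𝕜 X] [NormedAddCommGroup Y] [NormedSpace 𝕜 Y]
    (T : X →L[𝕜] Y) : Prop :=
  ∀ ε : ℝ, 0 < ε → ∃ n : ℕ, ∀ E : Submodule 𝕜 X, Module.finrank 𝕜 E = n →
    ∃ x ∈ E, x ≠ 0 ∧ ‖T x‖ < ε * ‖x‖

def SupStrictCosing {𝕜 X Y : Type*} [NontriviallyNormedField 𝕜]
    [NormedAddCommGroup X] [NormedSpace 𝕜 X] [NormedAddCommGroup Y] [NormedSpace 𝕜 Y]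
    (T : X →L[𝕜] Y) : Prop :=
  ∀ ε : ℝ, 0 < ε → ∃ N : ℕ, ∀ n : ℕ, N ≤ n → ∀ E : Submodule 𝕜 Y,
    IsClosed (E : Set Y) → Module.finrank 𝕜 (Y ⧸ E) = n →
    ∃ x : X, ‖x‖ = 1 ∧ Metric.infDist (T x) (E : Set Y) < ε

/-- The closed linear span of the operators `X → Y` factoring through the Hilbert
space `ℓ₂`. -/
def closedSpanHilbertFactorable (𝕜 X Y : Type*) [RCLike 𝕜]
    [NormedAddCommGroup X] [NormedSpace 𝕜 X] [NormedAddCommGroup Y] [NormedSpace 𝕜 Y] :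
    Submodule 𝕜 (X →L[𝕜] Y) :=
  (Submodule.span 𝕜 {T : X →L[𝕜] Y | ∃ (A : X →L[𝕜] lp (fun _ : ℕ => 𝕜) 2)
      (B : lp (fun _ : ℕ => 𝕜) 2 →L[𝕜] Y), T = B.comp A}).topologicalClosure

lemma aux_pow_quad (m : ℕ) : ∀ ρ : ℝ, 1 ≤ ρ → ρ ≤ m + 2 → ∃ C : ℝ, 0 ≤ C ∧
    ∀ u : ℝ, -1 ≤ u → u ≤ 3 → (1 + u) ^ ρ ≤ 1 + ρ * u + C * u ^ 2 := by
  induction m with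
  | zero =>
    intro ρ h1 h2
    refine ⟨ρ - 1, by linarith, fun u hu hu3 => ?_⟩
    have hb : (1 + u) ^ (ρ - 1) ≤ 1 + (ρ - 1) * u :=
      rpow_one_add_le_one_add_mul_self hu (by linarith) (by norm_num at h2; linarith)
    have h0 : 0 ≤ 1 + u := by linarith
    have : (1 + u) ^ ρ = (1 + u) ^ (ρ - 1) * (1 + u) := by
      rcases h0.eq_or_lt with h | h
      · rw [← h, Real.zero_rpow (by linarith)]; simp
      · rw [← Real.rpow_add_one h.ne']; simp
    rw [this]
    nlinarith [mul_le_mul_of_nonneg_right hb h0]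
  | succ m ih =>
    intro ρ h1 h2
    by_cases h : ρ ≤ 2
    · exact ih ρ h1 (by have : (0:ℝ) ≤ m := by positivity
                        linarith)
    · push Not at h
      obtain ⟨C, hC, hq⟩ := ih (ρ - 1) (by linarith) (by push_cast at h2; linarith)
      refine ⟨ρ + 4 * C, by linarith, fun u hu hu3 => ?_⟩
      have h0 : 0 ≤ 1 + u := by linarith
      have e : (1 + u) ^ ρ = (1 + u) ^ (ρ - 1) * (1 + u) := by
        rcases h0.eq_or_lt with h | h
        · rw [← h, Real.zero_rpow (by linarith)]; simp
        · rw [← Real.rpow_add_one h.ne']; simp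
      rw [e]
      have := mul_le_mul_of_nonneg_right (hq u hu hu3) h0
      have h3 : 0 ≤ C * u^2 * (3 - u) := by
        have : 0 ≤ 3 - u := by linarith
        positivity
      nlinarith [sq_nonneg u]

lemma aux_scalar (𝕜 : Type*) [RCLike 𝕜] (r : ℝ) (hr : 2 < r) : ∃ C : ℝ, 0 ≤ C ∧
    ∀ z : 𝕜, ‖1 + z‖ ^ r ≤ 1 + r * RCLike.re z + C * (‖z‖ ^ 2 + ‖z‖ ^ r) := by
  obtain ⟨m, hm⟩ := exists_nat_ge (r / 2)
  obtain ⟨C, hC, hq⟩ := aux_pow_quad m (r / 2) (by linarith) (by linarith)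
  refine ⟨9 * C + r + 2 ^ r, by positivity, fun z => ?_⟩
  have hre : |RCLike.re z| ≤ ‖z‖ := RCLike.abs_re_le_norm z
  obtain ⟨hre1, hre2⟩ := abs_le.1 hre
  have hz0 := norm_nonneg z
  have hzr : 0 ≤ ‖z‖ ^ r := by positivity
  have h2r : (0:ℝ) < 2 ^ r := by positivity
  rcases le_total ‖z‖ 1 with hz | hz
  · have hsq : ‖1 + z‖ ^ 2 = 1 + (2 * RCLike.re z + ‖z‖ ^ 2) := by
      have := norm_add_sq (𝕜 := 𝕜) (1 : 𝕜) z
      simp at this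
      rw [this]; ring
    have hun := sq_nonneg ‖1 + z‖
    have e : ‖1 + z‖ ^ r = (1 + (2 * RCLike.re z + ‖z‖ ^ 2)) ^ (r / 2) := by
      rw [← hsq, ← Real.rpow_natCast, ← Real.rpow_mul (norm_nonneg _)]
      congr 1; push_cast; ring
    rw [e]
    have := hq (2 * RCLike.re z + ‖z‖ ^ 2) (by linarith) (by nlinarith)
    have hu2 : (2 * RCLike.re z + ‖z‖ ^ 2) ^ 2 ≤ 9 * ‖z‖ ^ 2 := by
      have h1 : |2 * RCLike.re z + ‖z‖ ^ 2| ≤ |3 * ‖z‖| := by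
        rw [abs_of_nonneg (by positivity : 0 ≤ 3 * ‖z‖)]
        rw [abs_le]; constructor <;> nlinarith
      have := sq_le_sq.2 h1
      nlinarith
    have h9 := mul_le_mul_of_nonneg_left hu2 hC
    have : 0 ≤ (9 * C + r + 2 ^ r) * ‖z‖ ^ r := by positivity
    have : 0 ≤ (2 ^ r) * ‖z‖ ^ 2 := by positivity
    nlinarith [sq_nonneg ‖z‖]
  · have h1 : ‖1 + z‖ ≤ 2 * ‖z‖ := by
      have := norm_add_le (1 : 𝕜) z
      simp at this; linarith
    have h2 : ‖1 + z‖ ^ r ≤ 2 ^ r * ‖z‖ ^ r := by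
      rw [← Real.mul_rpow (by norm_num) hz0]
      exact Real.rpow_le_rpow (norm_nonneg _) h1 (by linarith)
    have h3 : ‖z‖ ≤ ‖z‖ ^ r := by
      conv_lhs => rw [← Real.rpow_one ‖z‖]
      exact Real.rpow_le_rpow_of_exponent_le hz (by linarith)
    have : 0 ≤ (9 * C + r + 2 ^ r) * ‖z‖ ^ 2 := by positivity
    have : 0 ≤ (9 * C) * ‖z‖ ^ r := by positivity
    nlinarith

/-- Walsh matrix. -/
def walsh (k : ℕ) (i j : Fin k → Bool) : ℝ := ∏ t, (if i t && j t then -1 else 1)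

lemma walsh_sq (k : ℕ) (i j : Fin k → Bool) : walsh k i j * walsh k i j = 1 := by
  unfold walsh
  rw [← Finset.prod_mul_distrib]
  apply Finset.prod_eq_one
  intro t _
  split_ifs <;> norm_num

lemma walsh_symm (k : ℕ) (i j : Fin k → Bool) : walsh k i j = walsh k j i := by
  unfold walsh
  simp [Bool.and_comm]

lemma walsh_orth (k : ℕ) (i i' : Fin k → Bool) :
    ∑ j, walsh k i j * walsh k i' j = if i = i' then (Fintype.card (Fin k → Bool) : ℝ) else 0 := by
  unfold walsh
  simp_rw [← Finset.prod_mul_distrib]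
  have := Finset.prod_univ_sum (fun _ : Fin k => (Finset.univ : Finset Bool))
    (fun t b => ((if i t && b then (-1:ℝ) else 1) * (if i' t && b then (-1:ℝ) else 1)))
  rw [Fintype.piFinset_univ] at this
  rw [← this]
  have h2 : ∀ t, ∑ b : Bool, ((if i t && b then (-1:ℝ) else 1) * (if i' t && b then (-1:ℝ) else 1))
      = if i t = i' t then 2 else 0 := by
    intro t
    cases i t <;> cases i' t <;> norm_num
  simp_rw [h2]
  split_ifs with h
  · subst h; simp
  · obtain ⟨t, ht⟩ := Function.ne_iff.1 h
    exact Finset.prod_eq_zero (Finset.mem_univ t) (by simp [ht])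

lemma aux_bern (e Y : ℝ) (he : 0 < e) (hY : 0 ≤ Y) :
    1 + Y + min e 1 * Y * (1 + Y) ^ e ≤ (1 + Y) ^ (1 + e) := by
  have h1 : 0 < 1 + Y := by linarith
  set s := Y / (1 + Y) with hs
  have hs0 : 0 ≤ s := by positivity
  have hs1 : s ≤ 1 := by rw [hs, div_le_one h1]; linarith
  have hsY : 1 - s = (1 + Y)⁻¹ := by rw [hs]; field_simp; ring
  have key : (1 - s) ^ e ≤ 1 - min e 1 * s := by
    rcases le_total e 1 with h | h
    · rw [min_eq_left h]
      have := rpow_one_add_le_one_add_mul_self (s := -s) (by linarith) he.le h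
      simpa [sub_eq_add_neg] using this
    · rw [min_eq_right h]
      have := Real.rpow_le_rpow_of_exponent_ge' (x := 1 - s) (by linarith) (by linarith)
        zero_le_one h
      simpa using this
  rw [hsY, Real.inv_rpow h1.le] at key
  have hp : 0 < (1 + Y) ^ e := by positivity
  rw [Real.rpow_add h1, Real.rpow_one]
  have k2 := mul_le_mul_of_nonneg_left key (mul_pos h1 hp).le
  have e1 : (1 + Y) * (1 + Y) ^ e * ((1 + Y) ^ e)⁻¹ = 1 + Y := by field_simp
  have e2 : (1 + Y) * s = Y := by rw [hs]; field_simp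
  have e3 : (1 + Y) * (1 + Y) ^ e * (1 - min e 1 * s)
    = (1 + Y) * (1 + Y) ^ e - min e 1 * ((1 + Y) * s) * (1 + Y) ^ e := by ring
  rw [e1, e3, e2] at k2
  linarith

section base
variable {𝕜 : Type*} [RCLike 𝕜] {J : Type*} [Fintype J] [DecidableEq J]

lemma aux_l2 (w : J → J → ℝ)
    (horth : ∀ j j', ∑ i, w j i * w j' i = if j = j' then (Fintype.card J : ℝ) else 0)
    (v : J → 𝕜) :
    ∑ i, ‖∑ j, (w j i : 𝕜) * v j‖ ^ 2 = Fintype.card J * ∑ j, ‖v j‖ ^ 2 := by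
  have : ((∑ i, ‖∑ j, (w j i : 𝕜) * v j‖ ^ 2 : ℝ) : 𝕜)
      = ((Fintype.card J * ∑ j, ‖v j‖ ^ 2 : ℝ) : 𝕜) := by
    push_cast
    simp_rw [← RCLike.conj_mul, map_sum, map_mul, RCLike.conj_ofReal, Finset.sum_mul_sum]
    rw [Finset.sum_comm, Finset.mul_sum]
    refine Finset.sum_congr rfl fun j _ => ?_
    rw [Finset.sum_comm]
    have : ∀ j', ∑ i, (w j i : 𝕜) * (starRingEnd 𝕜) (v j) * ((w j' i : 𝕜) * v j')
        = ((∑ i, w j i * w j' i : ℝ) : 𝕜) * ((starRingEnd 𝕜) (v j) * v j') := by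
      intro j'
      push_cast
      rw [Finset.sum_mul]
      exact Finset.sum_congr rfl fun i _ => by ring
    simp_rw [this, horth]
    rw [Finset.sum_eq_single j]
    · simp
    · intro b _ hb; simp [hb.symm]
    · simp
  exact_mod_cast this

lemma aux_base_norm (w : J → J → ℝ) (hw : ∀ i j, w i j * w i j = 1)
    (horth : ∀ j j', ∑ i, w j i * w j' i = if j = j' then (Fintype.card J : ℝ) else 0)
    (r σ η C : ℝ) (hr : 2 < r) (hσ1 : 1 < σ) (hσ2 : σ < 2) (hη0 : 0 ≤ η) (hη1 : η ≤ 1)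
    (hC : 0 ≤ C) (hS : ∀ z : 𝕜, ‖1 + z‖ ^ r ≤ 1 + r * RCLike.re z + C * (‖z‖ ^ 2 + ‖z‖ ^ r))
    (hcond : η * C * (1 + (Fintype.card J : ℝ) ^ ((σ - 1) * ((r - 2) / σ)))
      ≤ min ((r - σ) / σ) 1)
    (v : J → 𝕜) (j0 : J) (hv0 : v j0 = 1) (hv : ∀ j, ‖v j‖ ≤ 1) :
    η / Fintype.card J * ∑ i, ‖∑ j, (w j i : 𝕜) * v j‖ ^ r + (1 - η) * ∑ j, ‖v j‖ ^ r
      ≤ (∑ j, ‖v j‖ ^ σ) ^ (r / σ) := by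
  set n : ℝ := ((Fintype.card J : ℕ) : ℝ) with hn
  have hnpos : 0 < n := by
    have : 0 < Fintype.card J := Fintype.card_pos_iff.2 ⟨j0⟩
    rw [hn]; exact_mod_cast this
  -- tail vector
  set y : J → 𝕜 := Function.update v j0 0 with hy
  have hy0 : y j0 = 0 := by simp [hy]
  have hyne : ∀ j, j ≠ j0 → y j = v j := fun j h => by simp [hy, h]
  have hyle : ∀ j, ‖y j‖ ≤ 1 := by
    intro j
    by_cases h : j = j0
    · rw [h, hy0]; simp
    · rw [hyne j h]; exact hv j
  have hvy : ∀ j, v j = (if j = j0 then 1 else 0) + y j := by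
    intro j
    by_cases h : j = j0
    · subst h; simp [hy0, hv0]
    · simp [h, hyne j h]
  set g : J → 𝕜 := fun i => ∑ j, (w j i : 𝕜) * y j with hg
  set Y : ℝ := ∑ j, ‖y j‖ ^ σ with hY
  have hY0 : 0 ≤ Y := Finset.sum_nonneg fun j _ => by positivity
  have hsumpow : ∀ a : ℝ, 0 < a → ∑ j, ‖v j‖ ^ a = 1 + ∑ j, ‖y j‖ ^ a := by
    intro a ha
    rw [← Finset.add_sum_erase _ _ (Finset.mem_univ j0),
      ← Finset.add_sum_erase _ (fun j => ‖y j‖ ^ a) (Finset.mem_univ j0), hv0, hy0]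
    simp only [norm_one, Real.one_rpow, norm_zero, Real.zero_rpow ha.ne', zero_add]
    congr 1
    exact Finset.sum_congr rfl fun j hj => by rw [hyne j (Finset.ne_of_mem_erase hj)]
  have hwabs : ∀ i j, |w i j| = 1 := by
    intro i j
    have := hw i j
    have h2 : |w i j| * |w i j| = 1 := by rw [abs_mul_abs_self]; exact this
    nlinarith [abs_nonneg (w i j)]
  have hG : ∀ i, ∑ j, (w j i : 𝕜) * v j = (w j0 i : 𝕜) * (1 + (w j0 i : 𝕜) * g i) := by
    intro i
    have h1 : ((w j0 i : 𝕜)) * (w j0 i : 𝕜) = 1 := by exact_mod_cast hw j0 i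
    have : ∑ j, (w j i : 𝕜) * v j = (w j0 i : 𝕜) + g i := by
      simp_rw [hvy, mul_add, Finset.sum_add_distrib, hg]
      simp
    rw [this, mul_add, ← mul_assoc, h1]; ring
  have hGn : ∀ i, ‖∑ j, (w j i : 𝕜) * v j‖ = ‖1 + (w j0 i : 𝕜) * g i‖ := by
    intro i
    rw [hG, norm_mul, RCLike.norm_ofReal, hwabs, one_mul]
  have hlin : ∑ i, (w j0 i : 𝕜) * g i = 0 := by
    simp_rw [hg, Finset.mul_sum]
    rw [Finset.sum_comm]
    refine Finset.sum_eq_zero fun j _ => ?_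
    have : ∑ i, (w j0 i : 𝕜) * ((w j i : 𝕜) * y j) = ((∑ i, w j0 i * w j i : ℝ) : 𝕜) * y j := by
      push_cast
      rw [Finset.sum_mul]
      exact Finset.sum_congr rfl fun i _ => by ring
    rw [this, horth]
    by_cases h : j = j0
    · rw [h, hy0, mul_zero]
    · rw [if_neg (Ne.symm h)]; simp
  have hlinre : ∑ i, RCLike.re ((w j0 i : 𝕜) * g i) = 0 := by
    rw [← map_sum, hlin]; simp
  have hgn : ∀ i, ‖(w j0 i : 𝕜) * g i‖ = ‖g i‖ := by
    intro i; rw [norm_mul, RCLike.norm_ofReal, hwabs, one_mul]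
  have hg2 : ∑ i, ‖g i‖ ^ 2 ≤ n * Y := by
    rw [hg, aux_l2 w horth y]
    refine mul_le_mul_of_nonneg_left (Finset.sum_le_sum fun j _ => ?_) hnpos.le
    rw [← Real.rpow_natCast]
    exact Real.rpow_le_rpow_of_exponent_ge_of_imp (norm_nonneg _) (hyle j)
      (by push_cast; linarith) (by intro _ h; norm_num at h)
  set f : ℝ := (r - 2) / σ with hf
  have hf0 : 0 < f := div_pos (by linarith) (by linarith)
  have hgsup : ∀ i, ‖g i‖ ^ (r - 2) ≤ n ^ ((σ - 1) * f) * Y ^ f := by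
    intro i
    have h1 : ‖g i‖ ≤ ∑ j, ‖y j‖ := by
      refine (norm_sum_le _ _).trans (Finset.sum_le_sum fun j _ => ?_)
      rw [norm_mul, RCLike.norm_ofReal, hwabs, one_mul]
    have h2 : (∑ j, ‖y j‖) ^ σ ≤ n ^ (σ - 1) * Y := by
      have := Real.rpow_sum_le_const_mul_sum_rpow (Finset.univ : Finset J) (fun j => ‖y j‖) hσ1.le
      simpa [hn] using this
    calc ‖g i‖ ^ (r - 2) ≤ (∑ j, ‖y j‖) ^ (r - 2) :=
          Real.rpow_le_rpow (norm_nonneg _) h1 (by linarith)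
      _ = ((∑ j, ‖y j‖) ^ σ) ^ f := by
          rw [← Real.rpow_mul (Finset.sum_nonneg fun j _ => norm_nonneg _), hf]
          congr 1; field_simp
      _ ≤ (n ^ (σ - 1) * Y) ^ f := by
          refine Real.rpow_le_rpow ?_ h2 hf0.le
          exact Real.rpow_nonneg (Finset.sum_nonneg fun j _ => norm_nonneg _) _
      _ = _ := by
          rw [Real.mul_rpow (by positivity) hY0, ← Real.rpow_mul hnpos.le]
  have hgr : ∑ i, ‖g i‖ ^ r ≤ n ^ ((σ - 1) * f) * Y ^ f * (n * Y) := by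
    calc ∑ i, ‖g i‖ ^ r ≤ ∑ i, n ^ ((σ - 1) * f) * Y ^ f * ‖g i‖ ^ 2 := by
          refine Finset.sum_le_sum fun i _ => ?_
          have : ‖g i‖ ^ r = ‖g i‖ ^ (r - 2) * ‖g i‖ ^ 2 := by
            rw [← Real.rpow_natCast, ← Real.rpow_add' (norm_nonneg _)]
            · congr 1; push_cast; ring
            · push_cast; linarith
          rw [this]
          exact mul_le_mul_of_nonneg_right (hgsup i) (by positivity)
      _ ≤ _ := by
          rw [← Finset.mul_sum]
          exact mul_le_mul_of_nonneg_left hg2 (by positivity)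
  have hmain : ∑ i, ‖∑ j, (w j i : 𝕜) * v j‖ ^ r
      ≤ n + C * (n * Y + n ^ ((σ - 1) * f) * Y ^ f * (n * Y)) := by
    calc ∑ i, ‖∑ j, (w j i : 𝕜) * v j‖ ^ r
        ≤ ∑ i, (1 + r * RCLike.re ((w j0 i : 𝕜) * g i) + C * (‖g i‖ ^ 2 + ‖g i‖ ^ r)) := by
          refine Finset.sum_le_sum fun i _ => ?_
          rw [hGn]
          have := hS ((w j0 i : 𝕜) * g i)
          rwa [hgn] at this
      _ = n + C * (∑ i, ‖g i‖ ^ 2 + ∑ i, ‖g i‖ ^ r) := by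
          rw [Finset.sum_add_distrib, Finset.sum_add_distrib, ← Finset.mul_sum, hlinre,
            ← Finset.mul_sum, Finset.sum_add_distrib]
          simp [hn]
      _ ≤ _ := by gcongr
  have hyr : ∑ j, ‖y j‖ ^ r ≤ Y := Finset.sum_le_sum fun j _ =>
    Real.rpow_le_rpow_of_exponent_ge_of_imp (norm_nonneg _) (hyle j)
      (by linarith) (by intro _ h; linarith)
  rw [hsumpow r (by linarith), hsumpow σ (by linarith)]
  set e : ℝ := (r - σ) / σ with he
  have he0 : 0 < e := div_pos (by linarith) (by linarith)
  have hre : r / σ = 1 + e := by rw [he]; field_simp; ring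
  rw [hre]
  refine le_trans ?_ (aux_bern e Y he0 hY0)
  have hYe1 : 1 ≤ (1 + Y) ^ e := Real.one_le_rpow (by linarith) he0.le
  have hYf : Y ^ f ≤ (1 + Y) ^ e := by
    calc Y ^ f ≤ (1 + Y) ^ f := Real.rpow_le_rpow hY0 (by linarith) hf0.le
      _ ≤ (1 + Y) ^ e := Real.rpow_le_rpow_of_exponent_le (by linarith) (by
          rw [hf, he]; gcongr)
  set D : ℝ := n ^ ((σ - 1) * f) with hD
  have hD0 : 0 ≤ D := by positivity
  set T : ℝ := (1 + Y) ^ e with hT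
  calc η / n * ∑ i, ‖∑ j, (w j i : 𝕜) * v j‖ ^ r + (1 - η) * (1 + ∑ j, ‖y j‖ ^ r)
      ≤ η / n * (n + C * (n * Y + D * Y ^ f * (n * Y))) + (1 - η) * (1 + Y) := by
        have : 0 ≤ 1 - η := by linarith
        gcongr
    _ = 1 + (1 - η) * Y + η * C * (Y * (1 + D * Y ^ f)) := by field_simp; ring
    _ ≤ 1 + Y + η * C * (Y * (T + D * T)) := by
        have h1 : (1 - η) * Y ≤ Y := by nlinarith
        have h2 : η * C * (Y * (1 + D * Y ^ f)) ≤ η * C * (Y * (T + D * T)) := by gcongr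
        linarith
    _ = 1 + Y + (η * C * (1 + D)) * (Y * T) := by ring
    _ ≤ 1 + Y + min e 1 * (Y * T) := by
        have : 0 ≤ Y * T := by positivity
        gcongr
    _ = _ := by ring

end base

def MB (𝕜 : Type*) [RCLike 𝕜] {κ ι : Type*} [Fintype κ] [Fintype ι] (A : κ → ι → ℝ)
    (s q : ℝ) : Prop :=
  ∀ x : ι → 𝕜, ∑ k, ‖∑ i, (A k i : 𝕜) * x i‖ ^ q ≤ (∑ i, ‖x i‖ ^ s) ^ (q / s)

section
variable {𝕜 : Type*} [RCLike 𝕜]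

lemma MB_dual {κ ι : Type*} [Fintype κ] [Fintype ι] (A : κ → ι → ℝ) (p r σ t : ℝ)
    (hpr : p.HolderConjugate r) (hst : σ.HolderConjugate t) (h2t : 2 ≤ t)
    (h : MB 𝕜 (fun i k => A k i) σ r) : MB 𝕜 A p t := by
  intro x
  set z : κ → 𝕜 := fun k => ∑ i, (A k i : 𝕜) * x i with hz
  set Z : ℝ := ∑ k, ‖z k‖ ^ t with hZ
  have hZ0 : 0 ≤ Z := Finset.sum_nonneg fun _ _ => by positivity
  have ht0 : 0 < t := by linarith
  have hσ0 : 0 < σ := hst.pos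
  have hp0 : 0 < p := hpr.pos
  have hr0 : 0 < r := hpr.symm.pos
  set v : κ → 𝕜 := fun k => ((‖z k‖ ^ (t - 2) : ℝ) : 𝕜) * (starRingEnd 𝕜) (z k) with hv
  have hvz : ∀ k, v k * z k = ((‖z k‖ ^ t : ℝ) : 𝕜) := by
    intro k
    simp only [hv]
    rw [mul_assoc, RCLike.conj_mul]
    have : ‖z k‖ ^ t = ‖z k‖ ^ (t - 2) * ‖z k‖ ^ 2 := by
      rw [← Real.rpow_natCast, ← Real.rpow_add' (norm_nonneg _)]
      · congr 1; push_cast; ring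
      · push_cast; linarith
    rw [this]; push_cast; rfl
  have hvn : ∀ k, ‖v k‖ ^ σ = ‖z k‖ ^ t := by
    intro k
    have : ‖v k‖ = ‖z k‖ ^ (t - 1) := by
      simp only [hv]
      rw [norm_mul, RCLike.norm_conj, RCLike.norm_ofReal, abs_of_nonneg (by positivity)]
      conv_lhs => rw [← Real.rpow_one ‖z k‖]
      rw [Real.rpow_one, ← Real.rpow_add_one' (norm_nonneg _) (by linarith)]
      congr 1; ring
    rw [this, ← Real.rpow_mul (norm_nonneg _)]
    congr 1
    have := hst.symm.sub_one_mul_conj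
    linarith
  have hxv := h v
  simp_rw [hvn] at hxv
  have hZeq : (Z : 𝕜) = ∑ i, x i * ∑ k, (A k i : 𝕜) * v k := by
    rw [hZ]; push_cast
    have : ∀ k, ((‖z k‖ ^ t : ℝ) : 𝕜) = ∑ i, x i * ((A k i : 𝕜) * v k) := by
      intro k
      rw [← hvz, hz]; simp only
      rw [Finset.mul_sum]
      exact Finset.sum_congr rfl fun i _ => by ring
    simp_rw [this, Finset.mul_sum]
    rw [Finset.sum_comm]
  have hZle : Z ≤ (∑ i, ‖x i‖ ^ p) ^ (1 / p) * Z ^ (1 / σ) := by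
    calc Z = ‖(Z : 𝕜)‖ := by rw [RCLike.norm_ofReal, abs_of_nonneg hZ0]
      _ ≤ ∑ i, ‖x i‖ * ‖∑ k, (A k i : 𝕜) * v k‖ := by
          rw [hZeq]
          refine (norm_sum_le _ _).trans (le_of_eq ?_)
          simp
      _ ≤ (∑ i, ‖x i‖ ^ p) ^ (1 / p) * (∑ i, ‖∑ k, (A k i : 𝕜) * v k‖ ^ r) ^ (1 / r) :=
          Real.inner_le_Lp_mul_Lq_of_nonneg _ hpr (fun _ _ => norm_nonneg _)
            (fun _ _ => norm_nonneg _)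
      _ ≤ (∑ i, ‖x i‖ ^ p) ^ (1 / p) * (Z ^ (r / σ)) ^ (1 / r) := by
          gcongr
      _ = _ := by
          rw [← Real.rpow_mul hZ0]
          congr 2; field_simp
  have hX0 : 0 ≤ ∑ i, ‖x i‖ ^ p := Finset.sum_nonneg fun _ _ => by positivity
  rcases hZ0.eq_or_lt with h0 | h0
  · rw [← h0]; positivity
  · have h1 : Z ^ (1 / t) ≤ (∑ i, ‖x i‖ ^ p) ^ (1 / p) := by
      have hs : Z = Z ^ (1 / t) * Z ^ (1 / σ) := by
        rw [← Real.rpow_add h0]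
        have := hst.symm.inv_add_inv_eq_one
        rw [one_div, one_div, this, Real.rpow_one]
      have hp : 0 < Z ^ (1 / σ) := by positivity
      rw [hs] at hZle
      conv_rhs at hZle => rw [← hs]
      exact le_of_mul_le_mul_right hZle hp
    have h2 := Real.rpow_le_rpow (by positivity) h1 ht0.le
    rw [← Real.rpow_mul hZ0, ← Real.rpow_mul hX0] at h2
    rw [one_div_mul_cancel ht0.ne', Real.rpow_one] at h2
    convert h2 using 2
    ring

lemma MB_mink {κ ι : Type*} [Fintype κ] [Fintype ι] (q : ℝ) (hq : 1 ≤ q) (f : ι → κ → ℝ)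
    (hf : ∀ i k, 0 ≤ f i k) :
    ∑ k, (∑ i, f i k) ^ q ≤ (∑ i, (∑ k, f i k ^ q) ^ (1 / q)) ^ q := by
  classical
  have key : ∀ s : Finset ι, (∑ k, (∑ i ∈ s, f i k) ^ q) ^ (1 / q)
      ≤ ∑ i ∈ s, (∑ k, f i k ^ q) ^ (1 / q) := by
    intro s
    induction s using Finset.induction_on with
    | empty =>
      have : q ≠ 0 := by linarith
      simp [Real.zero_rpow this, this]
    | insert a s ha ih =>
      simp_rw [Finset.sum_insert ha]
      refine (Real.Lp_add_le_of_nonneg Finset.univ hq (fun k _ => hf a k)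
        (fun k _ => Finset.sum_nonneg fun i _ => hf i k)).trans ?_
      gcongr
  have h0 : 0 ≤ ∑ k, (∑ i, f i k) ^ q := Finset.sum_nonneg fun k _ =>
    Real.rpow_nonneg (Finset.sum_nonneg fun i _ => hf i k) _
  have h1 := Real.rpow_le_rpow (by positivity) (key Finset.univ) (by linarith : 0 ≤ q)
  rwa [← Real.rpow_mul h0, one_div_mul_cancel (by linarith), Real.rpow_one] at h1

lemma MB_tensor {κ ι κ' ι' : Type*} [Fintype κ] [Fintype ι] [Fintype κ'] [Fintype ι']
    (A : κ → ι → ℝ) (B : κ' → ι' → ℝ) (s q : ℝ) (hs : 0 < s) (hsq : s ≤ q)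
    (hA : MB 𝕜 A s q) (hB : MB 𝕜 B s q) :
    MB 𝕜 (fun (k : κ × κ') (i : ι × ι') => A k.1 i.1 * B k.2 i.2) s q := by
  intro x
  have hq0 : 0 < q := by linarith
  have hqs : 1 ≤ q / s := by rw [le_div_iff₀ hs]; linarith
  set z : ι → κ' → 𝕜 := fun i k' => ∑ i', (B k' i' : 𝕜) * x (i, i') with hz
  have e : ∀ k : κ × κ', ∑ i : ι × ι', ((A k.1 i.1 * B k.2 i.2 : ℝ) : 𝕜) * x i
      = ∑ i, (A k.1 i : 𝕜) * z i k.2 := by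
    intro k
    rw [Fintype.sum_prod_type]
    refine Finset.sum_congr rfl fun i _ => ?_
    rw [hz]; simp only
    rw [Finset.mul_sum]
    exact Finset.sum_congr rfl fun i' _ => by push_cast; ring
  simp_rw [e]
  rw [Fintype.sum_prod_type, Finset.sum_comm, Fintype.sum_prod_type]
  simp only
  calc ∑ k', ∑ k, ‖∑ i, (A k i : 𝕜) * z i k'‖ ^ q
      ≤ ∑ k', (∑ i, ‖z i k'‖ ^ s) ^ (q / s) := Finset.sum_le_sum fun k' _ => hA _
    _ ≤ (∑ i, (∑ k', (‖z i k'‖ ^ s) ^ (q / s)) ^ (1 / (q / s))) ^ (q / s) :=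
        MB_mink (q / s) hqs (fun i k' => ‖z i k'‖ ^ s) (fun _ _ => by positivity)
    _ ≤ (∑ i, ∑ i', ‖x (i, i')‖ ^ s) ^ (q / s) := by
        have hS : ∀ i, 0 ≤ ∑ i', ‖x (i, i')‖ ^ s := fun i =>
          Finset.sum_nonneg fun _ _ => by positivity
        refine Real.rpow_le_rpow (Finset.sum_nonneg fun i _ => by positivity)
          (Finset.sum_le_sum fun i _ => ?_) (by positivity)
        have h1 : ∀ k', (‖z i k'‖ ^ s) ^ (q / s) = ‖z i k'‖ ^ q := by
          intro k'
          rw [← Real.rpow_mul (norm_nonneg _)]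
          congr 1; field_simp
        simp_rw [h1]
        have h2 := Real.rpow_le_rpow (Finset.sum_nonneg fun _ _ => by positivity)
          (hB (fun i' => x (i, i'))) (by positivity : 0 ≤ 1 / (q / s))
        rwa [← Real.rpow_mul (hS i), mul_one_div_cancel (by positivity), Real.rpow_one] at h2

/-- Tensor power of a matrix. -/
def tpow {κ ι : Type*} (A : κ → ι → ℝ) (N : ℕ) (k : Fin N → κ) (i : Fin N → ι) : ℝ :=
  ∏ t, A (k t) (i t)

lemma MB_tpow {κ ι : Type*} [Fintype κ] [Fintype ι] (A : κ → ι → ℝ) (s q : ℝ)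
    (hs : 0 < s) (hsq : s ≤ q) (hA : MB 𝕜 A s q) (N : ℕ) : MB 𝕜 (tpow A N) s q := by
  induction N with
  | zero =>
    intro x
    simp only [Finset.univ_unique, Finset.sum_singleton, tpow]
    rw [← Real.rpow_mul (norm_nonneg _)]
    simp
    apply le_of_eq; congr 1; field_simp
  | succ N ih =>
    intro x
    have h := MB_tensor A (tpow A N) s q hs hsq hA ih
      (fun i => x ((Fin.consEquiv fun _ => ι) i))
    rw [← Equiv.sum_comp (Fin.consEquiv fun _ => κ), ← Equiv.sum_comp (Fin.consEquiv fun _ => ι)]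
    convert h using 5 with k
    rw [← Equiv.sum_comp (Fin.consEquiv fun _ => ι)]
    refine Finset.sum_congr rfl fun i _ => ?_
    congr 2
    simp [tpow, Fin.prod_univ_succ]

lemma tpow_sum_mul {κ κ' ι : Type*} [Fintype ι] (A : κ → ι → ℝ) (B : κ' → ι → ℝ) (N : ℕ)
    (k : Fin N → κ) (k' : Fin N → κ') :
    ∑ i, tpow A N k i * tpow B N k' i = ∏ t, ∑ i, A (k t) i * B (k' t) i := by
  classical
  unfold tpow
  simp_rw [← Finset.prod_mul_distrib]
  have := Finset.prod_univ_sum (fun _ : Fin N => (Finset.univ : Finset ι))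
    (fun t b => A (k t) b * B (k' t) b)
  rw [Fintype.piFinset_univ] at this
  rw [← this]

lemma tpow_sum_abs_rpow {κ ι : Type*} [Fintype ι] (A : κ → ι → ℝ) (N : ℕ) (p : ℝ)
    (k : Fin N → κ) :
    ∑ i, |tpow A N k i| ^ p = ∏ t, ∑ i, |A (k t) i| ^ p := by
  classical
  unfold tpow
  have := Finset.prod_univ_sum (fun _ : Fin N => (Finset.univ : Finset ι))
    (fun t b => |A (k t) b| ^ p)
  rw [Fintype.piFinset_univ] at this
  rw [this]
  refine Finset.sum_congr rfl fun i _ => ?_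
  rw [Finset.abs_prod, Real.finsetProd_rpow _ _ (fun _ _ => abs_nonneg _)]

end

lemma aux_base_full {𝕜 : Type*} [RCLike 𝕜] {J : Type*} [Fintype J] [DecidableEq J]
    (w : J → J → ℝ) (hw : ∀ i j, w i j * w i j = 1)
    (horth : ∀ j j', ∑ i, w j i * w j' i = if j = j' then (Fintype.card J : ℝ) else 0)
    (r σ η C : ℝ) (hr : 2 < r) (hσ1 : 1 < σ) (hσ2 : σ < 2) (hη0 : 0 ≤ η) (hη1 : η ≤ 1)
    (hC : 0 ≤ C) (hS : ∀ z : 𝕜, ‖1 + z‖ ^ r ≤ 1 + r * RCLike.re z + C * (‖z‖ ^ 2 + ‖z‖ ^ r))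
    (hcond : η * C * (1 + (Fintype.card J : ℝ) ^ ((σ - 1) * ((r - 2) / σ)))
      ≤ min ((r - σ) / σ) 1)
    (v : J → 𝕜) :
    η / Fintype.card J * ∑ i, ‖∑ j, (w j i : 𝕜) * v j‖ ^ r + (1 - η) * ∑ j, ‖v j‖ ^ r
      ≤ (∑ j, ‖v j‖ ^ σ) ^ (r / σ) := by
  by_cases h0 : ∀ j, v j = 0
  · have hr' : r ≠ 0 := by linarith
    have hs' : σ ≠ 0 := by linarith
    simp [h0, Real.zero_rpow hr', Real.zero_rpow hs']
    positivity
  push Not at h0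
  obtain ⟨j1, hj1⟩ := h0
  obtain ⟨j0, -, hmax⟩ := Finset.exists_max_image Finset.univ (fun j => ‖v j‖) ⟨j1, Finset.mem_univ _⟩
  have hpos : 0 < ‖v j0‖ := lt_of_lt_of_le (norm_pos_iff.2 hj1) (hmax j1 (Finset.mem_univ _))
  have hne : v j0 ≠ 0 := norm_pos_iff.1 hpos
  have key := aux_base_norm w hw horth r σ η C hr hσ1 hσ2 hη0 hη1 hC hS hcond
    (fun j => v j / v j0) j0 (div_self hne)
    (fun j => by rw [norm_div, div_le_one hpos]; exact hmax j (Finset.mem_univ _))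
  have e1 : ∀ i, ∑ j, (w j i : 𝕜) * (v j / v j0) = (∑ j, (w j i : 𝕜) * v j) / v j0 := by
    intro i
    rw [Finset.sum_div]
    exact Finset.sum_congr rfl fun j _ => by ring
  simp only [e1, norm_div, Real.div_rpow (norm_nonneg _) hpos.le] at key
  rw [← Finset.sum_div, ← Finset.sum_div, ← Finset.sum_div,
    Real.div_rpow (Finset.sum_nonneg fun _ _ => by positivity) (by positivity),
    ← Real.rpow_mul hpos.le] at key
  have : σ * (r / σ) = r := by field_simp
  rw [this] at key
  have hP : 0 < ‖v j0‖ ^ r := by positivity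
  rw [← mul_div_assoc, ← mul_div_assoc, ← add_div, div_le_div_iff_of_pos_right hP] at key
  exact key

section
variable {J : Type*} [DecidableEq J]

def blk (w : J → J → ℝ) (a b : ℝ) (j : J) : J ⊕ J → ℝ :=
  Sum.elim (fun i => a * w j i) (fun i => if j = i then b else 0)

lemma MB_blk {𝕜 : Type*} [RCLike 𝕜] [Fintype J]
    (w : J → J → ℝ) (hw : ∀ i j, w i j * w i j = 1)
    (horth : ∀ j j', ∑ i, w j i * w j' i = if j = j' then (Fintype.card J : ℝ) else 0)
    (r σ η C : ℝ) (hr : 2 < r) (hσ1 : 1 < σ) (hσ2 : σ < 2) (hη0 : 0 ≤ η) (hη1 : η ≤ 1)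
    (hC : 0 ≤ C) (hS : ∀ z : 𝕜, ‖1 + z‖ ^ r ≤ 1 + r * RCLike.re z + C * (‖z‖ ^ 2 + ‖z‖ ^ r))
    (hcond : η * C * (1 + (Fintype.card J : ℝ) ^ ((σ - 1) * ((r - 2) / σ)))
      ≤ min ((r - σ) / σ) 1) :
    MB 𝕜 (fun i j => blk w ((η / Fintype.card J) ^ (1 / r)) ((1 - η) ^ (1 / r)) j i) σ r := by
  intro v
  refine le_trans (le_of_eq ?_)
    (aux_base_full w hw horth r σ η C hr hσ1 hσ2 hη0 hη1 hC hS hcond v)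
  rw [Fintype.sum_sum_type, Finset.mul_sum, Finset.mul_sum]
  have hn : (0:ℝ) ≤ η / Fintype.card J := by positivity
  have h1 : 0 ≤ 1 - η := by linarith
  have hpow : ∀ a : ℝ, 0 ≤ a → ∀ z : 𝕜, ‖((a ^ (1 / r) : ℝ) : 𝕜) * z‖ ^ r = a * ‖z‖ ^ r := by
    intro a ha z
    rw [norm_mul, RCLike.norm_ofReal, abs_of_nonneg (by positivity),
      Real.mul_rpow (by positivity) (norm_nonneg _), ← Real.rpow_mul ha,
      one_div_mul_cancel (by linarith), Real.rpow_one]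
  congr 1
  · refine Finset.sum_congr rfl fun i _ => ?_
    rw [← hpow _ hn, Finset.mul_sum]
    congr 2
    refine Finset.sum_congr rfl fun j _ => ?_
    simp only [blk, Sum.elim_inl]
    push_cast; ring
  · refine Finset.sum_congr rfl fun i _ => ?_
    rw [← hpow _ h1]
    congr 2
    rw [Finset.sum_eq_single i]
    · simp [blk]
    · intro b _ hb; simp [blk, hb]
    · simp

lemma blk_orth [Fintype J] (w : J → J → ℝ)
    (horth : ∀ j j', ∑ i, w j i * w j' i = if j = j' then (Fintype.card J : ℝ) else 0)
    (a b a' b' : ℝ) (j j' : J) :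
    ∑ i, blk w a b j i * blk w a' b' j' i
      = if j = j' then a * a' * Fintype.card J + b * b' else 0 := by
  rw [Fintype.sum_sum_type]
  have h1 : ∑ i, blk w a b j (Sum.inl i) * blk w a' b' j' (Sum.inl i)
      = a * a' * ∑ i, w j i * w j' i := by
    rw [Finset.mul_sum]
    exact Finset.sum_congr rfl fun i _ => by simp only [blk, Sum.elim_inl]; ring
  have h2 : ∑ i, blk w a b j (Sum.inr i) * blk w a' b' j' (Sum.inr i)
      = if j = j' then b * b' else 0 := by
    rw [Finset.sum_eq_single j]
    · simp only [blk, Sum.elim_inr, if_true]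
      split_ifs with h h' h'
      · rfl
      · exact absurd h.symm h'
      · exact absurd h'.symm h
      · simp
    · intro i _ hi; simp [blk, hi.symm]
    · simp
  rw [h1, h2, horth]
  split_ifs <;> simp

lemma blk_abs [Fintype J] (w : J → J → ℝ) (hw : ∀ i j, w i j * w i j = 1)
    (a b p : ℝ) (ha : 0 ≤ a) (hb : 0 ≤ b) (hp : 0 < p) (j : J) :
    ∑ i, |blk w a b j i| ^ p = Fintype.card J * a ^ p + b ^ p := by
  have hwabs : ∀ i j, |w i j| = 1 := by
    intro i j
    have h2 : |w i j| * |w i j| = 1 := by rw [abs_mul_abs_self]; exact hw i j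
    nlinarith [abs_nonneg (w i j)]
  rw [Fintype.sum_sum_type]
  congr 1
  · simp [blk, abs_mul, hwabs, abs_of_nonneg ha]
  · rw [Finset.sum_eq_single j]
    · simp [blk, abs_of_nonneg hb]
    · intro i _ hi; simp [blk, hi.symm, Real.zero_rpow hp.ne']
    · simp
end

open Filter Topology in
lemma aux_params (p r σ C : ℝ) (hpr : p.HolderConjugate r) (hp2 : p < 2) (hσp : p < σ)
    (hσ2 : σ < 2) (hC : 0 ≤ C) : ∃ (k : ℕ) (η : ℝ), 0 < η ∧ η < 1 ∧
    η * C * (1 + ((2:ℝ) ^ k) ^ ((σ - 1) * ((r - 2) / σ))) ≤ min ((r - σ) / σ) 1 ∧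
    ((2:ℝ) ^ k) ^ (1 / 2 - 1 / p) * η ^ (1 / p) + (1 - η) ^ (1 / p) < 1 := by
  have hp1 : 1 < p := hpr.lt
  have hr2 : 2 < r := by
    rw [hpr.conjugate_eq, lt_div_iff₀ (by linarith)]; linarith
  set δ : ℝ := 1 / p - 1 / 2 with hδ
  have hδ0 : 0 < δ := by
    rw [hδ, sub_pos]; exact one_div_lt_one_div_of_lt (by linarith) hp2
  have hinv : 1 / p + 1 / r = 1 := by
    have := hpr.inv_add_inv_eq_one
    simpa [one_div] using this
  have hδr : δ * r = (r - 2) / 2 := by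
    have : 1 / p = 1 - 1 / r := by linarith
    rw [hδ, this]; field_simp; ring
  set y : ℝ := (σ - 1) * ((r - 2) / σ) with hy
  have hyd : y < δ * r := by
    rw [hδr, hy, ← mul_div_assoc, div_lt_div_iff₀ (by linarith) (by norm_num)]
    nlinarith
  have hn : Tendsto (fun k : ℕ => (2:ℝ) ^ k) atTop atTop :=
    tendsto_pow_atTop_atTop_of_one_lt (by norm_num)
  set η : ℕ → ℝ := fun k => (2 * p) ^ r * ((2:ℝ) ^ k) ^ (-(δ * r)) with hη
  have hη0 : Tendsto η atTop (𝓝 0) := by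
    have := (tendsto_rpow_neg_atTop (by nlinarith : 0 < δ * r)).comp hn
    have := this.const_mul ((2 * p) ^ r)
    simpa [hη, Function.comp_def] using this
  have hηy : Tendsto (fun k => η k * ((2:ℝ) ^ k) ^ y) atTop (𝓝 0) := by
    have := (tendsto_rpow_neg_atTop (by linarith : 0 < δ * r - y)).comp hn
    have := this.const_mul ((2 * p) ^ r)
    simp only [mul_zero] at this
    refine this.congr fun k => ?_
    simp only [Function.comp, hη]
    rw [mul_assoc, ← Real.rpow_add (by positivity)]
    congr 2; ring
  have hmin : 0 < min ((r - σ) / σ) 1 :=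
    lt_min (div_pos (by linarith) (by linarith)) one_pos
  have hlim : Tendsto (fun k => η k * C * (1 + ((2:ℝ) ^ k) ^ y)) atTop (𝓝 0) := by
    have := (hη0.add hηy).const_mul C
    simp only [add_zero, mul_zero] at this
    refine this.congr fun k => ?_
    ring
  obtain ⟨k, h1, h2⟩ := ((hη0.eventually (gt_mem_nhds one_pos)).and
    (hlim.eventually (gt_mem_nhds hmin))).exists
  have hpos : 0 < η k := by simp only [hη]; positivity
  refine ⟨k, η k, hpos, h1, h2.le, ?_⟩
  set n : ℝ := (2:ℝ) ^ k with hnn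
  have hn0 : 0 < n := by positivity
  have hbern : (1 - η k) ^ (1 / p) ≤ 1 - 1 / p * η k := by
    have := rpow_one_add_le_one_add_mul_self (s := -η k) (by linarith) (p := 1 / p)
      (by positivity) (by rw [div_le_one (by linarith)]; linarith)
    simpa [sub_eq_add_neg] using this
  have hηr : (η k) ^ (1 / r) = 2 * p * n ^ (-δ) := by
    simp only [hη]
    rw [Real.mul_rpow (by positivity) (by positivity), ← Real.rpow_mul (by positivity),
      ← Real.rpow_mul (by positivity)]
    have hr0 : r ≠ 0 := by linarith
    rw [mul_one_div_cancel hr0, Real.rpow_one]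
    congr 2; field_simp
  have hηs : η k = (η k) ^ (1 / p) * (η k) ^ (1 / r) := by
    rw [← Real.rpow_add hpos, hinv, Real.rpow_one]
  have e : (1:ℝ) / 2 - 1 / p = -δ := by rw [hδ]; ring
  rw [e]
  have hq : 0 < n ^ (-δ) * (η k) ^ (1 / p) := by positivity
  have h3 : 1 / p * η k = 2 * (n ^ (-δ) * (η k) ^ (1 / p)) := by
    conv_lhs => rw [hηs, hηr]
    field_simp
  linarith

/-- The finite-dimensional building block. -/
lemma exists_block (𝕜 : Type*) [RCLike 𝕜] (p r : ℝ) (hpr : p.HolderConjugate r) (hp2 : p < 2) :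
    ∃ (t : ℝ) (k : ℕ) (τ κ : (Fin k → Bool) → ((Fin k → Bool) ⊕ (Fin k → Bool)) → ℝ)
      (β : ((Fin k → Bool) ⊕ (Fin k → Bool)) → ℝ) (Λ : ℝ),
      2 < t ∧ t < r ∧ MB 𝕜 τ p t ∧ (∀ j, ∑ i, κ j i * τ j i = 1) ∧
      (∀ j, ∑ i, |κ j i| ^ p = 1) ∧ (∀ i, 0 < β i) ∧
      (∀ j j', ∑ i, (κ j i / β i) * (κ j' i / β i) = if j = j' then Λ else 0) ∧ 0 ≤ Λ ∧
      Λ * ∑ i, β i ^ 2 < Fintype.card (Fin k → Bool) := by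
  have hp1 : 1 < p := hpr.lt
  have hr2 : 2 < r := by
    rw [hpr.conjugate_eq, lt_div_iff₀ (by linarith)]; linarith
  obtain ⟨C, hC, hS⟩ := aux_scalar 𝕜 r hr2
  obtain ⟨σ, hσp, hσ2⟩ := exists_between hp2
  obtain ⟨k, η, hη0, hη1, hcond, huv⟩ := aux_params p r σ C hpr hp2 hσp hσ2 hC
  have hinv : 1 / p + 1 / r = 1 := by
    have := hpr.inv_add_inv_eq_one
    simpa [one_div] using this
  have hst : σ.HolderConjugate (σ.conjExponent) := Real.HolderConjugate.conjExponent (by linarith)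
  have ht2 : 2 < σ.conjExponent := by
    rw [Real.conjExponent, lt_div_iff₀ (by linarith)]; linarith
  have htr : σ.conjExponent < r := by
    rw [hpr.conjugate_eq, Real.conjExponent, div_lt_div_iff₀ (by linarith) (by linarith)]
    nlinarith
  have hcard : ((Fintype.card (Fin k → Bool) : ℕ) : ℝ) = 2 ^ k := by simp
  set n : ℝ := (2:ℝ) ^ k with hn
  have hn0 : 0 < n := by positivity
  have hηn : 0 < η / n := by positivity
  have h1η : 0 < 1 - η := by linarith
  set a : ℝ := (η / n) ^ (1 / p) with ha
  set b : ℝ := (1 - η) ^ (1 / p) with hb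
  have ha0 : 0 < a := by positivity
  have hb0 : 0 < b := by positivity
  set u : ℝ := Real.sqrt n * a with hu
  have hu0 : 0 < u := by positivity
  have hu' : u = n ^ (1 / 2 - 1 / p) * η ^ (1 / p) := by
    rw [hu, ha, Real.div_rpow hη0.le hn0.le, Real.sqrt_eq_rpow, Real.rpow_sub hn0]
    ring
  have hprod : ∀ x : ℝ, 0 < x → x ^ (1 / p) * x ^ (1 / r) = x := by
    intro x hx
    rw [← Real.rpow_add hx, hinv, Real.rpow_one]
  have hpp : ∀ x : ℝ, 0 < x → (x ^ (1 / p)) ^ p = x := by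
    intro x hx
    rw [← Real.rpow_mul hx.le, one_div_mul_cancel (by linarith), Real.rpow_one]
  have hMB := MB_blk (𝕜 := 𝕜) (walsh k) (walsh_sq k) (walsh_orth k) r σ η C hr2 (by linarith) hσ2
    hη0.le hη1.le hC hS (by rw [hcard]; exact hcond)
  rw [hcard] at hMB
  refine ⟨σ.conjExponent, k, blk (walsh k) ((η / n) ^ (1 / r)) ((1 - η) ^ (1 / r)),
    blk (walsh k) a b, Sum.elim (fun _ => Real.sqrt u) (fun _ => Real.sqrt b), u + b,
    ht2, htr, MB_dual _ p r σ _ hpr hst ht2.le hMB, ?_, ?_, ?_, ?_, by positivity, ?_⟩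
  · intro j
    rw [blk_orth _ (walsh_orth k), if_pos rfl, hcard, ha, hb, hprod _ hηn, hprod _ h1η]
    field_simp; ring
  · intro j
    rw [blk_abs _ (walsh_sq k) a b p ha0.le hb0.le (by linarith), hcard, ha, hb, hpp _ hηn,
      hpp _ h1η]
    field_simp; ring
  · rintro (i | i)
    · simpa using hu0
    · simpa using hb0
  · intro j j'
    have e : ∀ (j : Fin k → Bool) i, blk (walsh k) a b j i
        / (Sum.elim (fun _ => Real.sqrt u) (fun _ => Real.sqrt b) i : ℝ)
        = blk (walsh k) (a / Real.sqrt u) (b / Real.sqrt b) j i := by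
      rintro j (i | i)
      · simp [blk]; ring
      · simp only [blk, Sum.elim_inr]; split_ifs <;> simp
    simp_rw [e]
    rw [blk_orth _ (walsh_orth k), hcard]
    congr 1
    rw [div_mul_div_comm, div_mul_div_comm, Real.mul_self_sqrt hu0.le, Real.mul_self_sqrt hb0.le]
    have h1 : b * b / b = b := by field_simp
    have h2 : a * a / u * n = u := by
      rw [div_mul_eq_mul_div, div_eq_iff hu0.ne', hu]
      have := Real.mul_self_sqrt hn0.le
      calc a * a * n = a * a * (Real.sqrt n * Real.sqrt n) := by rw [this]
        _ = _ := by ring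
    rw [h1, h2]
  · rw [Fintype.sum_sum_type]
    simp only [Sum.elim_inl, Sum.elim_inr, Real.sq_sqrt hu0.le, Real.sq_sqrt hb0.le,
      Finset.sum_const, Finset.card_univ, nsmul_eq_mul]
    rw [hcard, ← mul_add]
    have h1 : u + b < 1 := by rw [hu']; exact huv
    have h2 : 0 < u + b := by positivity
    have : (u + b) * (u + b) < 1 := by nlinarith
    calc (u + b) * (n * (u + b)) = n * ((u + b) * (u + b)) := by ring
      _ < n * 1 := by gcongr
      _ = n := mul_one n

lemma sum_rpow_le_rpow_sum' {α : Type*} (G : Finset α) (a : α → ℝ) (ha : ∀ i, 0 ≤ a i) (s : ℝ)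
    (hs : 1 ≤ s) : ∑ i ∈ G, a i ^ s ≤ (∑ i ∈ G, a i) ^ s := by
  classical
  induction G using Finset.induction_on with
  | empty => simp [Real.zero_rpow (by linarith : s ≠ 0)]
  | insert b G hb ih =>
    rw [Finset.sum_insert hb, Finset.sum_insert hb]
    have h := Real.add_rpow_le_rpow_add (ha b) (Finset.sum_nonneg (fun i (_ : i ∈ G) => ha i)) hs
    linarith

lemma block_sum_le {𝕜 : Type*} [RCLike 𝕜] {κ ι : ℕ → Type} [∀ N, Fintype (κ N)]
    [∀ N, Fintype (ι N)] (e : (Σ N, ι N) ≃ ℕ) (e' : (Σ N, κ N) ≃ ℕ)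
    (A : ∀ N, κ N → ι N → ℝ) (p t : ℝ) (hp : 1 ≤ p) (hpt : p ≤ t)
    [Fact (1 ≤ ENNReal.ofReal p)]
    (hA : ∀ N, MB 𝕜 (A N) p t) (x : lp (fun _ : ℕ => 𝕜) (ENNReal.ofReal p)) (F : Finset ℕ) :
    ∑ m ∈ F, ‖∑ i, (A (e'.symm m).1 (e'.symm m).2 i : 𝕜) * x (e ⟨(e'.symm m).1, i⟩)‖ ^ t
      ≤ ‖x‖ ^ t := by
  classical
  have hp0 : 0 < p := by linarith
  have htr : (ENNReal.ofReal p).toReal = p := ENNReal.toReal_ofReal hp0.le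
  set f : (Σ N, κ N) → ℝ := fun z => ‖∑ i, (A z.1 z.2 i : 𝕜) * x (e ⟨z.1, i⟩)‖ ^ t with hf
  set G : Finset ℕ := F.image (fun m => (e'.symm m).1) with hG
  have h1 : ∑ m ∈ F, f (e'.symm m) ≤ ∑ z ∈ G.sigma (fun N => (Finset.univ : Finset (κ N))), f z := by
    rw [show ∑ m ∈ F, f (e'.symm m) = ∑ z ∈ F.map e'.symm.toEmbedding, f z by
      rw [Finset.sum_map]; rfl]
    apply Finset.sum_le_sum_of_subset_of_nonneg
    · intro z hz
      simp only [Finset.mem_map, Equiv.coe_toEmbedding] at hz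
      obtain ⟨m, hm, rfl⟩ := hz
      simp only [Finset.mem_sigma, Finset.mem_univ, and_true, hG, Finset.mem_image]
      exact ⟨m, hm, rfl⟩
    · intro z _ _
      positivity
  have h2 : ∑ z ∈ G.sigma (fun N => (Finset.univ : Finset (κ N))), f z ≤
      ∑ N ∈ G, (∑ i, ‖x (e ⟨N, i⟩)‖ ^ p) ^ (t / p) := by
    rw [Finset.sum_sigma]
    exact Finset.sum_le_sum (fun N _ => hA N (fun i => x (e ⟨N, i⟩)))
  have h3 : ∑ N ∈ G, (∑ i, ‖x (e ⟨N, i⟩)‖ ^ p) ^ (t / p) ≤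
      (∑ N ∈ G, ∑ i, ‖x (e ⟨N, i⟩)‖ ^ p) ^ (t / p) :=
    sum_rpow_le_rpow_sum' _ _ (fun N => by positivity) _ ((one_le_div hp0).2 hpt)
  have h4 : ∑ N ∈ G, ∑ i, ‖x (e ⟨N, i⟩)‖ ^ p ≤ ‖x‖ ^ p := by
    rw [← Finset.sum_sigma G (fun N => (Finset.univ : Finset (ι N)))
      (fun z => ‖x (e z)‖ ^ p)]
    have h := lp.sum_rpow_le_norm_rpow (by rw [htr]; exact hp0) x
      ((G.sigma (fun N => (Finset.univ : Finset (ι N)))).map e.toEmbedding)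
    rw [htr, Finset.sum_map] at h
    exact h
  calc _ ≤ _ := h1
    _ ≤ _ := h2
    _ ≤ _ := h3
    _ ≤ (‖x‖ ^ p) ^ (t / p) := by
      gcongr
      exact div_nonneg (by linarith) hp0.le
    _ = ‖x‖ ^ t := by
      rw [← Real.rpow_mul (norm_nonneg _)]; congr 1; field_simp

lemma sum_q_le {𝕜 : Type*} [RCLike 𝕜] (w : ℕ → 𝕜) (t q M R : ℝ) (ht : 0 < t) (htq : t ≤ q)
    (hM : ∀ m, ‖w m‖ ≤ M)
    (F : Finset ℕ) (h : ∑ m ∈ F, ‖w m‖ ^ t ≤ R) : ∑ m ∈ F, ‖w m‖ ^ q ≤ M ^ (q - t) * R := by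
  have hM0 : 0 ≤ M := (norm_nonneg _).trans (hM 0)
  calc ∑ m ∈ F, ‖w m‖ ^ q ≤ ∑ m ∈ F, M ^ (q - t) * ‖w m‖ ^ t := by
        apply Finset.sum_le_sum
        intro m _
        have : ‖w m‖ ^ q = ‖w m‖ ^ (q - t) * ‖w m‖ ^ t := by
          rw [← Real.rpow_add_of_nonneg (norm_nonneg _) (by linarith) ht.le]; congr 1; ring
        rw [this]
        gcongr
        exact hM m
    _ = M ^ (q - t) * ∑ m ∈ F, ‖w m‖ ^ t := by rw [Finset.mul_sum]
    _ ≤ _ := by gcongr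

lemma exists_U (𝕜 : Type*) [RCLike 𝕜] {κ ι : ℕ → Type} [∀ N, Fintype (κ N)]
    [∀ N, Fintype (ι N)] (e : (Σ N, ι N) ≃ ℕ) (e' : (Σ N, κ N) ≃ ℕ)
    (A : ∀ N, κ N → ι N → ℝ) (p t q : ℝ) (hp : 1 ≤ p) (hpt : p ≤ t) (htq : t ≤ q)
    [Fact (1 ≤ ENNReal.ofReal p)] [Fact (1 ≤ ENNReal.ofReal q)]
    (hA : ∀ N, MB 𝕜 (A N) p t) :
    ∃ U : lp (fun _ : ℕ => 𝕜) (ENNReal.ofReal p) →L[𝕜] lp (fun _ : ℕ => 𝕜) (ENNReal.ofReal q),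
      (∀ x N k, U x (e' ⟨N, k⟩) = ∑ i, (A N k i : 𝕜) * x (e ⟨N, i⟩)) ∧
      ∀ x (F : Finset ℕ), ∑ m ∈ F, ‖U x m‖ ^ t ≤ ‖x‖ ^ t := by
  have ht0 : 0 < t := by linarith
  have hq0 : 0 < q := by linarith
  have hqr : (ENNReal.ofReal q).toReal = q := ENNReal.toReal_ofReal hq0.le
  let w : lp (fun _ : ℕ => 𝕜) (ENNReal.ofReal p) → ℕ → 𝕜 := fun x m =>
    ∑ i, (A (e'.symm m).1 (e'.symm m).2 i : 𝕜) * x (e ⟨(e'.symm m).1, i⟩)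
  have hb : ∀ x (F : Finset ℕ), ∑ m ∈ F, ‖w x m‖ ^ t ≤ ‖x‖ ^ t := fun x F =>
    block_sum_le e e' A p t hp hpt hA x F
  have hM : ∀ x m, ‖w x m‖ ≤ ‖x‖ := by
    intro x m
    have := hb x {m}
    rw [Finset.sum_singleton] at this
    exact (Real.rpow_le_rpow_iff (norm_nonneg _) (norm_nonneg _) ht0).1 this
  have hqb : ∀ x (F : Finset ℕ), ∑ m ∈ F, ‖w x m‖ ^ q ≤ ‖x‖ ^ q := by
    intro x F
    refine (sum_q_le (w x) t q ‖x‖ _ ht0 htq (hM x) F (hb x F)).trans (le_of_eq ?_)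
    rw [← Real.rpow_add_of_nonneg (norm_nonneg _) (by linarith) ht0.le]; congr 1; ring
  have hmem : ∀ x, Memℓp (w x) (ENNReal.ofReal q) := by
    intro x
    apply memℓp_gen' (C := ‖x‖ ^ q)
    intro F
    rw [hqr]; exact hqb x F
  let L : lp (fun _ : ℕ => 𝕜) (ENNReal.ofReal p) →ₗ[𝕜] lp (fun _ : ℕ => 𝕜) (ENNReal.ofReal q) :=
    { toFun := fun x => ⟨w x, hmem x⟩
      map_add' := by
        intro x y
        ext m
        simp only [w, lp.coeFn_add, Pi.add_apply, mul_add, Finset.sum_add_distrib]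
      map_smul' := by
        intro a x
        ext m
        simp only [w, lp.coeFn_smul, Pi.smul_apply, smul_eq_mul, RingHom.id_apply, Finset.mul_sum]
        exact Finset.sum_congr rfl (fun i _ => by ring) }
  refine ⟨L.mkContinuous 1 ?_, ?_, ?_⟩
  · intro x
    rw [one_mul]
    apply lp.norm_le_of_forall_sum_le (by rw [hqr]; exact hq0) (norm_nonneg _)
    intro F
    rw [hqr]; exact hqb x F
  · intro x N k
    change w x (e' ⟨N, k⟩) = _
    have h : ∀ z : Σ N, κ N, z = ⟨N, k⟩ → ∑ i, (A z.1 z.2 i : 𝕜) * x (e ⟨z.1, i⟩) =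
        ∑ i, (A N k i : 𝕜) * x (e ⟨N, i⟩) := by
      rintro z rfl
      rfl
    exact h _ (Equiv.symm_apply_apply _ _)
  · exact hb

def coordL (𝕜 : Type*) [RCLike 𝕜] (s : ℝ≥0∞) [Fact (1 ≤ s)] (m : ℕ) :
    lp (fun _ : ℕ => 𝕜) s →L[𝕜] 𝕜 :=
  LinearMap.mkContinuous
    { toFun := fun x => x m
      map_add' := fun x y => by simp
      map_smul' := fun a x => by simp } 1
    (fun x => by
      rw [one_mul]
      exact lp.norm_apply_le_norm (ne_of_gt (lt_of_lt_of_le one_pos Fact.out)) x m)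

lemma coordL_apply (𝕜 : Type*) [RCLike 𝕜] (s : ℝ≥0∞) [Fact (1 ≤ s)] (m : ℕ)
    (x : lp (fun _ : ℕ => 𝕜) s) : coordL 𝕜 s m x = x m := rfl

lemma coordL_norm (𝕜 : Type*) [RCLike 𝕜] (s : ℝ≥0∞) [Fact (1 ≤ s)] (m : ℕ) :
    ‖coordL 𝕜 s m‖ ≤ 1 := LinearMap.mkContinuous_norm_le _ zero_le_one _

lemma U_fss {𝕜 : Type*} [RCLike 𝕜] {X : Type*} [NormedAddCommGroup X] [NormedSpace 𝕜 X]
    (t q : ℝ) (ht : 0 < t) (htq : t < q) [Fact (1 ≤ ENNReal.ofReal q)]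
    (U : X →L[𝕜] lp (fun _ : ℕ => 𝕜) (ENNReal.ofReal q))
    (hU : ∀ x (F : Finset ℕ), ∑ m ∈ F, ‖U x m‖ ^ t ≤ ‖x‖ ^ t) (ε : ℝ) (hε : 0 < ε) :
    ∃ n : ℕ, ∀ E : Submodule 𝕜 X, Module.finrank 𝕜 E = n →
      ∃ x ∈ E, x ≠ 0 ∧ ‖U x‖ < ε * ‖x‖ := by
  classical
  have hq0 : 0 < q := by linarith
  have hqr : (ENNReal.ofReal q).toReal = q := ENNReal.toReal_ofReal hq0.le
  set C : ℝ := (ε ^ (-q)) ^ (1 / (q - t)) with hC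
  have hC0 : 0 ≤ C := by positivity
  refine ⟨⌊C ^ t⌋₊ + 1, fun E hE => ?_⟩
  by_contra! hcon
  have hlow : ∀ x ∈ E, ε * ‖x‖ ≤ ‖U x‖ := by
    intro x hx
    by_cases h : x = 0
    · simp [h]
    · exact hcon x hx h
  have hbd : ∀ x ∈ E, (∀ m, ‖U x m‖ ≤ 1) → ‖x‖ ≤ C := by
    intro x hx h1
    rcases eq_or_lt_of_le (norm_nonneg x) with h0 | h0
    · rw [← h0]; exact hC0
    have h2 : ‖U x‖ ≤ ‖x‖ ^ (t / q) := by
      apply lp.norm_le_of_forall_sum_le (by rw [hqr]; exact hq0) (by positivity)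
      intro F
      rw [hqr]
      have := sum_q_le (U x) t q 1 _ ht htq.le h1 F (hU x F)
      rw [Real.one_rpow, one_mul] at this
      rw [← Real.rpow_mul (norm_nonneg _), div_mul_cancel₀ _ hq0.ne']
      exact this
    have h3 : (ε * ‖x‖) ^ q ≤ ‖x‖ ^ t := by
      calc (ε * ‖x‖) ^ q ≤ (‖x‖ ^ (t / q)) ^ q := by
            gcongr
            exact (hlow x hx).trans h2
        _ = ‖x‖ ^ t := by
            rw [← Real.rpow_mul (norm_nonneg _), div_mul_cancel₀ _ hq0.ne']
    have h4 : ‖x‖ ^ (q - t) ≤ ε ^ (-q) := by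
      rw [Real.mul_rpow hε.le h0.le] at h3
      rw [Real.rpow_sub h0, Real.rpow_neg hε.le, div_le_iff₀ (by positivity), ← div_eq_inv_mul,
        le_div_iff₀ (by positivity)]
      linarith
    rw [hC]
    calc ‖x‖ = (‖x‖ ^ (q - t)) ^ (1 / (q - t)) := by
          rw [← Real.rpow_mul h0.le, mul_one_div_cancel (by linarith), Real.rpow_one]
      _ ≤ _ := by
          gcongr
  haveI : FiniteDimensional 𝕜 E := Module.finite_of_finrank_pos (by omega)
  letI : NormedSpace ℝ E := NormedSpace.restrictScalars ℝ 𝕜 E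
  haveI : ProperSpace E := FiniteDimensional.proper 𝕜 E
  let φ : ℕ → E →L[𝕜] 𝕜 := fun m => (coordL 𝕜 (ENNReal.ofReal q) m).comp (U.comp E.subtypeL)
  have hφ : ∀ m (x : E), φ m x = U (x : X) m := fun m x => rfl
  let K : Set E := {x | ∀ m, ‖φ m x‖ ≤ 1}
  have hKc : IsCompact K := by
    apply Metric.isCompact_of_isClosed_isBounded
    · have : K = ⋂ m, {x | ‖φ m x‖ ≤ 1} := by ext x; simp [K]
      rw [this]
      exact isClosed_iInter (fun m => isClosed_le (φ m).continuous.norm continuous_const)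
    · apply (Metric.isBounded_closedBall (x := (0 : E)) (r := C)).subset
      intro x hx
      rw [mem_closedBall_zero_iff]
      exact hbd x x.2 hx
  obtain ⟨x, hx⟩ := hKc.extremePoints_nonempty ⟨0, fun m => by simp⟩
  rw [mem_extremePoints] at hx
  obtain ⟨hxK, hext⟩ := hx
  have hxC : ‖(x : X)‖ ≤ C := hbd x x.2 hxK
  have hten : Filter.Tendsto (fun m => ‖φ m x‖ ^ q) Filter.cofinite (nhds 0) := by
    have := (lp.memℓp (U (x : X))).summable (by rw [hqr]; exact hq0)
    rw [hqr] at this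
    exact this.tendsto_cofinite_zero
  have hfin : {m | ¬ ‖φ m x‖ < 1 / 2}.Finite := by
    have h := hten.eventually (gt_mem_nhds (show (0 : ℝ) < (1 / 2) ^ q by positivity))
    have h' : ∀ᶠ m in Filter.cofinite, ‖φ m x‖ < 1 / 2 := by
      filter_upwards [h] with m hm
      exact (Real.rpow_lt_rpow_iff (norm_nonneg _) (by norm_num) hq0).1 hm
    exact h'
  set B := hfin.toFinset with hB
  set A := B.filter (fun m => ‖φ m x‖ = 1) with hA
  have hAcard : (A.card : ℝ) ≤ C ^ t := by
    have h := hU x A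
    rw [Finset.sum_congr rfl (g := fun _ => (1 : ℝ))] at h
    · simp only [Finset.sum_const, nsmul_eq_mul, mul_one] at h
      exact h.trans (by gcongr)
    · intro m hm
      rw [hA, Finset.mem_filter] at hm
      rw [← hφ, hm.2, Real.one_rpow]
  have hker : LinearMap.ker (LinearMap.pi (fun m : A => (φ m : E →ₗ[𝕜] 𝕜))) ≠ ⊥ := by
    apply LinearMap.ker_ne_bot_of_finrank_lt
    rw [Module.finrank_fintype_fun_eq_card, Fintype.card_coe, hE, Nat.lt_add_one_iff]
    exact Nat.le_floor hAcard
  obtain ⟨y, hy, hy0⟩ := (Submodule.ne_bot_iff _).1 hker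
  have hyA : ∀ m ∈ A, φ m y = 0 := by
    intro m hm
    exact congrFun (LinearMap.mem_ker.1 hy) ⟨m, hm⟩
  have hyn : ∀ m, ‖φ m y‖ ≤ ‖U (y : X)‖ := by
    intro m
    exact lp.norm_apply_le_norm (ne_of_gt (lt_of_lt_of_le one_pos Fact.out)) _ m
  have hs1 : ∀ᶠ s : ℝ in nhdsWithin 0 (Set.Ioi 0), ∀ m ∈ B, ‖φ m x‖ < 1 →
      ‖φ m x‖ + s * ‖φ m y‖ < 1 := by
    rw [Filter.eventually_all_finset]
    intro m _
    by_cases h : ‖φ m x‖ < 1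
    · have hc : Continuous (fun s : ℝ => ‖φ m x‖ + s * ‖φ m y‖) := by fun_prop
      have := (hc.tendsto 0).eventually (gt_mem_nhds (show ‖φ m x‖ + 0 * ‖φ m y‖ < 1 by simpa using h))
      filter_upwards [nhdsWithin_le_nhds this] with s hs _ using hs
    · exact Filter.Eventually.of_forall (fun s h' => absurd h' h)
  have hs2 : ∀ᶠ s : ℝ in nhdsWithin 0 (Set.Ioi 0), s * ‖U (y : X)‖ < 1 / 2 := by
    have hc : Continuous (fun s : ℝ => s * ‖U (y : X)‖) := by fun_prop
    exact nhdsWithin_le_nhds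
      ((hc.tendsto 0).eventually (gt_mem_nhds (show 0 * ‖U (y : X)‖ < 1 / 2 by norm_num)))
  obtain ⟨s, ⟨h1, h2⟩, hs0⟩ := ((hs1.and hs2).and self_mem_nhdsWithin).exists
  have hs0' : (0 : ℝ) < s := hs0
  have key : ∀ m, ‖φ m x‖ + s * ‖φ m y‖ ≤ 1 := by
    intro m
    by_cases hmB : m ∈ B
    · by_cases hm1 : ‖φ m x‖ = 1
      · rw [hyA m (Finset.mem_filter.2 ⟨hmB, hm1⟩), hm1]; simp
      · exact (h1 m hmB (lt_of_le_of_ne (hxK m) hm1)).le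
    · have h3 : ‖φ m x‖ < 1 / 2 := by
        by_contra h
        exact hmB (hfin.mem_toFinset.2 h)
      have h4 : s * ‖φ m y‖ ≤ s * ‖U (y : X)‖ := by
        gcongr
        exact hyn m
      linarith
  have hsn : ‖((s : ℝ) : 𝕜)‖ = s := by rw [RCLike.norm_ofReal, abs_of_pos hs0']
  have hp : x + (s : 𝕜) • y ∈ K := by
    intro m
    rw [map_add, map_smul]
    refine (norm_add_le _ _).trans ?_
    rw [norm_smul, hsn]
    exact key m
  have hm : x - (s : 𝕜) • y ∈ K := by
    intro m
    rw [map_sub, map_smul]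
    refine (norm_sub_le _ _).trans ?_
    rw [norm_smul, hsn]
    exact key m
  have hseg : x ∈ openSegment ℝ (x + (s : 𝕜) • y) (x - (s : 𝕜) • y) := by
    refine ⟨1 / 2, 1 / 2, by norm_num, by norm_num, by norm_num, ?_⟩
    rw [← smul_add, add_add_sub_cancel, ← two_smul ℝ x, smul_smul]
    norm_num
  have := (hext _ hp _ hm hseg).1
  rw [add_eq_left, smul_eq_zero] at this
  rcases this with h | h
  · exact hs0'.ne' (by exact_mod_cast h)
  · exact hy0 h

lemma lp_not_findim (𝕜 : Type*) [RCLike 𝕜] (s : ℝ≥0∞) [Fact (1 ≤ s)] :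
    ¬ FiniteDimensional 𝕜 (lp (fun _ : ℕ => 𝕜) s) := by
  intro h
  set n := Module.finrank 𝕜 (lp (fun _ : ℕ => 𝕜) s)
  let f : lp (fun _ : ℕ => 𝕜) s →ₗ[𝕜] (Fin (n + 1) → 𝕜) :=
    LinearMap.pi (fun m => (coordL 𝕜 s m : lp (fun _ : ℕ => 𝕜) s →ₗ[𝕜] 𝕜))
  have hf : Function.Surjective f := by
    intro v
    refine ⟨∑ i : Fin (n + 1), lp.single s (i : ℕ) (v i), ?_⟩
    ext m
    change coordL 𝕜 s m _ = _
    rw [map_sum, Finset.sum_eq_single m]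
    · rw [coordL_apply, lp.single_apply_self]
    · intro b _ hb
      rw [coordL_apply, lp.single_apply_ne]
      exact fun h => hb (Fin.ext h.symm)
    · simp
  have := LinearMap.finrank_le_finrank_of_surjective hf
  rw [Module.finrank_fin_fun] at this
  omega

lemma sscs_of_not_findim {𝕜 X Y : Type*} [RCLike 𝕜]
    [NormedAddCommGroup X] [NormedSpace 𝕜 X] [NormedAddCommGroup Y] [NormedSpace 𝕜 Y]
    (hX : ¬ FiniteDimensional 𝕜 X) (T : X →L[𝕜] Y) (ε : ℝ) (hε : 0 < ε) :
    ∃ N : ℕ, ∀ n : ℕ, N ≤ n → ∀ E : Submodule 𝕜 Y,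
    IsClosed (E : Set Y) → Module.finrank 𝕜 (Y ⧸ E) = n →
    ∃ x : X, ‖x‖ = 1 ∧ Metric.infDist (T x) (E : Set Y) < ε := by
  refine ⟨1, fun n hn E _ hfr => ?_⟩
  haveI : FiniteDimensional 𝕜 (Y ⧸ E) := Module.finite_of_finrank_pos (by omega)
  let f : X →ₗ[𝕜] (Y ⧸ E) := E.mkQ.comp (T : X →ₗ[𝕜] Y)
  have hk : LinearMap.ker f ≠ ⊥ := by
    intro h
    exact hX (FiniteDimensional.of_injective f (LinearMap.ker_eq_bot.1 h))
  obtain ⟨y, hy, hy0⟩ := (Submodule.ne_bot_iff _).1 hk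
  have hyn : ‖y‖ ≠ 0 := norm_ne_zero_iff.2 hy0
  have hTy : T y ∈ E := by
    have : E.mkQ (T y) = 0 := hy
    rwa [Submodule.mkQ_apply, Submodule.Quotient.mk_eq_zero] at this
  refine ⟨((‖y‖⁻¹ : ℝ) : 𝕜) • y, ?_, ?_⟩
  · rw [norm_smul, RCLike.norm_ofReal, abs_of_nonneg (by positivity), inv_mul_cancel₀ hyn]
  · rw [map_smul, Metric.infDist_zero_of_mem (E.smul_mem _ hTy)]
    exact hε

lemma exists_funcs {𝕜 : Type*} [RCLike 𝕜] {s : ℝ≥0∞} [Fact (1 ≤ s)] {Y : Type*}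
    [NormedAddCommGroup Y] [NormedSpace 𝕜 Y] (J : lp (fun _ : ℕ => 𝕜) s →L[𝕜] Y) (c : ℝ)
    (hc : 0 < c) (hJ : ∀ z, c * ‖z‖ ≤ ‖J z‖) (m : ℕ) :
    ∃ y : Y →L[𝕜] 𝕜, (∀ z, y (J z) = z m) ∧ ‖y‖ ≤ 1 / c := by
  have hinj : Function.Injective (J : lp (fun _ : ℕ => 𝕜) s →ₗ[𝕜] Y) := by
    rw [← LinearMap.ker_eq_bot, LinearMap.ker_eq_bot']
    intro z hz
    have h := hJ z
    have hz' : J z = 0 := hz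
    rw [hz', norm_zero] at h
    have : ‖z‖ ≤ 0 := by
      by_contra! h0
      nlinarith [mul_pos hc h0]
    exact norm_le_zero_iff.1 this
  let eq := LinearEquiv.ofInjective (J : lp (fun _ : ℕ => 𝕜) s →ₗ[𝕜] Y) hinj
  have heq : ∀ w, J (eq.symm w) = (w : Y) := by
    intro w
    have := congrArg Subtype.val (eq.apply_symm_apply w)
    exact this
  let f := LinearMap.mkContinuous
    ((coordL 𝕜 s m : lp (fun _ : ℕ => 𝕜) s →ₗ[𝕜] 𝕜).comp eq.symm.toLinearMap) (1 / c)
    (by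
      intro w
      change ‖coordL 𝕜 s m (eq.symm w)‖ ≤ _
      have h1 : ‖coordL 𝕜 s m (eq.symm w)‖ ≤ ‖eq.symm w‖ := by
        have := (coordL 𝕜 s m).le_of_opNorm_le (coordL_norm 𝕜 s m) (eq.symm w)
        rwa [one_mul] at this
      have h2 := hJ (eq.symm w)
      rw [heq] at h2
      rw [one_div, ← div_eq_inv_mul, le_div_iff₀ hc]
      have h3 : ‖(w : Y)‖ = ‖w‖ := rfl
      nlinarith)
  obtain ⟨g, hg, hgn⟩ := exists_extension_norm_eq _ f
  refine ⟨g, ?_, ?_⟩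
  · intro z
    have h := hg (eq z)
    have h1 : ((eq z : _) : Y) = J z := rfl
    rw [h1] at h
    rw [h]
    change coordL 𝕜 s m (eq.symm (eq z)) = _
    rw [LinearEquiv.symm_apply_apply, coordL_apply]
  · rw [hgn]
    exact LinearMap.mkContinuous_norm_le _ (by positivity) _

lemma sum_norm_sq_orth {𝕜 : Type*} [RCLike 𝕜] {H : Type*} [NormedAddCommGroup H]
    [InnerProductSpace 𝕜 H] {ι J : Type*} [Fintype ι] [Fintype J] [DecidableEq J]
    (M : J → ι → ℝ) (L : ℝ)
    (hM : ∀ j j', ∑ i, M j i * M j' i = if j = j' then L else 0) (u : J → H) :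
    ∑ i, ‖∑ j, (M j i : 𝕜) • u j‖ ^ 2 = L * ∑ j, ‖u j‖ ^ 2 := by
  have h : ((∑ i, ‖∑ j, (M j i : 𝕜) • u j‖ ^ 2 : ℝ) : 𝕜) = ((L * ∑ j, ‖u j‖ ^ 2 : ℝ) : 𝕜) := by
    push_cast
    simp_rw [← inner_self_eq_norm_sq_to_K (𝕜 := 𝕜)]
    simp_rw [sum_inner, inner_sum, inner_smul_left, inner_smul_right, RCLike.conj_ofReal]
    rw [Finset.sum_comm, Finset.mul_sum]
    refine Finset.sum_congr rfl (fun j _ => ?_)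
    rw [Finset.sum_comm]
    have : ∀ j', ∑ i, (M j i : 𝕜) * ((M j' i : 𝕜) * inner 𝕜 (u j) (u j')) =
        ((∑ i, M j i * M j' i : ℝ) : 𝕜) * inner 𝕜 (u j) (u j') := by
      intro j'
      push_cast
      rw [Finset.sum_mul]
      exact Finset.sum_congr rfl (fun i _ => by ring)
    simp_rw [this, hM]
    rw [Finset.sum_eq_single j]
    · simp
    · intro b _ hb
      simp [hb.symm]
    · simp
  exact_mod_cast h

lemma hilbert_est {𝕜 : Type*} [RCLike 𝕜] {H : Type*} [NormedAddCommGroup H]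
    [InnerProductSpace 𝕜 H] {ι J : Type*} [Fintype ι] [Fintype J] [DecidableEq J]
    (M : J → ι → ℝ) (L : ℝ) (b : ι → ℝ) (hb : ∀ i, 0 ≤ b i) (hL : 0 ≤ L)
    (hM : ∀ j j', ∑ i, M j i * M j' i = if j = j' then L else 0) (u : J → H) (a : ι → H)
    (Mu Ma : ℝ) (hu : ∀ j, ‖u j‖ ≤ Mu) (ha : ∀ i, ‖a i‖ ≤ Ma) :
    ‖∑ j, ∑ i, ((M j i * b i : ℝ) : 𝕜) * inner 𝕜 (u j) (a i)‖ ^ 2 ≤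
      L * (Fintype.card J * Mu ^ 2) * (∑ i, b i ^ 2) * Ma ^ 2 := by
  set v : ι → H := fun i => ∑ j, (M j i : 𝕜) • u j with hv
  have h1 : ∑ j, ∑ i, ((M j i * b i : ℝ) : 𝕜) * inner 𝕜 (u j) (a i) =
      ∑ i, (b i : 𝕜) * inner 𝕜 (v i) (a i) := by
    rw [Finset.sum_comm]
    refine Finset.sum_congr rfl (fun i _ => ?_)
    simp only [hv, sum_inner, inner_smul_left, RCLike.conj_ofReal, Finset.mul_sum]
    refine Finset.sum_congr rfl (fun j _ => ?_)
    push_cast; ring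
  have h2 : ‖∑ i, (b i : 𝕜) * inner 𝕜 (v i) (a i)‖ ≤ (∑ i, b i * ‖v i‖) * Ma := by
    rw [Finset.sum_mul]
    refine (norm_sum_le _ _).trans (Finset.sum_le_sum (fun i _ => ?_))
    rw [norm_mul, RCLike.norm_ofReal, abs_of_nonneg (hb i), mul_assoc]
    have := norm_inner_le_norm (𝕜 := 𝕜) (v i) (a i)
    have h3 : ‖v i‖ * ‖a i‖ ≤ ‖v i‖ * Ma := by gcongr; exact ha i
    exact mul_le_mul_of_nonneg_left (this.trans h3) (hb i)
  have h3 : (∑ i, b i * ‖v i‖) ^ 2 ≤ (∑ i, b i ^ 2) * ∑ i, ‖v i‖ ^ 2 :=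
    Finset.sum_mul_sq_le_sq_mul_sq _ _ _
  have h4 : ∑ i, ‖v i‖ ^ 2 = L * ∑ j, ‖u j‖ ^ 2 := sum_norm_sq_orth M L hM u
  have h5 : ∑ j, ‖u j‖ ^ 2 ≤ Fintype.card J * Mu ^ 2 := by
    calc ∑ j, ‖u j‖ ^ 2 ≤ ∑ j : J, Mu ^ 2 := by
          apply Finset.sum_le_sum
          intro j _
          gcongr
          exact hu j
      _ = _ := by simp
  rw [h1]
  calc _ ≤ ((∑ i, b i * ‖v i‖) * Ma) ^ 2 := by gcongr
    _ = (∑ i, b i * ‖v i‖) ^ 2 * Ma ^ 2 := by ring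
    _ ≤ ((∑ i, b i ^ 2) * (L * (Fintype.card J * Mu ^ 2))) * Ma ^ 2 := by
        gcongr
        refine h3.trans ?_
        rw [h4]
        gcongr
    _ = _ := by ring

lemma not_mem_closure_of_functionals {𝕜 V : Type*} [RCLike 𝕜] [NormedAddCommGroup V]
    [NormedSpace 𝕜 V] (Φ : ℕ → (V →ₗ[𝕜] 𝕜)) (D : ℝ) (hD : 0 ≤ D)
    (h : ∀ N S, ‖Φ N S‖ ≤ D * ‖S‖) (s : Set V)
    (hs : ∀ S ∈ s, Filter.Tendsto (fun N => Φ N S) Filter.atTop (nhds 0)) (T : V)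
    (hT : ∀ N, Φ N T = 1) : T ∉ (Submodule.span 𝕜 s).topologicalClosure := by
  intro hmem
  have hspan : ∀ S ∈ Submodule.span 𝕜 s, Filter.Tendsto (fun N => Φ N S) Filter.atTop (nhds 0) := by
    intro S hS
    induction hS using Submodule.span_induction with
    | mem x hx => exact hs x hx
    | zero => simp
    | add x y _ _ hx hy => simpa using hx.add hy
    | smul a x _ hx => simpa using hx.const_mul a
  have hmem' : T ∈ closure (Submodule.span 𝕜 s : Set V) := hmem
  rw [Metric.mem_closure_iff] at hmem'
  obtain ⟨S, hS, hd⟩ := hmem' (1 / (2 * (D + 1))) (by positivity)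
  rw [dist_eq_norm] at hd
  have h1 : ∀ N, ‖1 - Φ N S‖ ≤ 1 / 2 := by
    intro N
    rw [← hT N, ← map_sub]
    refine (h N _).trans ?_
    rw [lt_div_iff₀ (by positivity)] at hd
    nlinarith [norm_nonneg (T - S)]
  have h2 : Filter.Tendsto (fun N => ‖1 - Φ N S‖) Filter.atTop (nhds ‖(1 : 𝕜) - 0‖) :=
    ((hspan S hS).const_sub 1).norm
  have h3 := le_of_tendsto' h2 h1
  rw [sub_zero, norm_one] at h3
  norm_num at h3

lemma factor_decay {𝕜 : Type*} [RCLike 𝕜] {H X Y : Type*} [NormedAddCommGroup H]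
    [InnerProductSpace 𝕜 H] [CompleteSpace H] [NormedAddCommGroup X] [NormedSpace 𝕜 X]
    [NormedAddCommGroup Y] [NormedSpace 𝕜 Y] {I₀ J₀ : Type*} [Fintype I₀] [Fintype J₀]
    [DecidableEq J₀] (κ : J₀ → I₀ → ℝ) (β : I₀ → ℝ) (L : ℝ) (hβ : ∀ i, 0 < β i) (hL : 0 ≤ L)
    (hκ : ∀ j j', ∑ i, (κ j i / β i) * (κ j' i / β i) = if j = j' then L else 0)
    (N : ℕ) (y : (Fin N → J₀) → Y →L[𝕜] 𝕜) (v : (Fin N → I₀) → X) (D D' : ℝ)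
    (hy : ∀ j, ‖y j‖ ≤ D) (hv : ∀ i, ‖v i‖ ≤ D') (A : X →L[𝕜] H) (B : H →L[𝕜] Y) :
    ‖∑ j, y j (B (A (∑ i, (tpow κ N j i : 𝕜) • v i)))‖ ^ 2 ≤
      L ^ N * ((Fintype.card J₀ : ℝ) ^ N * (D * ‖B‖) ^ 2) * (∑ i, β i ^ 2) ^ N *
        (‖A‖ * D') ^ 2 := by
  classical
  let u : (Fin N → J₀) → H := fun j => (InnerProductSpace.toDual 𝕜 H).symm ((y j).comp B)
  have hu : ∀ j h, inner 𝕜 (u j) h = y j (B h) := by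
    intro j h
    exact InnerProductSpace.toDual_symm_apply
  have hun : ∀ j, ‖u j‖ ≤ D * ‖B‖ := by
    intro j
    have h1 : ‖u j‖ = ‖(y j).comp B‖ := LinearIsometryEquiv.norm_map _ _
    rw [h1]
    exact ((y j).opNorm_comp_le B).trans (by gcongr; exact hy j)
  let b : (Fin N → I₀) → ℝ := fun i => ∏ t, β (i t)
  have hb : ∀ i, 0 < b i := fun i => Finset.prod_pos (fun t _ => hβ _)
  have hK : ∀ j i, tpow κ N j i = tpow (fun j i => κ j i / β i) N j i * b i := by
    intro j i
    simp only [tpow, b]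
    rw [← Finset.prod_mul_distrib]
    exact Finset.prod_congr rfl (fun t _ => (div_mul_cancel₀ _ (hβ _).ne').symm)
  have horth : ∀ j j', ∑ i, tpow (fun j i => κ j i / β i) N j i *
      tpow (fun j i => κ j i / β i) N j' i = if j = j' then L ^ N else 0 := by
    intro j j'
    rw [tpow_sum_mul]
    simp_rw [hκ]
    split_ifs with h
    · subst h; simp
    · obtain ⟨t, ht⟩ := Function.ne_iff.1 h
      exact Finset.prod_eq_zero (Finset.mem_univ t) (by simp [ht])
  have hbs : ∑ i, b i ^ 2 = (∑ i, β i ^ 2) ^ N := by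
    simp only [b, ← Finset.prod_pow]
    rw [← Fintype.piFinset_univ,
      ← Finset.prod_univ_sum (fun _ : Fin N => (Finset.univ : Finset I₀)) (fun _ i => β i ^ 2)]
    simp
  have hav : ∀ i, ‖A (v i)‖ ≤ ‖A‖ * D' := fun i =>
    (A.le_opNorm _).trans (by gcongr; exact hv i)
  have hmain := hilbert_est (𝕜 := 𝕜) (tpow (fun j i => κ j i / β i) N) (L ^ N) b
    (fun i => (hb i).le) (by positivity) horth u (fun i => A (v i)) _ _ hun hav
  have heq : ∑ j, y j (B (A (∑ i, (tpow κ N j i : 𝕜) • v i))) =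
      ∑ j, ∑ i, ((tpow (fun j i => κ j i / β i) N j i * b i : ℝ) : 𝕜) *
        inner 𝕜 (u j) (A (v i)) := by
    refine Finset.sum_congr rfl (fun j _ => ?_)
    simp only [map_sum, map_smul, hu, smul_eq_mul]
    exact Finset.sum_congr rfl (fun i _ => by rw [hK])
  rw [heq]
  rw [hbs] at hmain
  simpa using hmain

lemma exists_index (I : Type) [Finite I] [Nonempty I] : Nonempty ((Σ N : ℕ, (Fin N → I)) ≃ ℕ) := by
  haveI : Infinite (Σ N : ℕ, (Fin N → I)) :=
    Infinite.of_injective (fun N : ℕ => (⟨N, fun _ => Classical.arbitrary I⟩ : Σ N : ℕ, (Fin N → I)))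
      (fun a b h => congrArg Sigma.fst h)
  exact nonempty_equiv_of_countable

/-- `1 < p < 2`, `1/p + 1/p' = 1`, `p' ≤ q < ∞`; `X` contains a complemented
copy of `ℓ_p` witnessed by `P, Q`, and `Ĵ : ℓ_q → Ŷ` is an isomorphic embedding.  Then
there is `Û : ℓ_p → ℓ_q`, finitely strictly singular and superstrictly cosingular, with
`Ĵ ∘ Û ∘ P` outside the closed linear span of the `ℓ₂`-factorable operators `X → Ŷ`. -/
theorem statement10 (𝕜 : Type*) [RCLike 𝕜] (p p' q : ℝ)
    (hp1 : 1 < p) (hp2 : p < 2) (hconj : 1 / p + 1 / p' = 1) (hq : p' ≤ q)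
    [Fact (1 ≤ ENNReal.ofReal p)] [Fact (1 ≤ ENNReal.ofReal q)]
    (X : Type*) [NormedAddCommGroup X] [NormedSpace 𝕜 X] [CompleteSpace X]
    (Yhat : Type*) [NormedAddCommGroup Yhat] [NormedSpace 𝕜 Yhat] [CompleteSpace Yhat]
    (P : X →L[𝕜] lp (fun _ : ℕ => 𝕜) (ENNReal.ofReal p))
    (Q : lp (fun _ : ℕ => 𝕜) (ENNReal.ofReal p) →L[𝕜] X)
    (hPQ : ∀ z, P (Q z) = z)
    (Jhat : lp (fun _ : ℕ => 𝕜) (ENNReal.ofReal q) →L[𝕜] Yhat) (c : ℝ) (hc : 0 < c)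
    (hJ : ∀ z, c * ‖z‖ ≤ ‖Jhat z‖) :
    ∃ Uhat : lp (fun _ : ℕ => 𝕜) (ENNReal.ofReal p) →L[𝕜]
        lp (fun _ : ℕ => 𝕜) (ENNReal.ofReal q),
      FinStrictSing Uhat ∧ SupStrictCosing Uhat ∧
      Jhat.comp (Uhat.comp P) ∉ closedSpanHilbertFactorable 𝕜 X Yhat := by
  classical
  have hp0 : 0 < p := by linarith
  have hp'0 : 0 < p' := by
    by_contra! h
    have h1 : 1 / p' ≤ 0 := one_div_nonpos.2 h
    have h2 : 1 / p < 1 := by rw [div_lt_one hp0]; exact hp1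
    linarith
  have hpr : p.HolderConjugate p' := by
    rw [Real.holderConjugate_iff]
    refine ⟨hp1, ?_⟩
    simpa [one_div] using hconj
  obtain ⟨t, k, τ, κ, β, L, ht2, htr, hτ, hκτ, hκp, hβ, hκ, hL, hlt⟩ := exists_block 𝕜 p p' hpr hp2
  have htq : t < q := lt_of_lt_of_le htr hq
  obtain ⟨e⟩ := exists_index ((Fin k → Bool) ⊕ (Fin k → Bool))
  obtain ⟨e'⟩ := exists_index (Fin k → Bool)
  obtain ⟨U, hU1, hU2⟩ := exists_U 𝕜 e e' (fun N => tpow τ N) p t q hp1.le (by linarith) htq.le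
    (fun N => MB_tpow τ p t hp0 (by linarith) hτ N)
  refine ⟨U, fun ε hε => U_fss t q (by linarith) htq U hU2 ε hε,
    fun ε hε => sscs_of_not_findim (lp_not_findim 𝕜 _) U ε hε, ?_⟩
  choose y hy hyn using exists_funcs Jhat c hc hJ
  have hpt : (ENNReal.ofReal p).toReal = p := ENNReal.toReal_ofReal hp0.le
  let n : ℕ := Fintype.card (Fin k → Bool)
  have hn : 0 < n := Fintype.card_pos
  have hnR : (0 : ℝ) < n := by exact_mod_cast hn
  have hn𝕜 : (n : 𝕜) ≠ 0 := by exact_mod_cast hn.ne'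
  let ev : ∀ N, (Fin N → (Fin k → Bool) ⊕ (Fin k → Bool)) → lp (fun _ : ℕ => 𝕜) (ENNReal.ofReal p) :=
    fun N i => lp.single (ENNReal.ofReal p) (e ⟨N, i⟩) (1 : 𝕜)
  have hev : ∀ N i, ‖ev N i‖ = 1 := by
    intro N i
    rw [lp.norm_single (by simpa using hp0), norm_one]
  let kv : ∀ N, (Fin N → (Fin k → Bool)) → lp (fun _ : ℕ => 𝕜) (ENNReal.ofReal p) :=
    fun N j => ∑ i, (tpow κ N j i : 𝕜) • ev N i
  have hkval : ∀ N j i, kv N j (e ⟨N, i⟩) = (tpow κ N j i : 𝕜) := by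
    intro N j i
    rw [← coordL_apply]
    simp only [kv, map_sum, map_smul, coordL_apply, ev]
    rw [Finset.sum_eq_single i]
    · rw [lp.single_apply_self]; simp
    · intro i' _ hi'
      rw [lp.single_apply_ne, smul_zero]
      intro h
      apply hi'
      have := e.injective h
      simpa using this.symm
    · simp
  have hkn : ∀ N j, ‖kv N j‖ = 1 := by
    intro N j
    let emb : (Fin N → (Fin k → Bool) ⊕ (Fin k → Bool)) ↪ ℕ :=
      ⟨fun i => e ⟨N, i⟩, fun a b h => by simpa using e.injective h⟩
    have h1 : kv N j = ∑ m ∈ Finset.univ.map emb,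
        lp.single (ENNReal.ofReal p) m (kv N j m) := by
      rw [Finset.sum_map]
      conv_lhs => simp only [kv]
      refine Finset.sum_congr rfl (fun i _ => ?_)
      change _ = lp.single (E := fun _ : ℕ => 𝕜) (ENNReal.ofReal p) (e ⟨N, i⟩) (kv N j (e ⟨N, i⟩))
      rw [hkval, ← lp.single_smul, smul_eq_mul, mul_one]
    have h2 := lp.norm_sum_single (p := ENNReal.ofReal p) (by rw [hpt]; exact hp0)
      (fun m => kv N j m) (Finset.univ.map emb)
    rw [← h1, hpt, Finset.sum_map] at h2
    have h3 : ∑ i, ‖kv N j (emb i)‖ ^ p = 1 := by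
      have : ∀ i, ‖kv N j (emb i)‖ ^ p = |tpow κ N j i| ^ p := by
        intro i
        change ‖kv N j (e ⟨N, i⟩)‖ ^ p = _
        rw [hkval, RCLike.norm_ofReal]
      simp_rw [this]
      rw [tpow_sum_abs_rpow]
      simp [hκp]
    rw [h3] at h2
    have h4 : ‖kv N j‖ ^ p = 1 ^ p := by rw [h2, Real.one_rpow]
    exact (Real.rpow_left_inj (norm_nonneg _) zero_le_one hp0.ne').1 h4
  let Φ : ℕ → ((X →L[𝕜] Yhat) →ₗ[𝕜] 𝕜) := fun N =>
    { toFun := fun S => ((n : 𝕜) ^ N)⁻¹ * ∑ j, y (e' ⟨N, j⟩) (S (Q (kv N j)))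
      map_add' := fun S T => by
        simp only [add_apply, map_add, Finset.sum_add_distrib, mul_add]
      map_smul' := fun a S => by
        simp only [smul_apply, map_smul, smul_eq_mul, RingHom.id_apply,
          ← Finset.mul_sum]
        ring }
  have hΦ : ∀ N S, Φ N S = ((n : 𝕜) ^ N)⁻¹ * ∑ j, y (e' ⟨N, j⟩) (S (Q (kv N j))) :=
    fun N S => rfl
  have hcard : ∀ N, Fintype.card (Fin N → (Fin k → Bool)) = n ^ N := by
    intro N
    rw [Fintype.card_fun, Fintype.card_fin]
  have hnn : ∀ N, ‖((n : 𝕜) ^ N)⁻¹‖ = ((n : ℝ) ^ N)⁻¹ := by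
    intro N
    rw [norm_inv, norm_pow, RCLike.norm_natCast]
  apply not_mem_closure_of_functionals Φ (1 / c * ‖Q‖) (by positivity)
  · intro N S
    rw [hΦ, norm_mul, hnn]
    have h1 : ‖∑ j, y (e' ⟨N, j⟩) (S (Q (kv N j)))‖ ≤ (n : ℝ) ^ N * (1 / c * ‖Q‖ * ‖S‖) := by
      refine (norm_sum_le _ _).trans ?_
      have h2 : ∀ j : Fin N → (Fin k → Bool), ‖y (e' ⟨N, j⟩) (S (Q (kv N j)))‖ ≤
          1 / c * ‖Q‖ * ‖S‖ := by
        intro j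
        have h3 : ‖Q (kv N j)‖ ≤ ‖Q‖ := by
          have := Q.le_opNorm (kv N j)
          rwa [hkn, mul_one] at this
        have h4 : ‖S (Q (kv N j))‖ ≤ ‖S‖ * ‖Q‖ :=
          (S.le_opNorm _).trans (by gcongr)
        have h5 := (y (e' ⟨N, j⟩)).le_of_opNorm_le (hyn (e' ⟨N, j⟩)) (S (Q (kv N j)))
        refine h5.trans ?_
        rw [mul_assoc, mul_comm ‖Q‖]
        gcongr
      refine (Finset.sum_le_sum (fun j _ => h2 j)).trans (le_of_eq ?_)
      rw [Finset.sum_const, Finset.card_univ, hcard, nsmul_eq_mul]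
      push_cast
      rfl
    calc _ ≤ ((n : ℝ) ^ N)⁻¹ * ((n : ℝ) ^ N * (1 / c * ‖Q‖ * ‖S‖)) := by gcongr
      _ = _ := by rw [← mul_assoc, inv_mul_cancel₀ (by positivity), one_mul]
  · rintro S ⟨A, B, rfl⟩
    rw [tendsto_zero_iff_norm_tendsto_zero]
    set ρ : ℝ := L * (∑ i, β i ^ 2) / n with hρ
    have hρ0 : 0 ≤ ρ := by positivity
    have hρ1 : ρ < 1 := by
      rw [hρ, div_lt_one hnR]; exact hlt
    set R : ℝ := (1 / c * ‖B‖) ^ 2 * (‖A‖ * ‖Q‖) ^ 2 with hR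
    have hb : ∀ N, ‖Φ N (B.comp A)‖ ≤ Real.sqrt (ρ ^ N * R) := by
      intro N
      apply Real.le_sqrt_of_sq_le
      have h1 := factor_decay κ β L hβ hL hκ N (fun j => y (e' ⟨N, j⟩)) (fun i => Q (ev N i))
        (1 / c) ‖Q‖ (fun j => hyn _) (fun i => by
          have := Q.le_opNorm (ev N i)
          rwa [hev, mul_one] at this) A B
      have h2 : ∀ j, Q (kv N j) = ∑ i, (tpow κ N j i : 𝕜) • Q (ev N i) := by
        intro j
        simp only [kv, map_sum, map_smul]
      rw [hΦ, norm_mul, hnn, mul_pow]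
      simp only [ContinuousLinearMap.comp_apply, h2]
      calc _ ≤ (((n : ℝ) ^ N)⁻¹) ^ 2 * (L ^ N * ((n : ℝ) ^ N * (1 / c * ‖B‖) ^ 2) *
            (∑ i, β i ^ 2) ^ N * (‖A‖ * ‖Q‖) ^ 2) := by
            gcongr
        _ = ρ ^ N * R := by
            rw [hρ, hR, div_pow, mul_pow L]
            have : (n : ℝ) ^ N ≠ 0 := by positivity
            field_simp
    have hlim : Filter.Tendsto (fun N : ℕ => Real.sqrt (ρ ^ N * R)) Filter.atTop (nhds 0) := by
      have h1 := ((tendsto_pow_atTop_nhds_zero_of_lt_one hρ0 hρ1).mul_const R).sqrt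
      simpa using h1
    exact squeeze_zero (fun N => norm_nonneg _) hb hlim
  · intro N
    rw [hΦ]
    have h1 : ∀ j, y (e' ⟨N, j⟩) ((Jhat.comp (U.comp P)) (Q (kv N j))) = 1 := by
      intro j
      rw [ContinuousLinearMap.comp_apply, ContinuousLinearMap.comp_apply, hPQ, hy, hU1]
      simp_rw [hkval]
      have h2 := tpow_sum_mul κ τ N j j
      simp only [hκτ, Finset.prod_const_one] at h2
      have h3 : ((∑ i, tpow κ N j i * tpow τ N j i : ℝ) : 𝕜) = 1 := by rw [h2]; simp
      rw [← h3]
      push_cast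
      exact Finset.sum_congr rfl (fun i _ => mul_comm _ _)
    simp_rw [h1]
    rw [Finset.sum_const, Finset.card_univ, hcard, nsmul_eq_mul, mul_one]
    push_cast
    exact inv_mul_cancel₀ (pow_ne_zero _ hn𝕜)

end
end

section
/- Let 1 < p < ∞. Let Z_p = (⊕_{n≥1} ℓ₂ⁿ)_{ℓ_p} denote the ℓ_p-sum of the finite-dimensional Euclidean spaces ℓ₂ⁿ, fix an isomorphism D : ℓ_p → Z_p (such a D exists by Pełczyński's decomposition), fix positive integers (k_n) and linear maps θ_n : ℓ₂ⁿ → ℓ_∞^{k_n} satisfying ‖x‖/2 ≤ ‖θ_n x‖ ≤ ‖x‖ for all x ∈ ℓ₂ⁿ, and let Θ : Z_p → (⊕_{n≥1} ℓ_∞^{k_n})_{c₀} be the bounded operator sending (x_n)_n to (θ_n x_n)_n (i.e. Θ is the composition of the formal identity Z_p → (⊕ ℓ₂ⁿ)_{c₀} with ⊕_n θ_n; the space (⊕ ℓ_∞^{k_n})_{c₀} is canonically isometric to c₀). Suppose R ∈ L(ℓ_p, c₀) is not finitely strictly singular. Then the operator T = Θ∘D factors through R: there exist bounded operators A ∈ L(ℓ_p,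 ℓ_p) and B ∈ L(c₀, (⊕ ℓ_∞^{k_n})_{c₀}) such that T = B∘R∘A. -/
open scoped ENNReal

set_option synthInstance.maxHeartbeats 1000000
set_option maxHeartbeats 1000000

noncomputable section

/-- average over the discrete cube -/
noncomputable def cubeAvg (k : ℕ) (f : (Fin k → Bool) → ℝ) : ℝ := (∑ ω, f ω) / 2 ^ k

/-- sign -/
def sgn16 (𝕜 : Type*) [RCLike 𝕜] (b : Bool) : 𝕜 := if b then 1 else -1

lemma cubeAvg_succ (k : ℕ) (f : (Fin (k+1) → Bool) → ℝ) :
    cubeAvg (k+1) f = (cubeAvg k (fun ω => f (Fin.cons true ω)) +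
      cubeAvg k (fun ω => f (Fin.cons false ω))) / 2 := by
  unfold cubeAvg
  have : ∑ ω, f ω = ∑ q : Bool × (Fin k → Bool), f (Fin.cons q.1 q.2) := by
    symm
    exact Fintype.sum_equiv (Fin.consEquiv (fun _ => Bool)) _ _ (fun q => rfl)
  rw [this, Fintype.sum_prod_type, Fintype.sum_bool, pow_succ]
  field_simp

lemma cubeAvg_zero (f : (Fin 0 → Bool) → ℝ) : cubeAvg 0 f = f (fun i => i.elim0) := by
  unfold cubeAvg
  simp only [Finset.univ_unique, Finset.sum_singleton, pow_zero, div_one]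
  exact congrArg f (Subsingleton.elim _ _)

lemma cubeAvg_add (k : ℕ) (f g : (Fin k → Bool) → ℝ) :
    cubeAvg k (fun ω => f ω + g ω) = cubeAvg k f + cubeAvg k g := by
  unfold cubeAvg; rw [Finset.sum_add_distrib, add_div]

lemma cubeAvg_sub (k : ℕ) (f g : (Fin k → Bool) → ℝ) :
    cubeAvg k (fun ω => f ω - g ω) = cubeAvg k f - cubeAvg k g := by
  unfold cubeAvg; rw [Finset.sum_sub_distrib, sub_div]

lemma cubeAvg_mul (k : ℕ) (c : ℝ) (f : (Fin k → Bool) → ℝ) :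
    cubeAvg k (fun ω => c * f ω) = c * cubeAvg k f := by
  unfold cubeAvg; rw [← Finset.mul_sum, mul_div_assoc]

lemma cubeAvg_const (k : ℕ) (c : ℝ) : cubeAvg k (fun _ => c) = c := by
  unfold cubeAvg; simp

lemma cubeAvg_mono (k : ℕ) {f g : (Fin k → Bool) → ℝ} (h : ∀ ω, f ω ≤ g ω) :
    cubeAvg k f ≤ cubeAvg k g := by
  unfold cubeAvg; gcongr with ω; exact h ω

lemma cubeAvg_sum {ι : Type*} (s : Finset ι) (k : ℕ) (f : ι → (Fin k → Bool) → ℝ) :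
    cubeAvg k (fun ω => ∑ i ∈ s, f i ω) = ∑ i ∈ s, cubeAvg k (f i) := by
  unfold cubeAvg; rw [Finset.sum_comm, Finset.sum_div]

lemma cubeAvg_exists_le (k : ℕ) (f : (Fin k → Bool) → ℝ) : ∃ ω, f ω ≤ cubeAvg k f := by
  by_contra! h
  have h1 : ∑ ω : Fin k → Bool, cubeAvg k f < ∑ ω, f ω :=
    Finset.sum_lt_sum_of_nonempty Finset.univ_nonempty (fun ω _ => h ω)
  simp only [Finset.sum_const, Finset.card_univ, Fintype.card_fun, Fintype.card_bool,
    Fintype.card_fin, nsmul_eq_mul] at h1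
  unfold cubeAvg at h1
  push_cast at h1
  rw [mul_div_cancel₀ _ (by positivity)] at h1
  exact lt_irrefl _ h1

lemma cubeAvg_sq_le (k : ℕ) (f : (Fin k → Bool) → ℝ) :
    (cubeAvg k f) ^ 2 ≤ cubeAvg k (fun ω => f ω ^ 2) := by
  have h := cubeAvg_mono k (f := fun _ => 0) (g := fun ω => (f ω - cubeAvg k f) ^ 2)
    (fun ω => sq_nonneg _)
  have e : (fun ω => (f ω - cubeAvg k f) ^ 2) =
      fun ω => f ω ^ 2 - ((2 * cubeAvg k f) * f ω - cubeAvg k f ^ 2) := by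
    funext ω; ring
  rw [e, cubeAvg_const, cubeAvg_sub, cubeAvg_sub, cubeAvg_mul, cubeAvg_const] at h
  nlinarith

/-- flip a coordinate -/
def flip16 {k : ℕ} (i : Fin k) (ω : Fin k → Bool) : Fin k → Bool := Function.update ω i (!ω i)

lemma flip16_flip16 {k : ℕ} (i : Fin k) (ω : Fin k → Bool) : flip16 i (flip16 i ω) = ω := by
  unfold flip16; simp

lemma cubeAvg_flip {k : ℕ} (i : Fin k) (f : (Fin k → Bool) → ℝ) :
    cubeAvg k (fun ω => f (flip16 i ω)) = cubeAvg k f := by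
  unfold cubeAvg
  congr 1
  exact Fintype.sum_equiv ⟨flip16 i, flip16 i, flip16_flip16 i, flip16_flip16 i⟩ _ _ (fun _ => rfl)

lemma flip_zero_cons {k : ℕ} (b : Bool) (ω : Fin k → Bool) :
    flip16 (0 : Fin (k+1)) (Fin.cons b ω : Fin (k+1) → Bool) = Fin.cons (!b) ω := by
  unfold flip16; simp

lemma flip_succ_cons {k : ℕ} (i : Fin k) (b : Bool) (ω : Fin k → Bool) :
    flip16 i.succ (Fin.cons b ω : Fin (k+1) → Bool) = Fin.cons b (flip16 i ω) := by
  unfold flip16; simp [Fin.cons_update]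

/-- Efron-Stein -/
lemma efron_stein : ∀ (k : ℕ) (f : (Fin k → Bool) → ℝ),
    cubeAvg k (fun ω => f ω ^ 2) - (cubeAvg k f) ^ 2 ≤
      ∑ i, cubeAvg k (fun ω => (f ω - f (flip16 i ω)) ^ 2) / 4 := by
  intro k
  induction k with
  | zero => intro f; simp [cubeAvg_zero]
  | succ k ih =>
    intro f
    rw [Fin.sum_univ_succ]
    simp only [cubeAvg_succ, flip_zero_cons, flip_succ_cons, Bool.not_true, Bool.not_false]
    have h1 := ih (fun ω => f (Fin.cons true ω))
    have h2 := ih (fun ω => f (Fin.cons false ω))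
    have h3 := cubeAvg_sq_le k (fun ω => f (Fin.cons true ω) - f (Fin.cons false ω))
    rw [cubeAvg_sub] at h3
    have e1 : cubeAvg k (fun ω => (f (Fin.cons false ω) - f (Fin.cons true ω))^2) =
      cubeAvg k (fun ω => (f (Fin.cons true ω) - f (Fin.cons false ω))^2) := by
      congr 1; funext ω; ring
    rw [e1]
    have e2 : ∀ a b : Fin k → ℝ, ∑ i, (a i + b i) / 2 / 4 = (∑ i, a i / 4 + ∑ i, b i / 4) / 2 := by
      intro a b
      rw [← Finset.sum_add_distrib, Finset.sum_div]
      congr 1; funext i; ring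
    rw [e2]
    nlinarith

section normvar
variable {𝕜 : Type*} [RCLike 𝕜] {X : Type*} [NormedAddCommGroup X] [NormedSpace 𝕜 X]

/-- Rademacher sum -/
def rad16 {k : ℕ} (z : Fin k → X) (ω : Fin k → Bool) : X := ∑ i, sgn16 𝕜 (ω i) • z i

lemma sgn16_not (b : Bool) : sgn16 𝕜 (!b) = - sgn16 𝕜 b := by cases b <;> simp [sgn16]
lemma norm_sgn16 (b : Bool) : ‖sgn16 𝕜 b‖ = 1 := by cases b <;> simp [sgn16]

lemma rad16_cons {k : ℕ} (z : Fin (k+1) → X) (b : Bool) (ω : Fin k → Bool) :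
    rad16 (𝕜 := 𝕜) z (Fin.cons b ω) = sgn16 𝕜 b • z 0 + rad16 (𝕜 := 𝕜) (fun i => z i.succ) ω := by
  unfold rad16; rw [Fin.sum_univ_succ]; simp

lemma rad16_flip {k : ℕ} (z : Fin k → X) (i : Fin k) (ω : Fin k → Bool) :
    rad16 (𝕜 := 𝕜) z ω - rad16 (𝕜 := 𝕜) z (flip16 i ω) = (2 : 𝕜) • sgn16 𝕜 (ω i) • z i := by
  unfold rad16
  rw [← Finset.sum_sub_distrib, Finset.sum_eq_single i]
  · simp [flip16, sgn16_not, two_smul]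
  · intro j _ hj; simp [flip16, hj]
  · simp

lemma norm_var {k : ℕ} (z : Fin k → X)
    (hz : ∀ s : X →L[𝕜] 𝕜, ‖s‖ ≤ 1 → ∑ i, ‖s (z i)‖ ^ 2 ≤ 1) :
    cubeAvg k (fun ω => (‖rad16 (𝕜 := 𝕜) z ω‖ - cubeAvg k (fun ω => ‖rad16 (𝕜 := 𝕜) z ω‖)) ^ 2) ≤ 2 := by
  set f : (Fin k → Bool) → ℝ := fun ω => ‖rad16 (𝕜 := 𝕜) z ω‖ with hf
  have e : (fun ω => (f ω - cubeAvg k f) ^ 2) =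
      fun ω => f ω ^ 2 - ((2 * cubeAvg k f) * f ω - cubeAvg k f ^ 2) := by
    funext ω; ring
  have e0 : cubeAvg k (fun ω => (f ω - cubeAvg k f) ^ 2) =
      cubeAvg k (fun ω => f ω ^ 2) - (cubeAvg k f) ^ 2 := by
    rw [e, cubeAvg_sub, cubeAvg_sub, cubeAvg_mul, cubeAvg_const]; ring
  rw [e0]
  refine (efron_stein k f).trans ?_
  have h1 : ∀ i, cubeAvg k (fun ω => (f ω - f (flip16 i ω)) ^ 2) =
      2 * cubeAvg k (fun ω => (max (f ω - f (flip16 i ω)) 0) ^ 2) := by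
    intro i
    have : (fun ω => (f ω - f (flip16 i ω)) ^ 2) = fun ω => (max (f ω - f (flip16 i ω)) 0) ^ 2 +
        (fun ω' => (max (f ω' - f (flip16 i ω')) 0) ^ 2) (flip16 i ω) := by
      funext ω
      simp only [flip16_flip16]
      rcases le_total (f ω) (f (flip16 i ω)) with h | h
      · rw [max_eq_right (by linarith), max_eq_left (by linarith)]; ring
      · rw [max_eq_left (by linarith), max_eq_right (by linarith)]; ring
    rw [this, cubeAvg_add, cubeAvg_flip i (fun ω' => (max (f ω' - f (flip16 i ω')) 0) ^ 2)]; ring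
  simp_rw [h1]
  rw [← Finset.sum_div, ← Finset.mul_sum, ← cubeAvg_sum]
  have h2 : cubeAvg k (fun ω => ∑ i, (max (f ω - f (flip16 i ω)) 0) ^ 2) ≤ cubeAvg k (fun _ => 4) := by
    apply cubeAvg_mono
    intro ω
    obtain ⟨s, hs1, hs2⟩ := exists_dual_vector'' 𝕜 (rad16 (𝕜 := 𝕜) z ω)
    have h3 : ∀ i, (max (f ω - f (flip16 i ω)) 0) ^ 2 ≤ 4 * ‖s (z i)‖ ^ 2 := by
      intro i
      have h4 : f ω - f (flip16 i ω) ≤ 2 * ‖s (z i)‖ := by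
        have h5 : RCLike.re (s (rad16 (𝕜 := 𝕜) z ω)) = f ω := by rw [hs2]; simp [hf]
        have h6 : RCLike.re (s (rad16 (𝕜 := 𝕜) z (flip16 i ω))) ≤ f (flip16 i ω) :=
          (RCLike.re_le_norm _).trans ((s.le_opNorm _).trans
            (by rw [hf]; exact mul_le_of_le_one_left (norm_nonneg _) hs1))
        have h7 : f ω - f (flip16 i ω) ≤
            RCLike.re (s (rad16 (𝕜 := 𝕜) z ω - rad16 (𝕜 := 𝕜) z (flip16 i ω))) := by
          rw [map_sub, map_sub]; linarith
        rw [rad16_flip] at h7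
        refine h7.trans ((RCLike.re_le_norm _).trans ?_)
        simp [norm_smul, norm_sgn16]
      have h8 : max (f ω - f (flip16 i ω)) 0 ≤ 2 * ‖s (z i)‖ := max_le h4 (by positivity)
      have h9 : (0:ℝ) ≤ max (f ω - f (flip16 i ω)) 0 := le_max_right _ _
      nlinarith
    calc _ ≤ ∑ i, 4 * ‖s (z i)‖ ^ 2 := Finset.sum_le_sum (fun i _ => h3 i)
      _ ≤ 4 := by rw [← Finset.mul_sum]; linarith [hz s hs1]
  rw [cubeAvg_const] at h2
  linarith
end normvar

section khin
variable {𝕜 : Type*} [RCLike 𝕜]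

lemma khin_sq : ∀ (k : ℕ) (c : Fin k → 𝕜) (v : 𝕜),
    cubeAvg k (fun ω => ‖v + rad16 (𝕜 := 𝕜) c ω‖ ^ 2) = ‖v‖ ^ 2 + ∑ i, ‖c i‖ ^ 2 := by
  intro k
  induction k with
  | zero => intro c v; simp [cubeAvg_zero, rad16]
  | succ k ih =>
    intro c v
    rw [cubeAvg_succ]
    simp only [rad16_cons, ← add_assoc]
    rw [ih, ih, Fin.sum_univ_succ]
    have := parallelogram_law_with_norm 𝕜 v (c 0)
    simp only [sgn16]
    simp
    rw [← sub_eq_add_neg]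
    nlinarith

lemma khin_exp : ∀ (k : ℕ) (c : Fin k → ℝ),
    cubeAvg k (fun ω => Real.exp (rad16 (𝕜 := ℝ) c ω)) ≤ Real.exp ((∑ i, c i ^ 2) / 2) := by
  intro k
  induction k with
  | zero => intro c; simp [cubeAvg_zero, rad16]
  | succ k ih =>
    intro c
    rw [cubeAvg_succ]
    simp only [rad16_cons, Real.exp_add, cubeAvg_mul]
    have h := ih (fun i => c i.succ)
    have h2 := Real.cosh_le_exp_half_sq (c 0)
    rw [Real.cosh_eq] at h2
    rw [Fin.sum_univ_succ, add_div (c 0 ^ 2), Real.exp_add]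
    simp only [sgn16]
    simp
    have h3 := mul_le_mul h2 h (by
      have := cubeAvg_mono k (f := fun _ => 0) (g := fun ω => Real.exp (rad16 (𝕜 := ℝ) (fun i => c i.succ) ω)) (fun ω => (Real.exp_pos _).le)
      rwa [cubeAvg_const] at this) (by positivity)
    linarith

lemma re_rad16 {k : ℕ} (c : Fin k → 𝕜) (ω) :
    RCLike.re (rad16 (𝕜 := 𝕜) c ω) = rad16 (𝕜 := ℝ) (fun i => RCLike.re (c i)) ω := by
  unfold rad16
  rw [map_sum]
  refine Finset.sum_congr rfl fun i _ => ?_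
  cases ω i <;> simp [sgn16]

lemma im_rad16 {k : ℕ} (c : Fin k → 𝕜) (ω) :
    RCLike.im (rad16 (𝕜 := 𝕜) c ω) = rad16 (𝕜 := ℝ) (fun i => RCLike.im (c i)) ω := by
  unfold rad16
  rw [map_sum]
  refine Finset.sum_congr rfl fun i _ => ?_
  cases ω i <;> simp [sgn16]

lemma rad16_mul {k : ℕ} (t : 𝕜) (c : Fin k → 𝕜) (ω) :
    rad16 (𝕜 := 𝕜) (fun i => t * c i) ω = t * rad16 (𝕜 := 𝕜) c ω := by
  unfold rad16
  rw [Finset.mul_sum]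
  refine Finset.sum_congr rfl fun i _ => ?_
  simp only [smul_eq_mul]; ring

lemma khin_exp_abs (k : ℕ) (c : Fin k → ℝ) (hc : ∑ i, c i ^ 2 ≤ 1) :
    cubeAvg k (fun ω => Real.exp (2 * |rad16 (𝕜 := ℝ) c ω|)) ≤ 2 * Real.exp 2 := by
  have h1 := khin_exp k (fun i => 2 * c i)
  have h2 := khin_exp k (fun i => (-2) * c i)
  simp only [rad16_mul] at h1 h2
  have e : ∑ i, (2 * c i) ^ 2 = 4 * ∑ i, c i ^ 2 := by
    rw [Finset.mul_sum]; congr 1; funext i; ring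
  have e' : ∑ i, ((-2) * c i) ^ 2 = 4 * ∑ i, c i ^ 2 := by
    rw [Finset.mul_sum]; congr 1; funext i; ring
  rw [e] at h1
  rw [e'] at h2
  have h3 : Real.exp (4 * (∑ i, c i ^ 2) / 2) ≤ Real.exp 2 := Real.exp_le_exp.mpr (by linarith)
  have h4 : cubeAvg k (fun ω => Real.exp (2 * |rad16 (𝕜 := ℝ) c ω|)) ≤
     cubeAvg k (fun ω => Real.exp (2 * rad16 (𝕜 := ℝ) c ω) + Real.exp (-2 * rad16 (𝕜 := ℝ) c ω)) := by
    apply cubeAvg_mono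
    intro ω
    rcases abs_cases (rad16 (𝕜 := ℝ) c ω) with ⟨h, _⟩ | ⟨h, _⟩ <;> rw [h]
    · linarith [Real.exp_pos (-2 * rad16 (𝕜 := ℝ) c ω)]
    · have := Real.exp_pos (2 * rad16 (𝕜 := ℝ) c ω)
      rw [show 2 * -rad16 (𝕜 := ℝ) c ω = -2 * rad16 (𝕜 := ℝ) c ω by ring]
      linarith
  rw [cubeAvg_add] at h4
  linarith

lemma khin_upper_one (p : ℝ) (hp : 0 < p) : ∃ B : ℝ, 0 < B ∧ ∀ (k : ℕ) (c : Fin k → 𝕜),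
    ∑ i, ‖c i‖ ^ 2 ≤ 1 → cubeAvg k (fun ω => ‖rad16 (𝕜 := 𝕜) c ω‖ ^ p) ≤ B := by
  obtain ⟨m, hm⟩ := exists_nat_ge p
  set K : ℝ := 1 + (m.factorial : ℝ) with hK
  have hK0 : 0 < K := by positivity
  have key : ∀ t : ℝ, 0 ≤ t → t ^ p ≤ K * Real.exp t := by
    intro t ht
    have h1 : t ^ p ≤ 1 + t ^ m := by
      rcases le_total t 1 with h | h
      · have := Real.rpow_le_one ht h hp.le
        have : 0 ≤ t ^ m := by positivity
        linarith
      · have := Real.rpow_le_rpow_of_exponent_le h hm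
        rw [Real.rpow_natCast] at this
        linarith
    have h2 := Real.pow_div_factorial_le_exp t ht m
    rw [div_le_iff₀ (by positivity)] at h2
    have h3 := Real.one_le_exp ht
    rw [hK]; nlinarith
  refine ⟨2 * K * Real.exp 2, by positivity, ?_⟩
  intro k c hc
  have hre : ∑ i, (RCLike.re (c i)) ^ 2 ≤ 1 := by
    refine le_trans (Finset.sum_le_sum fun i _ => ?_) hc
    rw [sq_le_sq, abs_norm]; exact RCLike.abs_re_le_norm _
  have him : ∑ i, (RCLike.im (c i)) ^ 2 ≤ 1 := by
    refine le_trans (Finset.sum_le_sum fun i _ => ?_) hc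
    rw [sq_le_sq, abs_norm]; exact RCLike.abs_im_le_norm _
  have h1 := khin_exp_abs k _ hre
  have h2 := khin_exp_abs k _ him
  have h3 : cubeAvg k (fun ω => ‖rad16 (𝕜 := 𝕜) c ω‖ ^ p) ≤ cubeAvg k (fun ω =>
      (K / 2) * (Real.exp (2 * |rad16 (𝕜 := ℝ) (fun i => RCLike.re (c i)) ω|) +
       Real.exp (2 * |rad16 (𝕜 := ℝ) (fun i => RCLike.im (c i)) ω|))) := by
    apply cubeAvg_mono
    intro ω
    have h4 := key _ (norm_nonneg (rad16 (𝕜 := 𝕜) c ω))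
    rw [← re_rad16, ← im_rad16]
    set Z := rad16 (𝕜 := 𝕜) c ω
    have h5 : ‖Z‖ ≤ |RCLike.re Z| + |RCLike.im Z| := by
      have h := RCLike.norm_sq_eq_def (z := Z)
      have h' := norm_nonneg Z
      nlinarith [abs_nonneg (RCLike.re Z), abs_nonneg (RCLike.im Z), sq_abs (RCLike.re Z), sq_abs (RCLike.im Z), mul_nonneg (abs_nonneg (RCLike.re Z)) (abs_nonneg (RCLike.im Z))]
    have h6 : Real.exp ‖Z‖ ≤ Real.exp (|RCLike.re Z|) * Real.exp (|RCLike.im Z|) := by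
      rw [← Real.exp_add]; exact Real.exp_le_exp.mpr h5
    have h7 : ∀ t : ℝ, Real.exp (2 * t) = Real.exp t ^ 2 := fun t => by
      rw [← Real.exp_nat_mul]; norm_num
    rw [h7, h7]
    have h8 : Real.exp ‖Z‖ ≤ (Real.exp (|RCLike.re Z|) ^ 2 + Real.exp (|RCLike.im Z|) ^ 2) / 2 := by
      nlinarith [sq_nonneg (Real.exp (|RCLike.re Z|) - Real.exp (|RCLike.im Z|))]
    nlinarith
  rw [cubeAvg_mul, cubeAvg_add] at h3
  have e2 := Real.exp_pos 2
  nlinarith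

/-- scaling helper -/
lemma rad16_scale {k : ℕ} (c : Fin k → 𝕜) (s : ℝ) (hs : 0 < s) (h : ∑ i, ‖c i‖ ^ 2 = s ^ 2) :
    ∃ d : Fin k → 𝕜, ∑ i, ‖d i‖ ^ 2 = 1 ∧ ∀ ω, ‖rad16 (𝕜 := 𝕜) c ω‖ = s * ‖rad16 (𝕜 := 𝕜) d ω‖ := by
  refine ⟨fun i => ((s⁻¹ : ℝ) : 𝕜) * c i, ?_, ?_⟩
  · simp only [norm_mul, mul_pow, ← Finset.mul_sum, h, RCLike.norm_ofReal, sq_abs]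
    field_simp
  · intro ω
    rw [rad16_mul, norm_mul, RCLike.norm_ofReal, abs_of_pos (by positivity)]
    field_simp

lemma rad16_of_zero {k : ℕ} (c : Fin k → 𝕜) (h : ∑ i, ‖c i‖ ^ 2 = 0) (ω) :
    rad16 (𝕜 := 𝕜) c ω = 0 := by
  rw [Finset.sum_eq_zero_iff_of_nonneg (fun i _ => by positivity)] at h
  unfold rad16
  refine Finset.sum_eq_zero fun i hi => ?_
  have := h i hi
  simp at this
  simp [this]

lemma khin_upper (p : ℝ) (hp : 0 < p) : ∃ B : ℝ, 0 < B ∧ ∀ (k : ℕ) (c : Fin k → 𝕜) (s : ℝ), 0 ≤ s →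
    ∑ i, ‖c i‖ ^ 2 = s ^ 2 → cubeAvg k (fun ω => ‖rad16 (𝕜 := 𝕜) c ω‖ ^ p) ≤ B * s ^ p := by
  obtain ⟨B, hB, h⟩ := khin_upper_one (𝕜 := 𝕜) p hp
  refine ⟨B, hB, fun k c s hs hc => ?_⟩
  rcases hs.eq_or_lt with rfl | hs
  · simp only [rad16_of_zero c (by simpa using hc), norm_zero, Real.zero_rpow hp.ne', cubeAvg_const]
    simp
  · obtain ⟨d, hd, hd2⟩ := rad16_scale c s hs hc
    simp only [hd2]
    have := h k d hd.le
    simp only [Real.mul_rpow hs.le (norm_nonneg _), cubeAvg_mul]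
    rw [mul_comm]
    gcongr

lemma khin_lower : ∃ b : ℝ, 0 < b ∧ ∀ (k : ℕ) (c : Fin k → 𝕜) (s : ℝ), 0 ≤ s →
    ∑ i, ‖c i‖ ^ 2 = s ^ 2 → b * s ≤ cubeAvg k (fun ω => ‖rad16 (𝕜 := 𝕜) c ω‖) := by
  obtain ⟨B, hB, h⟩ := khin_upper_one (𝕜 := 𝕜) 4 (by norm_num)
  set l := Real.sqrt (2 * B) with hl
  have hl2 : l ^ 2 = 2 * B := Real.sq_sqrt (by positivity)
  have hl0 : 0 < l := Real.sqrt_pos.mpr (by positivity)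
  refine ⟨1 / (2 * l), by positivity, fun k c s hs hc => ?_⟩
  rcases hs.eq_or_lt with rfl | hs
  · simp only [rad16_of_zero c (by simpa using hc), norm_zero, cubeAvg_const]
    simp
  · obtain ⟨d, hd, hd2⟩ := rad16_scale c s hs hc
    simp only [hd2]
    have h1 := h k d hd.le
    have h2 := khin_sq k d 0
    rw [hd] at h2
    simp only [zero_add, norm_zero] at h2
    have h3 : cubeAvg k (fun ω => ‖rad16 (𝕜 := 𝕜) d ω‖ ^ 2) ≤ cubeAvg k (fun ω =>
        l * ‖rad16 (𝕜 := 𝕜) d ω‖ + (1 / l ^ 2) * ‖rad16 (𝕜 := 𝕜) d ω‖ ^ (4:ℝ)) := by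
      apply cubeAvg_mono
      intro ω
      have e : ‖rad16 (𝕜 := 𝕜) d ω‖ ^ (4:ℝ) = ‖rad16 (𝕜 := 𝕜) d ω‖ ^ 4 := by
        rw [← Real.rpow_natCast]; norm_num
      rw [e]
      set t := ‖rad16 (𝕜 := 𝕜) d ω‖
      have ht : 0 ≤ t := norm_nonneg _
      rcases le_total t l with h | h
      · have : 0 ≤ 1 / l ^ 2 * t ^ 4 := by positivity
        nlinarith
      · have : t ^ 2 ≤ 1 / l ^ 2 * t ^ 4 := by
          rw [one_div, inv_mul_eq_div, le_div_iff₀ (by positivity)]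
          have : l ^ 2 ≤ t ^ 2 := by gcongr
          nlinarith [sq_nonneg t]
        have : 0 ≤ l * t := by positivity
        linarith
    rw [cubeAvg_add, cubeAvg_mul, cubeAvg_mul, h2, hl2] at h3
    rw [cubeAvg_mul]
    have h4 : 1 / (2 * B) * cubeAvg k (fun ω => ‖rad16 (𝕜 := 𝕜) d ω‖ ^ (4:ℝ)) ≤ 1 / 2 := by
      rw [one_div, inv_mul_eq_div, div_le_iff₀ (by positivity)]; linarith
    have h5 : 1 / (2 * l) ≤ cubeAvg k (fun ω => ‖rad16 (𝕜 := 𝕜) d ω‖) := by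
      rw [div_le_iff₀ (by positivity)]; nlinarith
    rw [mul_comm]
    gcongr
end khin


section DR
variable {𝕜 : Type*} [RCLike 𝕜] {E : Type*} [NormedAddCommGroup E] [NormedSpace 𝕜 E]
  [FiniteDimensional 𝕜 E]

lemma exists_max_det (N : ℕ) (hN : Module.finrank 𝕜 E = N) :
    ∃ u : EuclideanSpace 𝕜 (Fin N) →L[𝕜] E, (∀ x, ‖u x‖ ≤ ‖x‖) ∧
      ∀ (T : EuclideanSpace 𝕜 (Fin N) →ₗ[𝕜] EuclideanSpace 𝕜 (Fin N)) (r : ℝ), 0 < r →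
        (∀ x, ‖u (T x)‖ ≤ r * ‖x‖) → ‖LinearMap.det T‖ ≤ r ^ N := by
  let H := EuclideanSpace 𝕜 (Fin N)
  let φ : E ≃L[𝕜] H := ContinuousLinearEquiv.ofFinrankEq (by simp [H, hN])
  let d : (H →L[𝕜] E) → ℝ := fun u => ‖((φ : E →L[𝕜] H).comp u).det‖
  have hd : Continuous d := by
    have h1 : Continuous (fun u : H →L[𝕜] E => (φ : E →L[𝕜] H).comp u) :=
      (ContinuousLinearMap.compL 𝕜 H E H (φ : E →L[𝕜] H)).continuous
    exact (ContinuousLinearMap.continuous_det.comp h1).norm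
  have : ProperSpace (H →L[𝕜] E) := FiniteDimensional.proper 𝕜 _
  obtain ⟨u, hu, hmax⟩ := (isCompact_closedBall (0 : H →L[𝕜] E) 1).exists_isMaxOn
    ⟨0, by simp⟩ hd.continuousOn
  rw [mem_closedBall_zero_iff] at hu
  have hdet : ∀ (v : H →L[𝕜] E), d v = ‖LinearMap.det ((φ : E →ₗ[𝕜] H) ∘ₗ (v : H →ₗ[𝕜] E))‖ :=
    fun v => rfl
  have hpos : 0 < d u := by
    set r : ℝ := (‖(φ.symm : H →L[𝕜] E)‖ + 1)⁻¹ with hr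
    have hr0 : 0 < r := by positivity
    have h1 : ((r : 𝕜) • (φ.symm : H →L[𝕜] E)) ∈ Metric.closedBall (0 : H →L[𝕜] E) 1 := by
      rw [mem_closedBall_zero_iff, norm_smul, RCLike.norm_ofReal, abs_of_pos hr0, hr,
        inv_mul_le_iff₀ (by positivity)]
      linarith
    have h2 := hmax h1
    have h3 : d ((r : 𝕜) • (φ.symm : H →L[𝕜] E)) = r ^ N := by
      rw [hdet]
      have : ((φ : E →ₗ[𝕜] H) ∘ₗ (((r : 𝕜) • (φ.symm : H →L[𝕜] E) : H →L[𝕜] E) : H →ₗ[𝕜] E)) =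
          (r : 𝕜) • LinearMap.id := by
        ext x; simp
      rw [this, LinearMap.det_smul]
      simp [H, abs_of_pos hr0]
    have h4 : d ((r : 𝕜) • (φ.symm : H →L[𝕜] E)) ≤ d u := h2
    rw [h3] at h4
    exact lt_of_lt_of_le (by positivity) h4
  refine ⟨u, fun x => (u.le_opNorm x).trans (mul_le_of_le_one_left (norm_nonneg _) hu), ?_⟩
  intro T r hr hT
  let T' : H →L[𝕜] H := LinearMap.toContinuousLinearMap T
  have h1 : (((r⁻¹ : ℝ) : 𝕜) • (u.comp T')) ∈ Metric.closedBall (0 : H →L[𝕜] E) 1 := by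
    rw [mem_closedBall_zero_iff]
    refine ContinuousLinearMap.opNorm_le_bound _ zero_le_one fun x => ?_
    have : ‖u (T x)‖ ≤ r * ‖x‖ := hT x
    simp only [smul_apply, norm_smul, RCLike.norm_ofReal,
      abs_of_pos (inv_pos.mpr hr)]
    rw [inv_mul_le_iff₀ hr, one_mul]
    exact this
  have h2 : d (((r⁻¹ : ℝ) : 𝕜) • (u.comp T')) ≤ d u := hmax h1
  have h3 : d (((r⁻¹ : ℝ) : 𝕜) • (u.comp T')) = (r⁻¹) ^ N * (d u * ‖LinearMap.det T‖) := by
    rw [hdet, hdet]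
    have : ((φ : E →ₗ[𝕜] H) ∘ₗ ((((r⁻¹ : ℝ) : 𝕜) • (u.comp T') : H →L[𝕜] E) : H →ₗ[𝕜] E)) =
          ((r⁻¹ : ℝ) : 𝕜) • (((φ : E →ₗ[𝕜] H) ∘ₗ (u : H →ₗ[𝕜] E)) ∘ₗ T) := by
      ext x; simp [T']
    rw [this, LinearMap.det_smul, LinearMap.det_comp, norm_mul, norm_mul, norm_pow,
      RCLike.norm_ofReal, abs_of_pos (inv_pos.mpr hr)]
    simp [H]
  rw [h3, inv_pow, inv_mul_le_iff₀ (by positivity), mul_comm (d u)] at h2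
  exact le_of_mul_le_mul_right h2 hpos

lemma dr_step (N : ℕ) (u : EuclideanSpace 𝕜 (Fin N) →L[𝕜] E) (hu : ∀ x, ‖u x‖ ≤ ‖x‖)
    (hmax : ∀ (T : EuclideanSpace 𝕜 (Fin N) →ₗ[𝕜] EuclideanSpace 𝕜 (Fin N)) (r : ℝ), 0 < r →
        (∀ x, ‖u (T x)‖ ≤ r * ‖x‖) → ‖LinearMap.det T‖ ≤ r ^ N) (m : ℕ) (hm : 2 * m ≤ N) :
    ∃ b : OrthonormalBasis (Fin N) 𝕜 (EuclideanSpace 𝕜 (Fin N)),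
      ∀ j : Fin N, (j : ℕ) < m → 1 / 4 ≤ ‖u (b j)‖ := by
  classical
  induction m with
  | zero => exact ⟨EuclideanSpace.basisFun (Fin N) 𝕜, fun j hj => absurd hj (Nat.not_lt_zero _)⟩
  | succ m ih =>
    obtain ⟨b, hb⟩ := ih (by omega)
    -- exists a vector
    have hex : ∃ w : EuclideanSpace 𝕜 (Fin N), (∀ j : Fin N, (j : ℕ) < m → b.repr w j = 0) ∧
        1 / 4 * ‖w‖ < ‖u w‖ := by
      by_contra! hcon
      let dd : Fin N → 𝕜 := fun j => if (j : ℕ) < m then 1 else 2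
      let T := Matrix.toLin b.toBasis b.toBasis (Matrix.diagonal dd)
      have hTb : ∀ j, T (b j) = dd j • b j := by
        intro j
        have := Matrix.toLin_self b.toBasis b.toBasis (Matrix.diagonal dd) j
        simp only [OrthonormalBasis.coe_toBasis] at this
        rw [show T (b j) = _ from this, Finset.sum_eq_single j]
        · simp
        · intro i _ hij; simp [Matrix.diagonal_apply_ne _ hij]
        · simp
      have hdet : ‖LinearMap.det T‖ = 2 ^ (N - m) := by
        rw [LinearMap.det_toLin, Matrix.det_diagonal, norm_prod]
        have : ∀ j : Fin N, ‖dd j‖ = if (j : ℕ) < m then 1 else 2 := by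
          intro j; simp only [dd]; split_ifs <;> simp
        simp only [this]
        rw [Fin.prod_univ_eq_prod_range (fun j => if j < m then (1:ℝ) else 2) N,
          ← Finset.prod_range_mul_prod_Ico _ (show m ≤ N by omega)]
        rw [Finset.prod_congr rfl (g := fun _ => (1:ℝ)), Finset.prod_congr (s₁ := Finset.Ico m N) rfl (g := fun _ => (2:ℝ))]
        · simp
        · intro x hx; simp at hx; simp; omega
        · intro x hx; simp at hx; simp; omega
      have hT : ∀ x, ‖u (T x)‖ ≤ (5 / 4) * ‖x‖ := by
        intro x
        let w : EuclideanSpace 𝕜 (Fin N) := ∑ j : Fin N, (if (j : ℕ) < m then (0:𝕜) else b.repr x j) • b j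
        have hw : ∀ j, b.repr w j = if (j : ℕ) < m then (0:𝕜) else b.repr x j := by
          intro j
          rw [b.repr_apply_apply]
          exact b.orthonormal.inner_right_fintype _ j
        have hTx : T x = x + w := by
          have e1 : T x = ∑ j, T (b.repr x j • b j) := by rw [← map_sum, b.sum_repr]
          have e2 : x + w = ∑ j, b.repr x j • b j + w := by rw [b.sum_repr]
          rw [e1, e2, ← Finset.sum_add_distrib]
          refine Finset.sum_congr rfl fun j _ => ?_
          rw [map_smul, hTb, smul_smul, ← add_smul]
          congr 1
          simp only [dd]
          split_ifs <;> ring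
        have hwn : ‖w‖ ≤ ‖x‖ := by
          rw [← b.repr.norm_map w, ← b.repr.norm_map x]
          rw [← sq_le_sq₀ (norm_nonneg _) (norm_nonneg _), EuclideanSpace.norm_sq_eq,
            EuclideanSpace.norm_sq_eq]
          refine Finset.sum_le_sum fun j _ => ?_
          rw [hw]
          split_ifs
          · simp
          · rfl
        have h1 := hcon w (fun j hj => by rw [hw, if_pos hj])
        rw [hTx, map_add]
        have := norm_add_le (u x) (u w)
        have := hu x
        linarith
      have h2 := hmax T (5/4) (by norm_num) hT
      rw [hdet] at h2
      have h3 : ((5:ℝ) / 4) ^ N < 2 ^ (N - m) := by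
        calc ((5:ℝ) / 4) ^ N ≤ (5 / 4) ^ (2 * (N - m)) := pow_le_pow_right₀ (by norm_num) (by omega)
          _ = (25 / 16) ^ (N - m) := by rw [pow_mul]; norm_num
          _ < 2 ^ (N - m) := pow_lt_pow_left₀ (by norm_num) (by norm_num) (by omega)
      linarith
    obtain ⟨w, hw0, hw⟩ := hex
    have hwne : ‖w‖ ≠ 0 := by
      intro h
      rw [norm_eq_zero] at h
      simp [h] at hw
    have hwp : 0 < ‖w‖ := lt_of_le_of_ne (norm_nonneg _) hwne.symm
    let w' : EuclideanSpace 𝕜 (Fin N) := ((‖w‖⁻¹ : ℝ) : 𝕜) • w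
    have hw'n : ‖w'‖ = 1 := by
      simp only [w', norm_smul, RCLike.norm_ofReal, abs_of_pos (inv_pos.mpr hwp)]
      field_simp
    have hw'u : 1 / 4 ≤ ‖u w'‖ := by
      simp only [w', map_smul, norm_smul, RCLike.norm_ofReal, abs_of_pos (inv_pos.mpr hwp)]
      rw [inv_mul_eq_div, le_div_iff₀ hwp]; linarith
    have hw'0 : ∀ j : Fin N, (j : ℕ) < m → inner 𝕜 (b j) w' = 0 := by
      intro j hj
      rw [inner_smul_right, ← b.repr_apply_apply, hw0 j hj, mul_zero]
    let im : Fin N := ⟨m, by omega⟩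
    let v : Fin N → EuclideanSpace 𝕜 (Fin N) := fun j => if j = im then w' else b j
    let s : Set (Fin N) := {j | (j : ℕ) < m + 1}
    have hv : Orthonormal 𝕜 (s.domRestrict v) := by
      constructor
      · rintro ⟨j, hj⟩
        rw [Set.domRestrict_apply]
        simp only [v]
        split_ifs
        · exact hw'n
        · exact b.norm_eq_one j
      · rintro ⟨i, hi⟩ ⟨j, hj⟩ hij
        have hij' : i ≠ j := fun h => hij (Subtype.ext h)
        have hlt : ∀ l : Fin N, l ∈ s → l ≠ im → (l : ℕ) < m := by
          intro l hl hne
          have h1 : (l : ℕ) < m + 1 := hl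
          have h2 : (l : ℕ) ≠ m := fun h => hne (Fin.ext h)
          omega
        rw [Set.domRestrict_apply, Set.domRestrict_apply]
        simp only [v]
        split_ifs with h1 h2 h2
        · exact absurd (h1.trans h2.symm) hij'
        · rw [← inner_conj_symm, hw'0 j (hlt j hj h2), map_zero]
        · exact hw'0 i (hlt i hi h1)
        · exact b.orthonormal.2 hij'
    obtain ⟨b', hb'⟩ := hv.exists_orthonormalBasis_extension_of_card_eq (by simp)
    refine ⟨b', fun j hj => ?_⟩
    rw [hb' j hj]
    simp only [v]
    split_ifs with h
    · exact hw'u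
    · apply hb
      have h2 : (j : ℕ) ≠ m := fun h' => h (Fin.ext h')
      omega

lemma dvoretzky_rogers (m : ℕ) (hm : 2 * m ≤ Module.finrank 𝕜 E) :
    ∃ x : Fin m → E, (∀ i, 1 / 4 ≤ ‖x i‖) ∧
      ∀ s : E →L[𝕜] 𝕜, ‖s‖ ≤ 1 → ∑ i, ‖s (x i)‖ ^ 2 ≤ 1 := by
  obtain ⟨u, hu, hmax⟩ := exists_max_det (𝕜 := 𝕜) (E := E) _ rfl
  obtain ⟨b, hb⟩ := dr_step _ u hu hmax m hm
  let ι : Fin m → Fin (Module.finrank 𝕜 E) := fun i => ⟨i, by omega⟩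
  have hι : Function.Injective ι := fun i j h => Fin.ext (by simpa [ι] using h)
  refine ⟨fun i => u (b (ι i)), fun i => hb _ i.2, fun s hs => ?_⟩
  have ho : Orthonormal 𝕜 (fun i => b (ι i)) := b.orthonormal.comp ι hι
  let c : Fin m → 𝕜 := fun i => s (u (b (ι i)))
  let x := ∑ i, (starRingEnd 𝕜 (c i)) • b (ι i)
  have hx : ‖x‖ ^ 2 = ∑ i, ‖c i‖ ^ 2 := by
    have := ho.inner_sum (fun i => starRingEnd 𝕜 (c i)) (fun i => starRingEnd 𝕜 (c i)) Finset.univ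
    have h2 : (‖x‖ : 𝕜) ^ 2 = ∑ i, (‖c i‖ : 𝕜) ^ 2 := by
      rw [← inner_self_eq_norm_sq_to_K (𝕜 := 𝕜)]
      rw [show inner 𝕜 x x = _ from this]
      refine Finset.sum_congr rfl fun i _ => ?_
      rw [RCLike.conj_conj, RCLike.mul_conj]
    exact_mod_cast h2
  have h1 : s (u x) = ((∑ i, ‖c i‖ ^ 2 : ℝ) : 𝕜) := by
    simp only [x, map_sum, map_smul, smul_eq_mul]
    push_cast
    refine Finset.sum_congr rfl fun i _ => ?_
    rw [RCLike.conj_mul]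
  have h2 : ‖s (u x)‖ ≤ ‖x‖ :=
    (s.le_opNorm _).trans ((mul_le_of_le_one_left (norm_nonneg _) hs).trans (hu x))
  rw [h1, RCLike.norm_ofReal, ← hx, abs_of_nonneg (by positivity)] at h2
  change ∑ i, ‖c i‖ ^ 2 ≤ 1
  rw [← hx]
  nlinarith [norm_nonneg x]
end DR


section net
variable {𝕜 : Type*} [RCLike 𝕜] {X : Type*} [NormedAddCommGroup X] [NormedSpace 𝕜 X]

lemma net_to_all {n : ℕ} (U : EuclideanSpace 𝕜 (Fin n) →ₗ[𝕜] X) (t : Set (EuclideanSpace 𝕜 (Fin n)))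
    (α β δ : ℝ) (hα : 0 ≤ α) (hβ : 0 ≤ β) (hδ : 0 ≤ δ) (hδ1 : δ ≤ 1 / 2) (hδ2 : δ * (2 * β) ≤ α / 2)
    (hnet : ∀ a, ‖a‖ = 1 → ∃ c ∈ t, ‖a - c‖ ≤ δ)
    (hU : ∀ c ∈ t, α ≤ ‖U c‖ ∧ ‖U c‖ ≤ β) :
    ∀ a, α / 2 * ‖a‖ ≤ ‖U a‖ ∧ ‖U a‖ ≤ 2 * β * ‖a‖ := by
  let V : EuclideanSpace 𝕜 (Fin n) →L[𝕜] X := LinearMap.toContinuousLinearMap U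
  have hV : ∀ a, V a = U a := fun a => rfl
  have h1 : ‖V‖ ≤ β + δ * ‖V‖ := by
    refine ContinuousLinearMap.opNorm_le_of_unit_norm (by positivity) fun a ha => ?_
    obtain ⟨c, hc, hac⟩ := hnet a ha
    have e : V a = V c + V (a - c) := by rw [← map_add]; simp
    rw [e]
    refine (norm_add_le _ _).trans (add_le_add (hU c hc).2 ((V.le_opNorm _).trans ?_))
    rw [mul_comm]; gcongr
  have h2 : ‖V‖ ≤ 2 * β := by nlinarith [norm_nonneg V]
  have h3 : ∀ a, ‖a‖ = 1 → α / 2 ≤ ‖V a‖ := by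
    intro a ha
    obtain ⟨c, hc, hac⟩ := hnet a ha
    have e : V c = V a - V (a - c) := by rw [← map_sub]; simp
    have h4 := (hU c hc).1
    rw [← hV, e] at h4
    have h5 := norm_sub_le (V a) (V (a - c))
    have h6 : ‖V (a - c)‖ ≤ δ * (2 * β) := (V.le_opNorm _).trans (by rw [mul_comm]; gcongr)
    linarith
  intro a
  refine ⟨?_, (V.le_opNorm a).trans (by gcongr)⟩
  rcases eq_or_ne a 0 with rfl | ha
  · simp
  · have hp : 0 < ‖a‖ := norm_pos_iff.mpr ha
    have := h3 (((‖a‖⁻¹ : ℝ) : 𝕜) • a) (by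
      rw [norm_smul, RCLike.norm_ofReal, abs_of_pos (inv_pos.mpr hp)]; field_simp)
    rw [map_smul, norm_smul, RCLike.norm_ofReal, abs_of_pos (inv_pos.mpr hp), inv_mul_eq_div,
      le_div_iff₀ hp] at this
    exact this
end net

lemma pow_compare {m : ℕ} (hm : 0 < m) (y : Fin m → ℝ) (hy : ∀ i, 0 ≤ y i) (r : ℝ) (hr : 0 < r) :
    (m : ℝ) ^ (min 1 r - 1) * ∑ i, y i ^ r ≤ (∑ i, y i) ^ r := by
  have hm' : (0:ℝ) < m := by exact_mod_cast hm
  have hY : 0 ≤ ∑ i, y i := Finset.sum_nonneg fun i _ => hy i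
  rcases le_total 1 r with h | h
  · rw [min_eq_left h]
    simp only [sub_self, Real.rpow_zero, one_mul]
    rcases hY.eq_or_lt with h0 | h0
    · have : ∀ i, y i = 0 := fun i =>
        (Finset.sum_eq_zero_iff_of_nonneg (fun i _ => hy i)).mp h0.symm i (Finset.mem_univ _)
      simp [this, Real.zero_rpow hr.ne']
    · have h1 : ∀ i, y i ^ r ≤ y i * (∑ i, y i) ^ (r - 1) := by
        intro i
        have hle : y i ≤ ∑ i, y i := Finset.single_le_sum (fun i _ => hy i) (Finset.mem_univ i)
        rcases (hy i).eq_or_lt with h2 | h2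
        · rw [← h2]; simp [Real.zero_rpow hr.ne']
        · calc y i ^ r = y i * y i ^ (r - 1) := by
                rw [← Real.rpow_one_add' h2.le (by linarith)]; congr 1; ring
            _ ≤ _ := by gcongr
      refine (Finset.sum_le_sum fun i _ => h1 i).trans ?_
      rw [← Finset.sum_mul, ← Real.rpow_one_add' hY (by linarith)]
      apply le_of_eq; congr 1; ring
  · rw [min_eq_right h]
    have h1 := Real.rpow_arith_mean_le_arith_mean_rpow Finset.univ (fun _ : Fin m => (1 / m : ℝ))
      (fun i => y i ^ r) (fun _ _ => by positivity) (by simp; field_simp)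
      (fun i _ => Real.rpow_nonneg (hy i) r) (p := 1 / r) (by rw [le_div_iff₀ hr]; linarith)
    have h2 : ∀ i, (y i ^ r) ^ (1 / r) = y i := fun i => by
      rw [← Real.rpow_mul (hy i)]; field_simp; simp
    simp only [h2, ← Finset.mul_sum] at h1
    have hZ : 0 ≤ ∑ i, y i ^ r := Finset.sum_nonneg fun i _ => Real.rpow_nonneg (hy i) r
    have h3 := Real.rpow_le_rpow (by positivity) h1 hr.le
    rw [← Real.rpow_mul (by positivity), one_div_mul_cancel hr.ne', Real.rpow_one,
      Real.mul_rpow (by positivity) hY] at h3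
    have h4 : (m:ℝ) ^ r * (1 / (m:ℝ)) ^ r = 1 := by
      rw [← Real.mul_rpow (by positivity) (by positivity)]; field_simp; simp
    rw [Real.rpow_sub_one hm'.ne']
    calc (m:ℝ) ^ r / m * ∑ i, y i ^ r = (m:ℝ) ^ r * (1 / m * ∑ i, y i ^ r) := by ring
      _ ≤ (m:ℝ) ^ r * ((1 / (m:ℝ)) ^ r * (∑ i, y i) ^ r) := by gcongr
      _ = _ := by rw [← mul_assoc, h4, one_mul]

lemma minkowski_sum {ι : Type*} (s : Finset ι) (M : ℕ) (p : ℝ) (hp : 1 ≤ p) (f : ι → ℕ → ℝ) :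
    (∑ l ∈ Finset.range M, |∑ i ∈ s, f i l| ^ p) ^ (1 / p) ≤
      ∑ i ∈ s, (∑ l ∈ Finset.range M, |f i l| ^ p) ^ (1 / p) := by
  have hp0 : 0 < p := by linarith
  classical
  induction s using Finset.induction_on with
  | empty => simp [Real.zero_rpow hp0.ne']; rw [Real.zero_rpow (by positivity)]
  | insert a s ha ih =>
    simp only [Finset.sum_insert ha]
    exact (Real.Lp_add_le _ _ _ hp).trans (by gcongr)

section lpz
variable {𝕜 : Type*} [RCLike 𝕜] (p : ℝ) [Fact (1 ≤ ENNReal.ofReal p)]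

lemma lp_norm_fin (hp : 1 < p) (M : ℕ) (v : lp (fun _ : ℕ => 𝕜) (ENNReal.ofReal p))
    (hv : ∀ l, M ≤ l → v l = 0) : ‖v‖ ^ p = ∑ l ∈ Finset.range M, ‖v l‖ ^ p := by
  have ht : (ENNReal.ofReal p).toReal = p := ENNReal.toReal_ofReal (by linarith)
  have := lp.norm_rpow_eq_tsum (by rw [ht]; linarith) v
  rw [ht] at this
  rw [this, tsum_eq_sum]
  intro l hl
  rw [hv l (by simpa using hl), norm_zero, Real.zero_rpow (by linarith)]

lemma lp_rad_apply {k : ℕ} (z : Fin k → lp (fun _ : ℕ => 𝕜) (ENNReal.ofReal p)) (ω) (l : ℕ) :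
    rad16 (𝕜 := 𝕜) z ω l = rad16 (𝕜 := 𝕜) (fun i => z i l) ω := by
  unfold rad16
  rw [lp.coeFn_sum, Finset.sum_apply]
  rfl

lemma rad_lp (hp : 1 < p) : ∃ b β : ℝ, 0 < b ∧ 0 < β ∧
    ∀ (k : ℕ) (z : Fin k → lp (fun _ : ℕ => 𝕜) (ENNReal.ofReal p)) (M : ℕ) (s : ℕ → ℝ) (S : ℝ),
      (∀ i l, M ≤ l → z i l = 0) → (∀ l, 0 ≤ s l) → (∀ l, ∑ i, ‖z i l‖ ^ 2 = s l ^ 2) →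
      0 ≤ S → S ^ p = ∑ l ∈ Finset.range M, s l ^ p →
      b * S ≤ cubeAvg k (fun ω => ‖rad16 (𝕜 := 𝕜) z ω‖) ∧
      cubeAvg k (fun ω => ‖rad16 (𝕜 := 𝕜) z ω‖) ≤ β * S := by
  have hp0 : 0 < p := by linarith
  obtain ⟨b, hb, hb2⟩ := khin_lower (𝕜 := 𝕜)
  obtain ⟨B, hB, hB2⟩ := khin_upper (𝕜 := 𝕜) p hp0
  refine ⟨b, B ^ (1 / p), hb, by positivity, ?_⟩
  intro k z M s S hz hs hzs hS hSp
  have hS' : S = (∑ l ∈ Finset.range M, s l ^ p) ^ (1 / p) := by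
    rw [← hSp, ← Real.rpow_mul hS]; field_simp; simp
  have hY0 : ∀ ω l, M ≤ l → rad16 (𝕜 := 𝕜) z ω l = 0 := by
    intro ω l hl
    rw [lp_rad_apply]
    unfold rad16
    exact Finset.sum_eq_zero fun i _ => by
      have h0 := hz i l hl
      simp only [h0, smul_zero]
  have hYn : ∀ ω, ‖rad16 (𝕜 := 𝕜) z ω‖ ^ p = ∑ l ∈ Finset.range M, ‖rad16 (𝕜 := 𝕜) z ω l‖ ^ p :=
    fun ω => lp_norm_fin p hp M _ (hY0 ω)
  have hYn' : ∀ ω, ‖rad16 (𝕜 := 𝕜) z ω‖ =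
      (∑ l ∈ Finset.range M, ‖rad16 (𝕜 := 𝕜) z ω l‖ ^ p) ^ (1 / p) := by
    intro ω
    rw [← hYn, ← Real.rpow_mul (norm_nonneg _)]; field_simp; simp
  constructor
  · have h1 := minkowski_sum (Finset.univ : Finset (Fin k → Bool)) M p hp.le
      (fun ω l => ‖rad16 (𝕜 := 𝕜) z ω l‖ / 2 ^ k)
    have h2 : ∑ ω : Fin k → Bool, (∑ l ∈ Finset.range M, |‖rad16 (𝕜 := 𝕜) z ω l‖ / 2 ^ k| ^ p) ^ (1 / p)
        = cubeAvg k (fun ω => ‖rad16 (𝕜 := 𝕜) z ω‖) := by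
      unfold cubeAvg
      rw [Finset.sum_div]
      refine Finset.sum_congr rfl fun ω _ => ?_
      have : ∀ l, |‖rad16 (𝕜 := 𝕜) z ω l‖ / 2 ^ k| ^ p = ‖rad16 (𝕜 := 𝕜) z ω l‖ ^ p / (2 ^ k) ^ p := by
        intro l
        rw [abs_of_nonneg (by positivity), Real.div_rpow (by positivity) (by positivity)]
      simp only [this]
      rw [← Finset.sum_div, Real.div_rpow (by positivity) (by positivity), ← hYn',
        ← Real.rpow_mul (by positivity), mul_one_div_cancel hp0.ne', Real.rpow_one]
    rw [h2] at h1
    refine le_trans ?_ h1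
    have h3 : b * S = (∑ l ∈ Finset.range M, (b * s l) ^ p) ^ (1 / p) := by
      have : ∀ l, (b * s l) ^ p = b ^ p * s l ^ p := fun l => Real.mul_rpow hb.le (hs l)
      simp only [this, ← Finset.mul_sum]
      rw [Real.mul_rpow (by positivity) (Finset.sum_nonneg fun l _ => Real.rpow_nonneg (hs l) p),
        ← hS', ← Real.rpow_mul hb.le, mul_one_div_cancel hp0.ne', Real.rpow_one]
    rw [h3]
    apply Real.rpow_le_rpow (Finset.sum_nonneg fun l _ => Real.rpow_nonneg (mul_nonneg hb.le (hs l)) p) _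
      (by positivity)
    refine Finset.sum_le_sum fun l _ => ?_
    apply Real.rpow_le_rpow (mul_nonneg hb.le (hs l)) _ hp0.le
    refine le_trans ?_ (le_abs_self _)
    have := hb2 k (fun i => z i l) (s l) (hs l) (hzs l)
    unfold cubeAvg at this
    rw [Finset.sum_div] at this
    simpa only [lp_rad_apply] using this
  · have h1 : (cubeAvg k (fun ω => ‖rad16 (𝕜 := 𝕜) z ω‖)) ^ p ≤
        cubeAvg k (fun ω => ‖rad16 (𝕜 := 𝕜) z ω‖ ^ p) := by
      have := Real.rpow_arith_mean_le_arith_mean_rpow (Finset.univ : Finset (Fin k → Bool))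
        (fun _ => 1 / 2 ^ k) (fun ω => ‖rad16 (𝕜 := 𝕜) z ω‖) (fun _ _ => by positivity)
        (by simp) (fun _ _ => norm_nonneg _) hp.le
      simp only [← Finset.mul_sum] at this
      unfold cubeAvg
      rw [div_eq_inv_mul, div_eq_inv_mul, ← one_div]
      exact this
    simp only [hYn] at h1
    rw [cubeAvg_sum] at h1
    have h2 : ∑ l ∈ Finset.range M, cubeAvg k (fun ω => ‖rad16 (𝕜 := 𝕜) z ω l‖ ^ p) ≤ B * S ^ p := by
      rw [hSp, Finset.mul_sum]
      refine Finset.sum_le_sum fun l _ => ?_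
      simp only [lp_rad_apply]
      exact hB2 k _ (s l) (hs l) (hzs l)
    have h3 := h1.trans h2
    have h0 : 0 ≤ cubeAvg k (fun ω => ‖rad16 (𝕜 := 𝕜) z ω‖) := by
      have := cubeAvg_mono k (f := fun _ => 0) (g := fun ω => ‖rad16 (𝕜 := 𝕜) z ω‖) (fun ω => norm_nonneg _)
      rwa [cubeAvg_const] at this
    have h4 : (B ^ (1 / p) * S) ^ p = B * S ^ p := by
      rw [Real.mul_rpow (by positivity) hS, ← Real.rpow_mul hB.le, one_div_mul_cancel hp0.ne', Real.rpow_one]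
    rw [← h4] at h3
    exact (Real.rpow_le_rpow_iff h0 (by positivity) hp0).mp h3
end lpz


section dvor
variable {𝕜 : Type*} [RCLike 𝕜] {X : Type*} [NormedAddCommGroup X] [NormedSpace 𝕜 X]

/-- the double Rademacher family -/
def zfam {m n : ℕ} (x : Fin m → X) (a : EuclideanSpace 𝕜 (Fin n)) (q : Fin (m * n)) : X :=
  a (finProdFinEquiv.symm q).2 • x (finProdFinEquiv.symm q).1

lemma zfam_sum {m n : ℕ} (x : Fin m → X) (a : EuclideanSpace 𝕜 (Fin n)) (ha : ‖a‖ = 1)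
    (g : X → ℝ) (hg : ∀ (c : 𝕜) x, g (c • x) = ‖c‖ ^ 2 * g x) :
    ∑ q, g (zfam x a q) = ∑ i, g (x i) := by
  unfold zfam
  rw [Equiv.sum_comp finProdFinEquiv.symm (fun q : Fin m × Fin n => g (a q.2 • x q.1)),
    Fintype.sum_prod_type]
  refine Finset.sum_congr rfl fun i _ => ?_
  simp only [hg]
  rw [← Finset.sum_mul, ← EuclideanSpace.norm_sq_eq, ha]; simp

/-- the random operator -/
def Urad {m n : ℕ} (x : Fin m → X) (ω : Fin (m * n) → Bool) : EuclideanSpace 𝕜 (Fin n) →ₗ[𝕜] X where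
  toFun a := rad16 (𝕜 := 𝕜) (zfam x a) ω
  map_add' a b := by
    unfold rad16 zfam
    rw [← Finset.sum_add_distrib]
    refine Finset.sum_congr rfl fun q _ => ?_
    rw [← smul_add, ← add_smul]; rfl
  map_smul' c a := by
    unfold rad16 zfam
    rw [Finset.smul_sum]
    refine Finset.sum_congr rfl fun q _ => ?_
    simp only [RingHom.id_apply, PiLp.smul_apply, smul_smul, smul_eq_mul]
    congr 1; ring

lemma Urad_mem {m n : ℕ} (x : Fin m → X) (ω : Fin (m * n) → Bool) (a : EuclideanSpace 𝕜 (Fin n))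
    (E : Submodule 𝕜 X) (hx : ∀ i, x i ∈ E) : Urad x ω a ∈ E := by
  show rad16 (𝕜 := 𝕜) (zfam x a) ω ∈ E
  unfold rad16 zfam
  exact E.sum_mem fun q _ => E.smul_mem _ (E.smul_mem _ (hx _))

lemma sphere_net (n : ℕ) (δ : ℝ) (hδ : 0 < δ) : ∃ t : Finset (EuclideanSpace 𝕜 (Fin n)),
    (∀ c ∈ t, ‖c‖ = 1) ∧ ∀ a, ‖a‖ = 1 → ∃ c ∈ t, ‖a - c‖ ≤ δ := by
  have : ProperSpace (EuclideanSpace 𝕜 (Fin n)) := FiniteDimensional.proper 𝕜 _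
  obtain ⟨t, ht, hf, hc⟩ := (isCompact_sphere (0 : EuclideanSpace 𝕜 (Fin n)) 1).finite_cover_balls hδ
  refine ⟨hf.toFinset, fun c hc => by simpa using ht (hf.mem_toFinset.mp hc), fun a ha => ?_⟩
  have := hc (show a ∈ Metric.sphere 0 1 by simpa using ha)
  simp only [Set.mem_iUnion, Metric.mem_ball, exists_prop] at this
  obtain ⟨c, hc, hd⟩ := this
  exact ⟨c, hf.mem_toFinset.mpr hc, by rw [← dist_eq_norm]; exact hd.le⟩
end dvor

section lpd
variable {𝕜 : Type*} [RCLike 𝕜] (p : ℝ) [Fact (1 ≤ ENNReal.ofReal p)]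

lemma dvor_core (hp : 1 < p) : ∃ c C : ℝ, 0 < c ∧ 0 < C ∧ ∀ n : ℕ, ∃ K : ℝ, 0 < K ∧
    ∀ (m : ℕ) (x : Fin m → lp (fun _ : ℕ => 𝕜) (ENNReal.ofReal p)) (M : ℕ) (s : ℕ → ℝ) (S : ℝ),
      (∀ i l, M ≤ l → x i l = 0) → (∀ l, 0 ≤ s l) → (∀ l, ∑ i, ‖x i l‖ ^ 2 = s l ^ 2) →
      K ≤ S → S ^ p = ∑ l ∈ Finset.range M, s l ^ p →
      (∀ f : lp (fun _ : ℕ => 𝕜) (ENNReal.ofReal p) →L[𝕜] 𝕜, ‖f‖ ≤ 1 → ∑ i, ‖f (x i)‖ ^ 2 ≤ 1) →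
      ∃ U : EuclideanSpace 𝕜 (Fin n) →ₗ[𝕜] lp (fun _ : ℕ => 𝕜) (ENNReal.ofReal p),
        (∀ E : Submodule 𝕜 (lp (fun _ : ℕ => 𝕜) (ENNReal.ofReal p)), (∀ i, x i ∈ E) → ∀ a, U a ∈ E) ∧
        ∀ a, c * ‖a‖ ≤ ‖U a‖ ∧ ‖U a‖ ≤ C * ‖a‖ := by
  obtain ⟨b, β, hb, hβ, H⟩ := rad_lp (𝕜 := 𝕜) p hp
  refine ⟨b / 4, 2 * (β + b / 2), by positivity, by positivity, fun n => ?_⟩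
  set δ : ℝ := min (1 / 2) (b / 4 / (2 * (β + b / 2))) with hδdef
  have hδ : 0 < δ := by positivity
  have hδ2 : δ * (2 * (β + b / 2)) ≤ b / 4 := by
    rw [← le_div_iff₀ (by positivity)]; exact min_le_right _ _
  obtain ⟨t, ht1, ht2⟩ := sphere_net (𝕜 := 𝕜) n δ hδ
  refine ⟨(√(2 * t.card) + 1) * (2 / b), by positivity, ?_⟩
  intro m x M s S hx hs hxs hKS hSp hw
  have hS : 0 < S := lt_of_lt_of_le (by positivity) hKS
  have hKS' : √(2 * t.card) ≤ b * S / 2 := by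
    have : √(2 * t.card) * (2 / b) ≤ S := le_trans (by gcongr; linarith) hKS
    rw [mul_div_assoc', div_le_iff₀ hb] at this
    linarith
  set μ : EuclideanSpace 𝕜 (Fin n) → ℝ := fun a =>
    cubeAvg (m * n) (fun ω => ‖rad16 (𝕜 := 𝕜) (zfam x a) ω‖) with hμ
  have hμb : ∀ a, ‖a‖ = 1 → b * S ≤ μ a ∧ μ a ≤ β * S := by
    intro a ha
    refine H (m * n) (zfam x a) M s S ?_ hs ?_ hS.le hSp
    · intro q l hl
      show a _ • (x _ l) = 0
      have h0 := hx (finProdFinEquiv.symm q).1 l hl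
      rw [h0, smul_zero]
    · intro l
      rw [← hxs l]
      refine zfam_sum x a ha (fun y => ‖y l‖ ^ 2) ?_
      intro c y
      show ‖c • (y l)‖ ^ 2 = _
      rw [norm_smul, mul_pow]
  have hvar : ∀ a, ‖a‖ = 1 →
      cubeAvg (m * n) (fun ω => (‖rad16 (𝕜 := 𝕜) (zfam x a) ω‖ - μ a) ^ 2) ≤ 2 := by
    intro a ha
    refine norm_var (zfam x a) fun f hf => ?_
    have := zfam_sum x a ha (fun y => ‖f y‖ ^ 2) (by
      intro c y; rw [map_smul, norm_smul, mul_pow])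
    rw [this]; exact hw f hf
  obtain ⟨ω, hω⟩ := cubeAvg_exists_le (m * n)
    (fun ω => ∑ a ∈ t, (‖rad16 (𝕜 := 𝕜) (zfam x a) ω‖ - μ a) ^ 2)
  rw [cubeAvg_sum] at hω
  have h1 : ∑ a ∈ t, (‖rad16 (𝕜 := 𝕜) (zfam x a) ω‖ - μ a) ^ 2 ≤ 2 * t.card := by
    refine hω.trans ((Finset.sum_le_sum fun a ha => hvar a (ht1 a ha)).trans ?_)
    simp [mul_comm]
  have h2 : ∀ a ∈ t, |‖rad16 (𝕜 := 𝕜) (zfam x a) ω‖ - μ a| ≤ b * S / 2 := by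
    intro a ha
    refine le_trans (Real.abs_le_sqrt ?_) hKS'
    exact (Finset.single_le_sum (f := fun a => (‖rad16 (𝕜 := 𝕜) (zfam x a) ω‖ - μ a) ^ 2)
      (fun a _ => sq_nonneg _) ha).trans h1
  have h3 := net_to_all (Urad x ω) (t : Set (EuclideanSpace 𝕜 (Fin n))) (b * S / 2) ((β + b / 2) * S) δ
    (by positivity) (by positivity) hδ.le (min_le_left _ _) (by nlinarith)
    (fun a ha => ht2 a ha) (fun a ha => by
      have h4 := abs_le.mp (h2 a ha)
      have h5 := hμb a (ht1 a ha)
      change b * S / 2 ≤ ‖rad16 (𝕜 := 𝕜) (zfam x a) ω‖ ∧ ‖rad16 (𝕜 := 𝕜) (zfam x a) ω‖ ≤ _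
      constructor <;> linarith)
  refine ⟨((S⁻¹ : ℝ) : 𝕜) • Urad x ω, fun E hE a => E.smul_mem _ (Urad_mem x ω a E hE), fun a => ?_⟩
  obtain ⟨h4, h5⟩ := h3 a
  rw [LinearMap.smul_apply, norm_smul, RCLike.norm_ofReal, abs_of_pos (inv_pos.mpr hS), inv_mul_eq_div,
    le_div_iff₀ hS, div_le_iff₀ hS]
  constructor <;> nlinarith

lemma dvor_lp (hp : 1 < p) : ∃ c C : ℝ, 0 < c ∧ 0 < C ∧ ∀ n : ℕ, ∃ N : ℕ,
    ∀ E : Submodule 𝕜 (lp (fun _ : ℕ => 𝕜) (ENNReal.ofReal p)), FiniteDimensional 𝕜 E →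
      N ≤ Module.finrank 𝕜 E → (∃ M, ∀ x ∈ E, ∀ l, M ≤ l → x l = 0) →
      ∃ U : EuclideanSpace 𝕜 (Fin n) →ₗ[𝕜] lp (fun _ : ℕ => 𝕜) (ENNReal.ofReal p),
        ∀ a, U a ∈ E ∧ c * ‖a‖ ≤ ‖U a‖ ∧ ‖U a‖ ≤ C * ‖a‖ := by
  have hp0 : 0 < p := by linarith
  obtain ⟨c, C, hc, hC, H⟩ := dvor_core (𝕜 := 𝕜) p hp
  refine ⟨c, C, hc, hC, fun n => ?_⟩
  obtain ⟨K, hK, H⟩ := H n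
  have hmin : 0 < min 1 (p / 2) := by positivity
  obtain ⟨m, hm, hm0⟩ : ∃ m : ℕ, K ^ p * 4 ^ p ≤ (m : ℝ) ^ (min 1 (p / 2)) ∧ 0 < m := by
    have h1 := ((tendsto_rpow_atTop hmin).comp tendsto_natCast_atTop_atTop).eventually_ge_atTop (K ^ p * 4 ^ p)
    obtain ⟨m, h2, h3⟩ := (h1.and (Filter.eventually_gt_atTop 0)).exists
    exact ⟨m, h2, h3⟩
  refine ⟨2 * m, ?_⟩
  rintro E hE hdim ⟨M, hM⟩
  obtain ⟨x, hx1, hx2⟩ := dvoretzky_rogers (𝕜 := 𝕜) (E := E) m hdim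
  set s : ℕ → ℝ := fun l => √(∑ i, ‖(x i : lp (fun _ : ℕ => 𝕜) (ENNReal.ofReal p)) l‖ ^ 2) with hs
  have hs0 : ∀ l, 0 ≤ s l := fun l => Real.sqrt_nonneg _
  have hsum0 : 0 ≤ ∑ l ∈ Finset.range M, s l ^ p :=
    Finset.sum_nonneg fun l _ => Real.rpow_nonneg (hs0 l) p
  have hSp : ((∑ l ∈ Finset.range M, s l ^ p) ^ (1 / p)) ^ p = ∑ l ∈ Finset.range M, s l ^ p := by
    rw [← Real.rpow_mul hsum0, one_div_mul_cancel hp0.ne', Real.rpow_one]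
  have key : (m : ℝ) ^ (min 1 (p / 2)) / 4 ^ p ≤ ∑ l ∈ Finset.range M, s l ^ p := by
    have h1 : ∀ l, (m : ℝ) ^ (min 1 (p / 2) - 1) * ∑ i, ‖(x i : lp (fun _ : ℕ => 𝕜) (ENNReal.ofReal p)) l‖ ^ p
        ≤ s l ^ p := by
      intro l
      have := pow_compare hm0 (fun i => ‖(x i : lp (fun _ : ℕ => 𝕜) (ENNReal.ofReal p)) l‖ ^ 2)
        (fun i => by positivity) (p / 2) (by positivity)
      have e : ∀ y : ℝ, 0 ≤ y → (y ^ 2) ^ (p / 2) = y ^ p := by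
        intro y hy
        rw [← Real.rpow_natCast_mul hy]; congr 1; push_cast; ring
      simp only [e _ (norm_nonneg _)] at this
      have e2 : (∑ i, ‖(x i : lp (fun _ : ℕ => 𝕜) (ENNReal.ofReal p)) l‖ ^ 2) = s l ^ 2 := by
        rw [hs]; dsimp only; rw [Real.sq_sqrt (by positivity)]
      rwa [e2, e _ (hs0 l)] at this
    refine le_trans ?_ (Finset.sum_le_sum fun l _ => h1 l)
    rw [← Finset.mul_sum, Finset.sum_comm]
    have h2 : ∀ i, (1 / 4 : ℝ) ^ p ≤ ∑ l ∈ Finset.range M, ‖(x i : lp (fun _ : ℕ => 𝕜) (ENNReal.ofReal p)) l‖ ^ p := by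
      intro i
      rw [← lp_norm_fin p hp M _ (hM _ (x i).2)]
      exact Real.rpow_le_rpow (by norm_num) (hx1 i) hp0.le
    have hmR : (0:ℝ) < m := by exact_mod_cast hm0
    calc (m : ℝ) ^ (min 1 (p / 2)) / 4 ^ p
        = (m : ℝ) ^ (min 1 (p / 2) - 1) * ∑ i : Fin m, (1 / 4 : ℝ) ^ p := by
          rw [Real.rpow_sub_one hmR.ne', Real.div_rpow (by norm_num) (by norm_num)]
          simp
          field_simp
      _ ≤ _ := by
          gcongr with i
          exact h2 i
  obtain ⟨U, hU1, hU2⟩ := H m (fun i => (x i : lp (fun _ : ℕ => 𝕜) (ENNReal.ofReal p))) M s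
    ((∑ l ∈ Finset.range M, s l ^ p) ^ (1 / p)) (fun i => hM _ (x i).2) hs0
    (fun l => by rw [hs]; dsimp only; rw [Real.sq_sqrt (by positivity)])
    (by
      rw [← Real.rpow_le_rpow_iff hK.le (Real.rpow_nonneg hsum0 _) hp0, hSp]
      refine le_trans ?_ key
      rw [le_div_iff₀ (by positivity)]; exact hm)
    hSp (fun f hf => by
      refine hx2 (f.comp E.subtypeL) ?_
      refine (ContinuousLinearMap.opNorm_comp_le _ _).trans ?_
      have := Submodule.norm_subtypeL_le E
      nlinarith [norm_nonneg f, norm_nonneg E.subtypeL])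
  exact ⟨U, fun a => ⟨hU1 E (fun i => (x i).2) a, hU2 a⟩⟩
end lpd


section gen
variable {𝕜 : Type*} [RCLike 𝕜] {X Y : Type*} [NormedAddCommGroup X] [NormedSpace 𝕜 X]
  [NormedAddCommGroup Y] [NormedSpace 𝕜 Y]

open Filter Topology in
lemma fd_small (E : Submodule 𝕜 X) [FiniteDimensional 𝕜 E] (T : ℕ → X →ₗ[𝕜] Y)
    (hT : ∀ x, Tendsto (fun M => T M x) atTop (𝓝 0)) (δ : ℝ) (hδ : 0 < δ) :
    ∃ M, ∀ x ∈ E, ‖T M x‖ ≤ δ * ‖x‖ := by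
  let b := Module.finBasis 𝕜 E
  let e : E →L[𝕜] (Fin (Module.finrank 𝕜 E) → 𝕜) :=
    LinearMap.toContinuousLinearMap (b.equivFun : E →ₗ[𝕜] (Fin (Module.finrank 𝕜 E) → 𝕜))
  have h1 : Tendsto (fun M => ‖e‖ * ∑ i, ‖T M (b i)‖) atTop (𝓝 0) := by
    have : Tendsto (fun M => ∑ i, ‖T M (b i)‖) atTop (𝓝 (∑ i : Fin (Module.finrank 𝕜 E), 0)) :=
      tendsto_finsetSum _ fun i _ => by simpa using (hT (b i)).norm
    simpa using this.const_mul ‖e‖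
  obtain ⟨M, hM⟩ := (h1.eventually_le_const hδ).exists
  refine ⟨M, fun x hx => ?_⟩
  have hsum : (⟨x, hx⟩ : E) = ∑ i, e ⟨x, hx⟩ i • b i := (b.sum_equivFun ⟨x, hx⟩).symm
  have hsum' : x = ∑ i, e ⟨x, hx⟩ i • (b i : X) := by
    have := congrArg (Subtype.val) hsum
    simpa using this
  have h2 : T M x = ∑ i, e ⟨x, hx⟩ i • T M (b i) := by
    conv_lhs => rw [hsum']
    rw [map_sum]; simp only [map_smul]
  rw [h2]
  refine (norm_sum_le _ _).trans ?_
  calc ∑ i, ‖e ⟨x, hx⟩ i • T M (b i)‖ ≤ ∑ i, (‖e‖ * ‖x‖) * ‖T M (b i)‖ := by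
        refine Finset.sum_le_sum fun i _ => ?_
        rw [norm_smul]
        gcongr
        exact (norm_le_pi_norm _ i).trans (e.le_opNorm _)
    _ = (‖e‖ * ∑ i, ‖T M (b i)‖) * ‖x‖ := by rw [← Finset.mul_sum]; ring
    _ ≤ δ * ‖x‖ := by gcongr

/-- finite codimension, measured on finite-dimensional subspaces -/
def SmallCodim (V : Submodule 𝕜 X) : Prop :=
  ∃ d : ℕ, ∀ E : Submodule 𝕜 X, FiniteDimensional 𝕜 E →
    Module.finrank 𝕜 E ≤ Module.finrank 𝕜 (E ⊓ V : Submodule 𝕜 X) + d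

lemma SmallCodim.inf {V V' : Submodule 𝕜 X} (h : SmallCodim V) (h' : SmallCodim V') :
    SmallCodim (V ⊓ V') := by
  obtain ⟨d, hd⟩ := h
  obtain ⟨d', hd'⟩ := h'
  refine ⟨d + d', fun E hE => ?_⟩
  have h1 := hd E hE
  have h2 := hd' (E ⊓ V) (Submodule.finiteDimensional_inf_left E V)
  rw [inf_assoc] at h2
  omega

lemma SmallCodim.top : SmallCodim (⊤ : Submodule 𝕜 X) :=
  ⟨0, fun E hE => by rw [inf_top_eq]; omega⟩

lemma SmallCodim.ker {F : Type*} [AddCommGroup F] [Module 𝕜 F] [FiniteDimensional 𝕜 F] (f : X →ₗ[𝕜] F) :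
    SmallCodim (LinearMap.ker f) := by
  refine ⟨Module.finrank 𝕜 F, fun E hE => ?_⟩
  have h1 := LinearMap.finrank_range_add_finrank_ker (f.domRestrict E)
  have h2 := Submodule.finrank_le (LinearMap.range (f.domRestrict E))
  have : FiniteDimensional 𝕜 (E ⊓ LinearMap.ker f : Submodule 𝕜 X) :=
    Submodule.finiteDimensional_inf_left E _
  let j : LinearMap.ker (f.domRestrict E) →ₗ[𝕜] (E ⊓ LinearMap.ker f : Submodule 𝕜 X) :=
    LinearMap.codRestrict _ (E.subtype ∘ₗ (LinearMap.ker (f.domRestrict E)).subtype)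
      (fun c => ⟨c.1.2, LinearMap.mem_ker.mp c.2⟩)
  have h3 := LinearMap.finrank_le_finrank_of_injective (f := j) (by
    intro a b hab
    have := congrArg Subtype.val hab
    exact Subtype.ext (Subtype.ext this))
  omega

lemma hb_ext {P : Type*} [AddCommGroup P] [Module 𝕜 P] (Ψ : P →ₗ[𝕜] Y) (f : P →ₗ[𝕜] 𝕜) (C : ℝ)
    (hC : 0 ≤ C) (h : ∀ z, ‖f z‖ ≤ C * ‖Ψ z‖) :
    ∃ g : Y →L[𝕜] 𝕜, (∀ z, g (Ψ z) = f z) ∧ ‖g‖ ≤ C := by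
  obtain ⟨s, hs⟩ := Ψ.rangeRestrict.exists_rightInverse_of_surjective Ψ.range_rangeRestrict
  have hs' : ∀ y : LinearMap.range Ψ, Ψ (s y) = y := fun y =>
    congrArg Subtype.val (LinearMap.congr_fun hs y)
  have hf : ∀ z, f (s (Ψ.rangeRestrict z)) = f z := by
    intro z
    have := h (s (Ψ.rangeRestrict z) - z)
    rw [map_sub Ψ, hs'] at this
    simp only [LinearMap.codRestrict_apply, LinearMap.rangeRestrict, sub_self, norm_zero, mul_zero] at this
    have := norm_le_zero_iff.mp this
    rwa [map_sub, sub_eq_zero] at this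
  let g0 : LinearMap.range Ψ →L[𝕜] 𝕜 := (f ∘ₗ s).mkContinuous C (fun y => by
    have := h (s y)
    rwa [hs'] at this)
  obtain ⟨g, hg1, hg2⟩ := exists_extension_norm_eq (LinearMap.range Ψ) g0
  refine ⟨g, fun z => ?_, hg2.trans_le (LinearMap.mkContinuous_norm_le _ hC _)⟩
  have := hg1 (Ψ.rangeRestrict z)
  exact this.trans (hf z)
end gen

section c0
variable {𝕜 : Type*} [RCLike 𝕜]

abbrev CZ (𝕜 : Type*) [RCLike 𝕜] (α : Type*) [TopologicalSpace α] := ZeroAtInftyContinuousMap α 𝕜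

lemma cz_norm_le {α : Type*} [TopologicalSpace α] (f : CZ 𝕜 α) {C : ℝ} (hC : 0 ≤ C) :
    ‖f‖ ≤ C ↔ ∀ x, ‖f x‖ ≤ C := by
  rw [← ZeroAtInftyContinuousMap.norm_toBCF_eq_norm, BoundedContinuousFunction.norm_le hC]; rfl

lemma cz_coord {α : Type*} [TopologicalSpace α] (f : CZ 𝕜 α) (x : α) : ‖f x‖ ≤ ‖f‖ :=
  (cz_norm_le f (norm_nonneg f)).mp le_rfl x

/-- tail projection in c0 -/
noncomputable def tailC (n : ℕ) : CZ 𝕜 ℕ →L[𝕜] CZ 𝕜 ℕ :=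
  LinearMap.mkContinuous
    { toFun := fun w =>
        { toFun := fun j => if j < n then 0 else w j
          continuous_toFun := continuous_of_discreteTopology
          zero_at_infty' := by
            refine squeeze_zero_norm (a := fun j => ‖w j‖) (fun j => ?_) ?_
            · split_ifs <;> simp
            · simpa using w.zero_at_infty'.norm }
      map_add' := fun v w => by
        ext j
        show (if j < n then (0:𝕜) else v j + w j) = (if j < n then 0 else v j) + (if j < n then 0 else w j)
        split_ifs <;> simp
      map_smul' := fun c w => by
        ext j
        show (if j < n then (0:𝕜) else c • w j) = c • (if j < n then 0 else w j)
        split_ifs <;> simp } 1 (fun w => by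
      rw [one_mul, cz_norm_le _ (norm_nonneg _)]
      intro j
      show ‖(if j < n then (0:𝕜) else w j)‖ ≤ _
      split_ifs
      · simp
      · exact cz_coord w j)

lemma tailC_apply (n : ℕ) (w : CZ 𝕜 ℕ) (j : ℕ) : tailC n w j = if j < n then 0 else w j := rfl

open Filter Topology in
lemma tailC_tendsto (w : CZ 𝕜 ℕ) : Tendsto (fun n => tailC n w) atTop (𝓝 0) := by
  rw [Metric.tendsto_atTop]
  intro ε hε
  have h := w.zero_at_infty'
  rw [cocompact_eq_cofinite, Nat.cofinite_eq_atTop, Metric.tendsto_atTop] at h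
  obtain ⟨N, hN⟩ := h (ε / 2) (by positivity)
  refine ⟨N, fun n hn => ?_⟩
  rw [dist_zero_right]
  refine lt_of_le_of_lt ((cz_norm_le _ (by positivity : 0 ≤ ε / 2)).mpr fun j => ?_) (half_lt_self hε)
  rw [tailC_apply]
  split_ifs with hj
  · simp; positivity
  · have := hN j (by omega)
    rw [dist_zero_right] at this
    exact this.le

/-- coordinates in c0 -/
def evC (j : ℕ) : CZ 𝕜 ℕ →ₗ[𝕜] 𝕜 where
  toFun w := w j
  map_add' _ _ := rfl
  map_smul' _ _ := rfl

lemma c0_sep (W : Submodule 𝕜 (CZ 𝕜 ℕ)) [FiniteDimensional 𝕜 W] :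
    ∃ J : ℕ, ∀ w ∈ W, ∀ y : CZ 𝕜 ℕ, (∀ j < J, y j = 0) → ‖y‖ ≤ 3 * ‖y + w‖ := by
  obtain ⟨J, hJ⟩ := fd_small W (fun n => (tailC (𝕜 := 𝕜) n : CZ 𝕜 ℕ →ₗ[𝕜] CZ 𝕜 ℕ)) tailC_tendsto
    (1 / 2) (by norm_num)
  refine ⟨J, fun w hw y hy => ?_⟩
  have h1 : ‖w‖ ≤ ‖y + w‖ + 1 / 2 * ‖w‖ := by
    rw [cz_norm_le _ (by positivity)]
    intro j
    by_cases hj : j < J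
    · have h2 := cz_coord (y + w) j
      have h3 : (y + w) j = w j := by
        show y j + w j = w j
        rw [hy j hj, zero_add]
      rw [h3] at h2
      nlinarith [norm_nonneg w]
    · have h2 := (cz_coord (tailC J w) j).trans (hJ w hw)
      rw [tailC_apply, if_neg hj] at h2
      nlinarith [norm_nonneg (y + w)]
  have h2 : ‖y‖ ≤ ‖y + w‖ + ‖w‖ := by
    have := norm_sub_le (y + w) w
    simpa using this
  linarith
end c0

section lpa
variable {𝕜 : Type*} [RCLike 𝕜] (p : ℝ) [Fact (1 ≤ ENNReal.ofReal p)]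

abbrev LPs (𝕜 : Type*) [RCLike 𝕜] (p : ℝ) : Type _ := lp (fun _ : ℕ => 𝕜) (ENNReal.ofReal p)

/-- truncation -/
noncomputable def truncL (M : ℕ) : LPs 𝕜 p →L[𝕜] LPs 𝕜 p :=
  ∑ l ∈ Finset.range M, (lp.singleContinuousLinearMap 𝕜 (fun _ : ℕ => 𝕜) (ENNReal.ofReal p) l).comp
    (lp.evalCLM 𝕜 (fun _ : ℕ => 𝕜) (ENNReal.ofReal p) l)

lemma truncL_eq (M : ℕ) (x : LPs 𝕜 p) :
    truncL p M x = ∑ l ∈ Finset.range M, lp.single (ENNReal.ofReal p) l (x l) := by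
  unfold truncL
  rw [sum_apply]
  rfl

lemma truncL_supp (M : ℕ) (x : LPs 𝕜 p) (l : ℕ) (hl : M ≤ l) : truncL p M x l = 0 := by
  rw [truncL_eq, lp.coeFn_sum, Finset.sum_apply]
  refine Finset.sum_eq_zero fun i hi => ?_
  have : l ≠ i := by simp at hi; omega
  rw [lp.single_apply]
  simp [Pi.single_apply, this]

open Filter Topology in
lemma truncL_tendsto (x : LPs 𝕜 p) : Tendsto (fun M => x - truncL p M x) atTop (𝓝 0) := by
  have := (lp.hasSum_single (p := ENNReal.ofReal p) ENNReal.ofReal_ne_top x).tendsto_sum_nat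
  have h2 := this.const_sub x
  rw [sub_self] at h2
  simpa only [truncL_eq] using h2

lemma big_subspaces (R : LPs 𝕜 p →L[𝕜] CZ 𝕜 ℕ)
    (hR : ∃ ε : ℝ, 0 < ε ∧ ∀ n : ℕ, ∃ E : Submodule 𝕜 (LPs 𝕜 p), Module.finrank 𝕜 E = n ∧
      ∀ x ∈ E, x ≠ 0 → ε * ‖x‖ ≤ ‖R x‖) :
    ∃ ε : ℝ, 0 < ε ∧ ∀ n : ℕ, ∃ E : Submodule 𝕜 (LPs 𝕜 p), FiniteDimensional 𝕜 E ∧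
      n ≤ Module.finrank 𝕜 E ∧ (∃ M, ∀ x ∈ E, ∀ l, M ≤ l → x l = 0) ∧
      ∀ x ∈ E, ε * ‖x‖ ≤ ‖R x‖ := by
  obtain ⟨ε, hε, h⟩ := hR
  refine ⟨ε / 4, by positivity, fun n => ?_⟩
  obtain ⟨E, hE, hER⟩ := h (n + 1)
  have hfd : FiniteDimensional 𝕜 E := Module.finite_of_finrank_pos (by omega)
  set δ : ℝ := min (ε / (2 * (‖R‖ + 1))) (1 / 2) with hδd
  have hδ : 0 < δ := by positivity
  have hδ1 : δ ≤ 1 / 2 := min_le_right _ _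
  have hδ2 : ‖R‖ * δ ≤ ε / 2 := by
    have h1 : δ ≤ ε / (2 * (‖R‖ + 1)) := min_le_left _ _
    rw [le_div_iff₀ (by positivity)] at h1
    nlinarith
  obtain ⟨M, hM⟩ := fd_small E
    (fun M => ((ContinuousLinearMap.id 𝕜 _ - truncL p M : LPs 𝕜 p →L[𝕜] LPs 𝕜 p) : LPs 𝕜 p →ₗ[𝕜] LPs 𝕜 p))
    (fun x => truncL_tendsto p x) δ hδ
  have hM' : ∀ x ∈ E, ‖x - truncL p M x‖ ≤ δ * ‖x‖ := hM
  let t : E →ₗ[𝕜] LPs 𝕜 p := (truncL (𝕜 := 𝕜) p M).toLinearMap.domRestrict E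
  have ht : ∀ x, t x = truncL p M x := fun x => rfl
  have hinj : Function.Injective t := by
    rw [← LinearMap.ker_eq_bot, LinearMap.ker_eq_bot']
    intro x hx
    have h1 := hM' x x.2
    rw [← ht, hx, sub_zero] at h1
    have : ‖(x : LPs 𝕜 p)‖ ≤ 0 := by nlinarith [norm_nonneg (x : LPs 𝕜 p)]
    exact Subtype.ext (norm_le_zero_iff.mp this)
  refine ⟨LinearMap.range t, inferInstance, ?_, ⟨M, ?_⟩, ?_⟩
  · rw [LinearMap.finrank_range_of_inj hinj]; omega
  · rintro _ ⟨⟨x, hx⟩, rfl⟩ l hl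
    exact truncL_supp p M x l hl
  · rintro _ ⟨⟨x, hxE⟩, rfl⟩
    rw [ht]
    change ε / 4 * ‖truncL p M x‖ ≤ ‖R (truncL p M x)‖
    have h1 := hM' x hxE
    have h2 : ε * ‖x‖ ≤ ‖R x‖ := by
      by_cases hx : x = 0
      · rw [hx]; simp
      · exact hER x hxE hx
    have h3 : ‖R x‖ ≤ ‖R (truncL p M x)‖ + ‖R‖ * (δ * ‖x‖) := by
      have e : R x = R (truncL p M x) + R (x - truncL p M x) := by rw [← map_add]; simp
      rw [e]
      refine (norm_add_le _ _).trans ?_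
      gcongr
      exact (R.le_opNorm _).trans (by gcongr)
    have h4 : ‖truncL p M x‖ ≤ 2 * ‖x‖ := by
      have : truncL p M x = x - (x - truncL p M x) := by simp
      rw [this]
      refine (norm_sub_le _ _).trans ?_
      nlinarith [norm_nonneg x]
    nlinarith [norm_nonneg x, mul_le_mul_of_nonneg_right hδ2 (norm_nonneg x)]
end lpa


section step
variable {𝕜 : Type*} [RCLike 𝕜] (p : ℝ) [Fact (1 ≤ ENNReal.ofReal p)]

/-- initial coordinates in lp -/
noncomputable def headL (L : ℕ) : LPs 𝕜 p →ₗ[𝕜] (Fin L → 𝕜) :=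
  LinearMap.pi fun l => (lp.evalCLM 𝕜 (fun _ : ℕ => 𝕜) (ENNReal.ofReal p) (l : ℕ)).toLinearMap

lemma step16 (hp : 1 < p) (R : LPs 𝕜 p →L[𝕜] CZ 𝕜 ℕ)
    (hR : ∃ ε : ℝ, 0 < ε ∧ ∀ n : ℕ, ∃ E : Submodule 𝕜 (LPs 𝕜 p), Module.finrank 𝕜 E = n ∧
      ∀ x ∈ E, x ≠ 0 → ε * ‖x‖ ≤ ‖R x‖) :
    ∃ C C' : ℝ, 0 < C ∧ 0 < C' ∧ ∀ (n r t L : ℕ) (V : Submodule 𝕜 (LPs 𝕜 p)) (W : Submodule 𝕜 (CZ 𝕜 ℕ))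
      (θ : EuclideanSpace 𝕜 (Fin n) →ₗ[𝕜] (Fin r → 𝕜)), SmallCodim V → FiniteDimensional 𝕜 W →
      (∀ x, ‖θ x‖ ≤ ‖x‖) →
      ∃ (U : EuclideanSpace 𝕜 (Fin n) →ₗ[𝕜] LPs 𝕜 p) (b : CZ 𝕜 ℕ →L[𝕜] (Fin r → 𝕜)) (L' : ℕ),
        L ≤ L' ∧ (∀ x, U x ∈ V) ∧ (∀ x l, l < L → U x l = 0) ∧ (∀ x l, L' ≤ l → U x l = 0) ∧
        (∀ x, ‖U x‖ ≤ C * ‖x‖) ∧ (∀ x, b (R (U x)) = θ x) ∧ (∀ w ∈ W, b w = 0) ∧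
        (∀ y, ‖b y‖ ≤ C' * ‖tailC t y‖) := by
  obtain ⟨ε, hε, hbig⟩ := big_subspaces p R hR
  obtain ⟨c, C, hc, hC, hD⟩ := dvor_lp (𝕜 := 𝕜) p hp
  refine ⟨C, 3 / (ε * c), hC, by positivity, ?_⟩
  intro n r t L V W θ hV hW hθ
  let W' := W.map (tailC (𝕜 := 𝕜) t).toLinearMap
  have : FiniteDimensional 𝕜 W' := inferInstanceAs (FiniteDimensional 𝕜 (W.map _))
  obtain ⟨J, hJ⟩ := c0_sep W'
  let K := max J t
  let hd : LPs 𝕜 p →ₗ[𝕜] (Fin K → 𝕜) := (LinearMap.pi fun j : Fin K => evC (𝕜 := 𝕜) (j : ℕ)) ∘ₗ R.toLinearMap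
  have hV2 : SmallCodim (V ⊓ (LinearMap.ker (headL (𝕜 := 𝕜) p L) ⊓ LinearMap.ker hd)) :=
    hV.inf ((SmallCodim.ker _).inf (SmallCodim.ker _))
  set V2 := V ⊓ (LinearMap.ker (headL (𝕜 := 𝕜) p L) ⊓ LinearMap.ker hd) with hV2d
  obtain ⟨d, hd'⟩ := hV2
  obtain ⟨N, hN⟩ := hD n
  obtain ⟨E, hE1, hE2, ⟨M, hE3⟩, hE4⟩ := hbig (N + d)
  obtain ⟨U, hU⟩ := hN (E ⊓ V2) (Submodule.finiteDimensional_inf_left E V2)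
    (Nat.le_of_add_le_add_right (hE2.trans (hd' E hE1))) ⟨M, fun x hx => hE3 x hx.1⟩
  have hUV : ∀ x, U x ∈ V2 := fun x => (hU x).1.2
  have hUE : ∀ x, U x ∈ E := fun x => (hU x).1.1
  have hy : ∀ x, ∀ j < K, R (U x) j = 0 := by
    intro x j hj
    exact congrFun (LinearMap.mem_ker.mp (hUV x).2.2) ⟨j, hj⟩
  have hty : ∀ x, tailC t (R (U x)) = R (U x) := by
    intro x
    ext j
    rw [tailC_apply]
    split_ifs with h
    · exact (hy x j (lt_of_lt_of_le h (le_max_right _ _))).symm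
    · rfl
  let Ψ : (EuclideanSpace 𝕜 (Fin n) × W') →ₗ[𝕜] CZ 𝕜 ℕ :=
    LinearMap.coprod (R.toLinearMap ∘ₗ U) W'.subtype
  have hΨ : ∀ x w, Ψ (x, w) = R (U x) + w := fun x w => by
    simp only [Ψ, LinearMap.coprod_apply]; rfl
  have hest : ∀ x (w : W'), ‖x‖ ≤ 3 / (ε * c) * ‖Ψ (x, w)‖ := by
    intro x w
    have h1 := hJ w w.2 (R (U x)) (fun j hj => hy x j (lt_of_lt_of_le hj (le_max_left _ _)))
    have h2 := hE4 _ (hUE x)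
    have h3 := (hU x).2.1
    rw [hΨ, div_mul_eq_mul_div, le_div_iff₀ (by positivity)]
    nlinarith
  have hg : ∀ i : Fin r, ∃ g : CZ 𝕜 ℕ →L[𝕜] 𝕜, (∀ z : EuclideanSpace 𝕜 (Fin n) × W', g (Ψ z) = θ z.1 i) ∧
      ‖g‖ ≤ 3 / (ε * c) := by
    intro i
    let f : (EuclideanSpace 𝕜 (Fin n) × W') →ₗ[𝕜] 𝕜 :=
      (LinearMap.proj i ∘ₗ θ) ∘ₗ LinearMap.fst 𝕜 (EuclideanSpace 𝕜 (Fin n)) W'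
    have hfb : ∀ z, ‖f z‖ ≤ 3 / (ε * c) * ‖Ψ z‖ := by
      rintro ⟨x, w⟩
      refine le_trans ?_ (hest x w)
      exact (norm_le_pi_norm (θ x) i).trans (hθ x)
    obtain ⟨g, h1, h2⟩ := hb_ext (𝕜 := 𝕜) (Y := CZ 𝕜 ℕ) (P := EuclideanSpace 𝕜 (Fin n) × W') Ψ f (3 / (ε * c)) (by positivity) hfb
    exact ⟨g, fun z => h1 z, h2⟩
  choose g hg1 hg2 using hg
  refine ⟨U, ContinuousLinearMap.pi fun i => (g i).comp (tailC t), max L M, le_max_left _ _,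
    fun x => (hUV x).1, ?_, ?_, fun x => (hU x).2.2, ?_, ?_, ?_⟩
  · intro x l hl
    exact congrFun (LinearMap.mem_ker.mp (hUV x).2.1) ⟨l, hl⟩
  · intro x l hl
    exact hE3 _ (hUE x) l ((le_max_right _ _).trans hl)
  · intro x
    ext i
    show g i (tailC t (R (U x))) = θ x i
    rw [hty]
    have := hg1 i (x, 0)
    rwa [hΨ, Submodule.coe_zero, add_zero] at this
  · intro w hw
    ext i
    show g i (tailC t w) = 0
    have := hg1 i (0, ⟨tailC t w, Submodule.mem_map_of_mem hw⟩)
    rw [hΨ, map_zero, map_zero, zero_add] at this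
    simpa using this
  · intro y
    rw [pi_norm_le_iff_of_nonneg (by positivity)]
    intro i
    show ‖g i (tailC t y)‖ ≤ _
    exact ((g i).le_opNorm _).trans (by gcongr; exact hg2 i)

/-- state of the recursion -/
structure St16 (𝕜 : Type*) [RCLike 𝕜] (p : ℝ) [Fact (1 ≤ ENNReal.ofReal p)] where
  V : Submodule 𝕜 (LPs 𝕜 p)
  hV : SmallCodim V
  W : Submodule 𝕜 (CZ 𝕜 ℕ)
  hW : FiniteDimensional 𝕜 W
  L : ℕ

lemma sequences16 (hp : 1 < p) (R : LPs 𝕜 p →L[𝕜] CZ 𝕜 ℕ)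
    (hR : ∃ ε : ℝ, 0 < ε ∧ ∀ n : ℕ, ∃ E : Submodule 𝕜 (LPs 𝕜 p), Module.finrank 𝕜 E = n ∧
      ∀ x ∈ E, x ≠ 0 → ε * ‖x‖ ≤ ‖R x‖)
    (k : ℕ → ℕ) (θ : ∀ n : ℕ, EuclideanSpace 𝕜 (Fin (n + 1)) →ₗ[𝕜] (Fin (k n) → 𝕜))
    (hθ : ∀ n x, ‖θ n x‖ ≤ ‖x‖) :
    ∃ (C C' : ℝ) (U : ∀ n : ℕ, EuclideanSpace 𝕜 (Fin (n + 1)) →ₗ[𝕜] LPs 𝕜 p)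
      (b : ∀ n : ℕ, CZ 𝕜 ℕ →L[𝕜] (Fin (k n) → 𝕜)) (L : ℕ → ℕ), 0 < C ∧ 0 < C' ∧ Monotone L ∧
      (∀ n x l, l < L n → U n x l = 0) ∧ (∀ n x l, L (n + 1) ≤ l → U n x l = 0) ∧
      (∀ n x, ‖U n x‖ ≤ C * ‖x‖) ∧ (∀ n x, b n (R (U n x)) = θ n x) ∧
      (∀ n m x, m ≠ n → b n (R (U m x)) = 0) ∧ (∀ n y, ‖b n y‖ ≤ C' * ‖tailC n y‖) := by
  obtain ⟨C, C', hC, hC', H⟩ := step16 p hp R hR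
  have step : ∀ (n : ℕ) (s : St16 𝕜 p), ∃ (U : EuclideanSpace 𝕜 (Fin (n + 1)) →ₗ[𝕜] LPs 𝕜 p)
      (b : CZ 𝕜 ℕ →L[𝕜] (Fin (k n) → 𝕜)) (s' : St16 𝕜 p),
      (s.L ≤ s'.L ∧ s'.V ≤ s.V ∧ s.W ≤ s'.W) ∧
      (∀ x, U x ∈ s.V) ∧ (∀ x l, l < s.L → U x l = 0) ∧ (∀ x l, s'.L ≤ l → U x l = 0) ∧
      (∀ x, ‖U x‖ ≤ C * ‖x‖) ∧ (∀ x, b (R (U x)) = θ n x) ∧ (∀ w ∈ s.W, b w = 0) ∧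
      (∀ y, ‖b y‖ ≤ C' * ‖tailC n y‖) ∧ (∀ v ∈ s'.V, b (R v) = 0) ∧ (∀ x, R (U x) ∈ s'.W) := by
    intro n s
    obtain ⟨U, b, L', h1, h2, h3, h4, h5, h6, h7, h8⟩ :=
      H (n + 1) (k n) n s.L s.V s.W (θ n) s.hV s.hW (hθ n)
    have := s.hW
    refine ⟨U, b, ⟨s.V ⊓ LinearMap.ker (b.toLinearMap ∘ₗ R.toLinearMap), s.hV.inf (SmallCodim.ker _),
      s.W ⊔ LinearMap.range (R.toLinearMap ∘ₗ U), inferInstance, L'⟩,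
      ⟨h1, inf_le_left, le_sup_left⟩, h2, h3, h4, h5, h6, h7, h8, ?_, ?_⟩
    · intro v hv
      exact LinearMap.mem_ker.mp hv.2
    · intro x
      exact (le_sup_right : LinearMap.range (R.toLinearMap ∘ₗ U) ≤ s.W ⊔ _) ⟨x, rfl⟩
  choose fU fb fs h using step
  let s : ℕ → St16 𝕜 p := fun n =>
    Nat.rec ⟨⊤, SmallCodim.top, ⊥, inferInstance, 0⟩ (fun n s => fs n s) n
  have hs : ∀ n, s (n + 1) = fs n (s n) := fun n => rfl
  have hL : Monotone (fun n => (s n).L) := monotone_nat_of_le_succ fun n => (h n (s n)).1.1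
  have hVm : Antitone (fun n => (s n).V) := antitone_nat_of_succ_le fun n => (h n (s n)).1.2.1
  have hWm : Monotone (fun n => (s n).W) := monotone_nat_of_le_succ fun n => (h n (s n)).1.2.2
  refine ⟨C, C', fun n => fU n (s n), fun n => fb n (s n), fun n => (s n).L, hC, hC', hL, ?_, ?_, ?_, ?_, ?_, ?_⟩
  · intro n; exact (h n (s n)).2.2.1
  · intro n; exact (h n (s n)).2.2.2.1
  · intro n; exact (h n (s n)).2.2.2.2.1
  · intro n; exact (h n (s n)).2.2.2.2.2.1
  · intro n m x hmn
    obtain ⟨-, -, -, -, -, -, h7, -, h9, -⟩ := h n (s n)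
    obtain ⟨-, g2, -, -, -, -, -, -, -, g10⟩ := h m (s m)
    rcases lt_or_gt_of_ne hmn with hlt | hlt
    · exact h7 _ (hWm (show m + 1 ≤ n from hlt) (g10 x))
    · exact h9 _ (hVm (show n + 1 ≤ m from hlt) (g2 x))
  · intro n; exact (h n (s n)).2.2.2.2.2.2.2.1
end step


section assem
variable {𝕜 : Type*} [RCLike 𝕜] (p : ℝ) [Fact (1 ≤ ENNReal.ofReal p)]

lemma disj_norm (hp : 1 < p) (v : ℕ → LPs 𝕜 p) (hv : ∀ l n m, n ≠ m → v n l = 0 ∨ v m l = 0)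
    (s : Finset ℕ) : ‖∑ n ∈ s, v n‖ ^ p = ∑ n ∈ s, ‖v n‖ ^ p := by
  have hp0 : 0 < p := by linarith
  have ht : (ENNReal.ofReal p).toReal = p := ENNReal.toReal_ofReal (by linarith)
  have hn : ∀ w : LPs 𝕜 p, ‖w‖ ^ p = ∑' l, ‖w l‖ ^ p := by
    intro w
    have := lp.norm_rpow_eq_tsum (by rw [ht]; linarith) w
    rwa [ht] at this
  have hsm : ∀ w : LPs 𝕜 p, Summable fun l => ‖w l‖ ^ p := by
    intro w
    have := (lp.memℓp w).summable (by rw [ht]; linarith)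
    rwa [ht] at this
  simp only [hn]
  rw [← Summable.tsum_finsetSum (fun n _ => hsm (v n))]
  refine tsum_congr fun l => ?_
  rw [lp.coeFn_sum, Finset.sum_apply]
  by_cases h : ∃ n ∈ s, v n l ≠ 0
  · obtain ⟨n, hn, hne⟩ := h
    have h0 : ∀ m ∈ s, m ≠ n → v m l = 0 := fun m _ hm => (hv l m n hm).resolve_right hne
    rw [Finset.sum_eq_single n h0 (fun h => absurd hn h), Finset.sum_eq_single n
      (fun m hm hmn => by rw [h0 m hm hmn, norm_zero, Real.zero_rpow hp0.ne']) (fun h => absurd hn h)]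
  · push Not at h
    rw [Finset.sum_eq_zero h, Finset.sum_eq_zero (fun m hm => by
      rw [h m hm, norm_zero, Real.zero_rpow hp0.ne'])]
    rw [norm_zero, Real.zero_rpow hp0.ne']

abbrev Zs (𝕜 : Type*) [RCLike 𝕜] (p : ℝ) : Type _ :=
  lp (fun n : ℕ => EuclideanSpace 𝕜 (Fin (n + 1))) (ENNReal.ofReal p)

lemma sumA (hp : 1 < p) (C : ℝ) (hC : 0 < C)
    (U : ∀ n : ℕ, EuclideanSpace 𝕜 (Fin (n + 1)) →ₗ[𝕜] LPs 𝕜 p)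
    (hU : ∀ n x, ‖U n x‖ ≤ C * ‖x‖)
    (hd : ∀ n m x y l, n ≠ m → U n x l = 0 ∨ U m y l = 0) :
    ∃ A : Zs 𝕜 p →L[𝕜] LPs 𝕜 p, ∀ z, HasSum (fun n => U n (z n)) (A z) := by
  have hp0 : 0 < p := by linarith
  have ht : (ENNReal.ofReal p).toReal = p := ENNReal.toReal_ofReal (by linarith)
  have h1 : ∀ (z : Zs 𝕜 p) (s : Finset ℕ), ‖∑ n ∈ s, U n (z n)‖ ^ p ≤ C ^ p * ∑ n ∈ s, ‖z n‖ ^ p := by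
    intro z s
    rw [disj_norm p hp _ (fun l n m hnm => hd n m _ _ l hnm), Finset.mul_sum]
    refine Finset.sum_le_sum fun n _ => ?_
    rw [← Real.mul_rpow hC.le (norm_nonneg _)]
    exact Real.rpow_le_rpow (norm_nonneg _) (hU n _) hp0.le
  have hsum : ∀ z : Zs 𝕜 p, Summable fun n => U n (z n) := by
    intro z
    rw [summable_iff_vanishing_norm]
    intro ε hε
    have h2 : Summable fun n => ‖z n‖ ^ p := by
      have := (lp.memℓp z).summable (by rw [ht]; linarith)
      rwa [ht] at this
    rw [summable_iff_vanishing_norm] at h2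
    obtain ⟨s, hs⟩ := h2 ((ε / C) ^ p) (by positivity)
    refine ⟨s, fun t hts => ?_⟩
    have h3 := (le_abs_self _).trans_lt (hs t hts)
    rw [← Real.rpow_lt_rpow_iff (norm_nonneg _) hε.le hp0]
    calc _ ≤ _ := h1 z t
      _ < C ^ p * (ε / C) ^ p := by gcongr
      _ = ε ^ p := by rw [← Real.mul_rpow hC.le (by positivity)]; congr 1; field_simp
  have hbd : ∀ z : Zs 𝕜 p, ‖∑' n, U n (z n)‖ ≤ C * ‖z‖ := by
    intro z
    refine le_of_tendsto (hsum z).hasSum.norm (Filter.Eventually.of_forall fun s => ?_)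
    rw [← Real.rpow_le_rpow_iff (norm_nonneg _) (by positivity) hp0, Real.mul_rpow hC.le (norm_nonneg _)]
    refine (h1 z s).trans ?_
    gcongr
    have := lp.sum_rpow_le_norm_rpow (by rw [ht]; linarith) z s
    rwa [ht] at this
  refine ⟨LinearMap.mkContinuous
    { toFun := fun z => ∑' n, U n (z n)
      map_add' := fun z w => by
        rw [← (hsum z).tsum_add (hsum w)]
        refine tsum_congr fun n => ?_
        rw [← map_add]; rfl
      map_smul' := fun c z => by
        rw [RingHom.id_apply, ← (hsum z).tsum_const_smul c]
        refine tsum_congr fun n => ?_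
        rw [← map_smul]; rfl } C hbd, fun z => (hsum z).hasSum⟩

lemma makeB (k : ℕ → ℕ) (C' : ℝ) (hC' : 0 < C') (b : ∀ n : ℕ, CZ 𝕜 ℕ →L[𝕜] (Fin (k n) → 𝕜))
    (hb : ∀ n y, ‖b n y‖ ≤ C' * ‖tailC n y‖) :
    ∃ B : CZ 𝕜 ℕ →L[𝕜] CZ 𝕜 (Σ n : ℕ, Fin (k n)), ∀ y n i, B y ⟨n, i⟩ = b n y i := by
  have htail : ∀ n (y : CZ 𝕜 ℕ), ‖tailC n y‖ ≤ ‖y‖ := by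
    intro n y
    rw [cz_norm_le _ (norm_nonneg _)]
    intro j
    rw [tailC_apply]
    split_ifs
    · simp
    · exact cz_coord y j
  refine ⟨LinearMap.mkContinuous
    { toFun := fun y =>
        { toFun := fun q => b q.1 y q.2
          continuous_toFun := continuous_of_discreteTopology
          zero_at_infty' := by
            rw [Filter.cocompact_eq_cofinite, Metric.tendsto_nhds]
            intro ε hε
            have h := Metric.tendsto_atTop.mp (tailC_tendsto y) (ε / C') (by positivity)
            obtain ⟨N, hN⟩ := h
            rw [Filter.eventually_cofinite]
            have hfin := ((Finset.range N).sigma (fun n => (Finset.univ : Finset (Fin (k n))))).finite_toSet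
            refine hfin.subset ?_
            rintro ⟨n, i⟩ hq
            refine Finset.mem_coe.mpr (Finset.mem_sigma.mpr ⟨?_, Finset.mem_univ _⟩)
            by_contra hn
            apply hq
            have h2 := hN n (by simpa using hn)
            rw [dist_zero_right] at h2 ⊢
            refine ((norm_le_pi_norm _ _).trans (hb n y)).trans_lt ?_
            rw [lt_div_iff₀ hC'] at h2
            linarith }
      map_add' := fun y z => by
        ext q
        show b q.1 (y + z) q.2 = b q.1 y q.2 + b q.1 z q.2
        rw [map_add]; rfl
      map_smul' := fun c y => by
        ext q
        show b q.1 (c • y) q.2 = c • b q.1 y q.2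
        rw [map_smul]; rfl } C' (fun y => by
      rw [cz_norm_le _ (by positivity)]
      rintro ⟨n, i⟩
      show ‖b n y i‖ ≤ _
      exact ((norm_le_pi_norm _ _).trans (hb n y)).trans (by gcongr; exact htail n y)), fun y n i => rfl⟩
end assem

lemma main16 (𝕜 : Type*) [RCLike 𝕜] (p : ℝ) (hp : 1 < p)
    [Fact (1 ≤ ENNReal.ofReal p)]
    (k : ℕ → ℕ)
    (θ : ∀ n : ℕ, EuclideanSpace 𝕜 (Fin (n + 1)) →ₗ[𝕜] (Fin (k n) → 𝕜))
    (hθ : ∀ n x, ‖θ n x‖ ≤ ‖x‖)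
    (R : LPs 𝕜 p →L[𝕜] CZ 𝕜 ℕ)
    (hR : ∃ ε : ℝ, 0 < ε ∧ ∀ n : ℕ, ∃ E : Submodule 𝕜 (LPs 𝕜 p), Module.finrank 𝕜 E = n ∧
      ∀ x ∈ E, x ≠ 0 → ε * ‖x‖ ≤ ‖R x‖) :
    ∃ (A : Zs 𝕜 p →L[𝕜] LPs 𝕜 p) (B : CZ 𝕜 ℕ →L[𝕜] CZ 𝕜 (Σ n : ℕ, Fin (k n))),
      ∀ z n i, B (R (A z)) ⟨n, i⟩ = θ n (z n) i := by
  obtain ⟨C, C', U, b, L, hC, hC', hL, h1, h2, h3, h4, h5, h6⟩ := sequences16 p hp R hR k θ hθ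
  have key : ∀ n m x y l, n < m → U n x l = 0 ∨ U m y l = 0 := by
    intro n m x y l hnm
    rcases lt_or_ge l (L m) with h | h
    · exact Or.inr (h1 m y l h)
    · exact Or.inl (h2 n x l ((hL (show n + 1 ≤ m from hnm)).trans h))
  obtain ⟨A, hA⟩ := sumA p hp C hC U h3 (by
    intro n m x y l hnm
    rcases lt_or_gt_of_ne hnm with h | h
    · exact key n m x y l h
    · exact (key m n y x l h).symm)
  obtain ⟨B, hB⟩ := makeB k C' hC' b h6
  refine ⟨A, B, fun z n i => ?_⟩
  rw [hB]
  have hs := ((b n).comp R).hasSum (hA z)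
  have hs2 : HasSum (fun m => ((b n).comp R) (U m (z m))) (θ n (z n)) := by
    rw [← h4 n (z n)]
    exact hasSum_single (f := fun m => ((b n).comp R) (U m (z m))) n (fun m hm => h5 n m (z m) hm)
  exact congrFun (hs.unique hs2) i

/-- let `1 < p < ∞`, let `Z_p = (⊕_{n ≥ 1} ℓ₂ⁿ)_{ℓ_p}`, fix an isomorphism
`D : ℓ_p ≃ Z_p`, integers `k n` and `2`-embeddings `θ n : ℓ₂ⁿ → ℓ_∞^{k n}`, and let
`Θ : Z_p → (⊕_{n ≥ 1} ℓ_∞^{k n})_{c₀}` be the bounded operator acting blockwise by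
`θ n` (here `(⊕ ℓ_∞^{k n})_{c₀}` is realized as the space of functions on `Σ n, Fin (k n)`
vanishing at infinity).  If `R ∈ L(ℓ_p, c₀)` is not finitely strictly singular, then
`T = Θ ∘ D` factors through `R`. -/
theorem statement16 (𝕜 : Type*) [RCLike 𝕜] (p : ℝ) (hp : 1 < p)
    [Fact (1 ≤ ENNReal.ofReal p)]
    (k : ℕ → ℕ)
    (θ : ∀ n : ℕ, EuclideanSpace 𝕜 (Fin (n + 1)) →ₗ[𝕜] (Fin (k n) → 𝕜))
    (hθ : ∀ (n : ℕ) (x : EuclideanSpace 𝕜 (Fin (n + 1))),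
      ‖x‖ / 2 ≤ ‖θ n x‖ ∧ ‖θ n x‖ ≤ ‖x‖)
    (D : lp (fun _ : ℕ => 𝕜) (ENNReal.ofReal p) ≃L[𝕜]
      lp (fun n : ℕ => EuclideanSpace 𝕜 (Fin (n + 1))) (ENNReal.ofReal p))
    (Θ : lp (fun n : ℕ => EuclideanSpace 𝕜 (Fin (n + 1))) (ENNReal.ofReal p) →L[𝕜]
      ZeroAtInftyContinuousMap (Σ n : ℕ, Fin (k n)) 𝕜)
    (hΘ : ∀ (z : lp (fun n : ℕ => EuclideanSpace 𝕜 (Fin (n + 1))) (ENNReal.ofReal p))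
      (n : ℕ) (i : Fin (k n)), Θ z ⟨n, i⟩ = θ n (z n) i)
    (R : lp (fun _ : ℕ => 𝕜) (ENNReal.ofReal p) →L[𝕜] ZeroAtInftyContinuousMap ℕ 𝕜)
    (hR : ¬ FinStrictSing R) :
    ∃ (A : lp (fun _ : ℕ => 𝕜) (ENNReal.ofReal p) →L[𝕜]
        lp (fun _ : ℕ => 𝕜) (ENNReal.ofReal p))
      (B : ZeroAtInftyContinuousMap ℕ 𝕜 →L[𝕜]
        ZeroAtInftyContinuousMap (Σ n : ℕ, Fin (k n)) 𝕜),
      Θ.comp (D : lp (fun _ : ℕ => 𝕜) (ENNReal.ofReal p) →L[𝕜]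
        lp (fun n : ℕ => EuclideanSpace 𝕜 (Fin (n + 1))) (ENNReal.ofReal p))
        = B.comp (R.comp A) := by
  have hR' : ∃ ε : ℝ, 0 < ε ∧ ∀ n : ℕ, ∃ E : Submodule 𝕜 (LPs 𝕜 p), Module.finrank 𝕜 E = n ∧
      ∀ x ∈ E, x ≠ 0 → ε * ‖x‖ ≤ ‖R x‖ := by
    unfold FinStrictSing at hR
    push Not at hR
    exact hR
  obtain ⟨A, B, hAB⟩ := main16 𝕜 p hp k θ (fun n x => (hθ n x).2) R hR'
  refine ⟨A.comp (D : lp (fun _ : ℕ => 𝕜) (ENNReal.ofReal p) →L[𝕜]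
        lp (fun n : ℕ => EuclideanSpace 𝕜 (Fin (n + 1))) (ENNReal.ofReal p)), B, ?_⟩
  ext z q
  obtain ⟨n, i⟩ := q
  show Θ (D z) ⟨n, i⟩ = B (R (A (D z))) ⟨n, i⟩
  rw [hΘ, hAB]

end
end
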